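/- Let Z ⊆ ℙ^{r'} (over ℂ) be a smooth Severi variety (so Z is projectable with dim(Z) = (2/3)(r' − 2)), and let Y ⊆ ℙ^r, r = r' − 1, be its generic projection. Then Y is smooth, non-projectable, dim(Y) = (2/3)(r − 1), and Y does NOT have the irreducible secant cone (ISC) property. In particular the bound dim(Y) > (2/3)(r − 1) in Corollary 3 is sharp. -/

import Mathlib

/- Background for [Lopez-Ran, "On the irreducibility of secant cones, and an application
to linear normality"]: a concrete model of complex projective geometry.  Projective space
`ℙ^r(ℂ)` is the projectivization of `ℂ^{r+1}`, equipped with the Zariski topology;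
subvarieties are (closed, irreducible) subsets; tangent spaces, smoothness, the invariant
`σ(Y)`, secant varieties/cones, generic linear projections and their double loci, and
linear normality are all defined from first principles below. -/

open MvPolynomial Set

noncomputable section

/-- Complex projective space of lines in `ℂⁿ` (so of projective dimension `n - 1`). -/
abbrev PrV (n : ℕ) : Type := Projectivization ℂ (Fin n → ℂ)

/-- `ℙ^r` over `ℂ`. -/
abbrev Pr (r : ℕ) : Type := PrV (r + 1)

/-- The vanishing locus in projective space of a polynomial, defined via all nonzero lifts
(for a homogeneous polynomial this is the usual projective zero locus). -/
def pZero {n : ℕ} (f : MvPolynomial (Fin n) ℂ) : Set (PrV n) :=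
  {x | ∀ v : Fin n → ℂ, ∀ hv : v ≠ 0, Projectivization.mk ℂ v hv = x → eval v f = 0}

/-- The Zariski topology on complex projective space. -/
instance prTop (n : ℕ) : TopologicalSpace (PrV n) :=
  TopologicalSpace.generateFrom {U | ∃ f : MvPolynomial (Fin n) ℂ, U = (pZero f)ᶜ}

/-- The Zariski topology on the affine space `ℂ^σ`. -/
def affTop (σ : Type) : TopologicalSpace (σ → ℂ) :=
  TopologicalSpace.generateFrom {U | ∃ f : MvPolynomial σ ℂ, U = {v | eval v f ≠ 0}}

/-- A property holds generically (on a dense Zariski-open set) on the affine space `ℂ^σ`. -/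
def GenericAff {σ : Type} (P : (σ → ℂ) → Prop) : Prop :=
  ∃ U : Set (σ → ℂ), @IsOpen _ (affTop σ) U ∧ @Dense _ (affTop σ) U ∧ ∀ v ∈ U, P v

/-- The projective line through two points (their linear span); for `x = y` this is `{x}`. -/
def lineThrough {n : ℕ} (x y : PrV n) : Set (PrV n) :=
  {z | z.rep ∈ Submodule.span ℂ ({x.rep, y.rep} : Set (Fin n → ℂ))}

/-- The projective linear subspace associated to a linear subspace `W ⊆ ℂⁿ`. -/
def projSub {n : ℕ} (W : Submodule ℂ (Fin n → ℂ)) : Set (PrV n) := {x | x.rep ∈ W}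

/-- The secant variety of `Y`: the (closure of the) union of all lines spanned by pairs of
distinct points of `Y`, i.e. the union of all secant lines of `Y`. -/
def secantVariety {n : ℕ} (Y : Set (PrV n)) : Set (PrV n) :=
  closure (⋃ x ∈ Y, ⋃ y ∈ Y, ⋃ _ : x ≠ y, lineThrough x y)

/-- `Y` is projectable if its secant variety is not all of projective space. -/
def Projectable {n : ℕ} (Y : Set (PrV n)) : Prop := secantVariety Y ≠ Set.univ

/-- Hyperplanes in projective space. -/
def IsHyperplane {n : ℕ} (H : Set (PrV n)) : Prop :=
  ∃ φ : (Fin n → ℂ) →ₗ[ℂ] ℂ, φ ≠ 0 ∧ H = {x | φ x.rep = 0}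

/-- A set in projective space is nondegenerate if it is contained in no hyperplane. -/
def NondegenerateSet {n : ℕ} (Y : Set (PrV n)) : Prop :=
  ∀ H : Set (PrV n), IsHyperplane H → ¬ Y ⊆ H

/-- Dimension of a subset of projective space: the Krull dimension of the subspace
topology. -/
def pdim {n : ℕ} (S : Set (PrV n)) : WithBot ℕ∞ := topologicalKrullDim S

/-- The homogeneous ideal of `Y` (as a set): all polynomials all of whose lifts vanish on
the affine cone of `Y`. -/
def homIdeal {n : ℕ} (Y : Set (PrV n)) : Set (MvPolynomial (Fin n) ℂ) := {f | Y ⊆ pZero f}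

/-- The differential of a polynomial at a point of `ℂⁿ`, as a linear form. -/
def jacLin {n : ℕ} (f : MvPolynomial (Fin n) ℂ) (v : Fin n → ℂ) : (Fin n → ℂ) →ₗ[ℂ] ℂ :=
  ∑ i, eval v (pderiv i f) • LinearMap.proj i

/-- The affine tangent space of the cone over `Y` at `v`: the common kernel of the
differentials of all elements of the homogeneous ideal of `Y`. -/
def affTangent {n : ℕ} (Y : Set (PrV n)) (v : Fin n → ℂ) : Submodule ℂ (Fin n → ℂ) :=
  ⨅ f ∈ homIdeal Y, LinearMap.ker (jacLin f v)

/-- The embedded projective tangent space `T_x Y ⊆ ℙⁿ⁻¹`. -/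
def projTangent {n : ℕ} (Y : Set (PrV n)) (x : PrV n) : Set (PrV n) :=
  projSub (affTangent Y x.rep)

/-- `x` is a smooth point of `Y` if the affine tangent space of the cone has the expected
dimension `dim Y + 1`. -/
def IsSmoothPt {n : ℕ} (Y : Set (PrV n)) (x : PrV n) : Prop :=
  ((Module.finrank ℂ (affTangent Y x.rep) : ℕ∞) : WithBot ℕ∞) = pdim Y + 1

/-- The smooth locus `Y_smooth` of `Y`. -/
def smoothLocus {n : ℕ} (Y : Set (PrV n)) : Set (PrV n) := {x ∈ Y | IsSmoothPt Y x}

/-- The singular locus of `Y`. -/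
def singLocus {n : ℕ} (Y : Set (PrV n)) : Set (PrV n) := Y \ smoothLocus Y

/-- `Y` is smooth if every point of `Y` is a smooth point. -/
def IsSmoothSet {n : ℕ} (Y : Set (PrV n)) : Prop := ∀ x ∈ Y, IsSmoothPt Y x

/-- A divisor on `Y`: an irreducible closed subvariety of `Y` of codimension one. -/
def IsDivisorOn {n : ℕ} (W Y : Set (PrV n)) : Prop :=
  W ⊆ Y ∧ IsIrreducible W ∧ closure W ∩ Y = W ∧ pdim W + 1 = pdim Y

/-- `σ(Y)`: the maximal dimension of a subvariety `Z` of the smooth locus of `Y` which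
contains a generic point of some divisor on `Y` (i.e. is dense in some divisor), and such
that all embedded tangent spaces `T_y Y`, `y ∈ Z`, lie in a fixed hyperplane. -/
def sigmaY {n : ℕ} (Y : Set (PrV n)) : WithBot ℕ∞ :=
  sSup { d | ∃ Z : Set (PrV n), Z ⊆ smoothLocus Y ∧ IsIrreducible Z ∧
      (∃ W, IsDivisorOn W Y ∧ W ⊆ closure (Z ∩ W)) ∧
      (∃ H, IsHyperplane H ∧ ∀ y ∈ Z, projTangent Y y ⊆ H) ∧ pdim Z = d }

/-- The ideal of polynomials vanishing (in all lifts) on the affine cone over `Y`. -/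
def idealOf {n : ℕ} (Y : Set (PrV n)) : Ideal (MvPolynomial (Fin n) ℂ) where
  carrier := homIdeal Y
  add_mem' := by
    intro f g hf hg x hx v hv hvx
    have h1 := hf hx v hv hvx
    have h2 := hg hx v hv hvx
    simp [map_add, h1, h2]
  zero_mem' := by intro x hx v hv hvx; simp
  smul_mem' := by
    intro c f hf x hx v hv hvx
    have h1 := hf hx v hv hvx
    simp [smul_eq_mul, map_mul, h1]

instance kerEvalPrime {n : ℕ} (v : Fin n → ℂ) :
    (RingHom.ker ((aeval v : MvPolynomial (Fin n) ℂ →ₐ[ℂ] ℂ) :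
      MvPolynomial (Fin n) ℂ →+* ℂ)).IsPrime :=
  RingHom.ker_isPrime _

/-- The local ring of the affine space `ℂⁿ` at the point `v`. -/
abbrev polyAtPoint {n : ℕ} (v : Fin n → ℂ) : Type :=
  Localization.AtPrime (RingHom.ker ((aeval v : MvPolynomial (Fin n) ℂ →ₐ[ℂ] ℂ) :
    MvPolynomial (Fin n) ℂ →+* ℂ))

/-- The local ring of the affine cone over `Y` at a (nonzero) point `v` of the cone. -/
abbrev coneLocalRing {n : ℕ} (Y : Set (PrV n)) (v : Fin n → ℂ) : Type :=
  polyAtPoint v ⧸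
    (Ideal.map (algebraMap (MvPolynomial (Fin n) ℂ) (polyAtPoint v)) (idealOf Y))

/-- A normal (irreducible, closed) subvariety of projective space: all local rings of its
affine cone at points of the punctured cone are integrally closed domains. -/
def IsNormalVariety {n : ℕ} (Y : Set (PrV n)) : Prop :=
  IsClosed Y ∧ IsIrreducible Y ∧
    ∀ x ∈ Y, IsDomain (coneLocalRing Y x.rep) ∧ IsIntegrallyClosed (coneLocalRing Y x.rep)

/-- The scheme-theoretic double locus of the projection of `Y` away from the projective
linear subspace `ℙ(W)`: points `y ∈ Y` such that the fibre of the projection through `y`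
(the span of `ℙ(W)` and `y`) meets `Y` in a subscheme different from the single reduced
point `y`: either it contains a second point of `Y`, or it is tangent to `Y` at `y`. -/
def doubleLocus {r : ℕ} (Y : Set (Pr r)) (W : Submodule ℂ (Fin (r+1) → ℂ)) : Set (Pr r) :=
  {y | y ∈ Y ∧
    ((∃ y' ∈ Y, y' ≠ y ∧ y'.rep ∈ W ⊔ Submodule.span ℂ {y.rep}) ∨
      affTangent Y y.rep ⊓ (W ⊔ Submodule.span ℂ {y.rep}) ≠ Submodule.span ℂ {y.rep})}

/-- The linear subspace spanned by a `(k+1)`-tuple of vectors of `ℂ^{r+1}` (used to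
parametrize generic linear subspaces of projective dimension `k`). -/
def spanOfTuple {r k : ℕ} (v : Fin (k+1) × Fin (r+1) → ℂ) :
    Submodule ℂ (Fin (r+1) → ℂ) :=
  Submodule.span ℂ (Set.range fun i : Fin (k+1) => fun j => v (i, j))

/-- The secant cone of `Y` at `z`: the closure of the union of all secant lines of `Y`
passing through `z`. -/
def secantCone {r : ℕ} (Y : Set (Pr r)) (z : Pr r) : Set (Pr r) :=
  closure (⋃ x ∈ Y, ⋃ y ∈ Y, ⋃ _ : x ≠ y, ⋃ _ : z ∈ lineThrough x y, lineThrough x y)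

/-- `Y` has the irreducible secant cone (ISC) property: the secant cone of `Y` at a generic
point of `ℙ^r` (equivalently, the generic fibre of `f : I_Y → ℙ^r`) is irreducible. -/
def ISC {r : ℕ} (Y : Set (Pr r)) : Prop :=
  ∃ U : Set (Pr r), IsOpen U ∧ Dense U ∧ ∀ z ∈ U, IsIrreducible (secantCone Y z)

/-- The outer (Segre) product of two vectors. -/
def outerVec {a b : ℕ} (v : Fin a → ℂ) (w : Fin b → ℂ) : Fin (a * b) → ℂ :=
  fun k => v (finProdFinEquiv.symm k).1 * w (finProdFinEquiv.symm k).2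

lemma outerVec_ne_zero {a b : ℕ} {v : Fin a → ℂ} {w : Fin b → ℂ}
    (hv : v ≠ 0) (hw : w ≠ 0) : outerVec v w ≠ 0 := by
  obtain ⟨i, hi⟩ := Function.ne_iff.mp hv
  obtain ⟨j, hj⟩ := Function.ne_iff.mp hw
  intro h
  have h2 := congrFun h (finProdFinEquiv (i, j))
  simp only [outerVec, Equiv.symm_apply_apply, Pi.zero_apply] at h2
  rcases mul_eq_zero.mp h2 with h3 | h3
  · exact hi h3
  · exact hj h3

/-- The Segre embedding of a product of projective spaces. -/
def segre {a b : ℕ} (p : PrV a × PrV b) : PrV (a * b) :=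
  Projectivization.mk ℂ (outerVec p.1.rep p.2.rep)
    (outerVec_ne_zero p.1.rep_nonzero p.2.rep_nonzero)

/-- The Zariski topology on a product of two projective spaces (induced via the Segre
embedding). -/
def pairTop (r : ℕ) : TopologicalSpace (Pr r × Pr r) :=
  TopologicalSpace.induced segre (prTop ((r+1) * (r+1)))

/-- Zariski closure in the product of two projective spaces. -/
def closureP {r : ℕ} (S : Set (Pr r × Pr r)) : Set (Pr r × Pr r) :=
  segre ⁻¹' closure (segre '' S)

/-- Zariski irreducibility of a subset of the product of two projective spaces. -/
def IsIrreducibleP {r : ℕ} (S : Set (Pr r × Pr r)) : Prop :=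
  IsIrreducible (closure (segre '' S))

/-- Zariski connectedness of a subset of the product of two projective spaces. -/
def IsConnectedP {r : ℕ} (S : Set (Pr r × Pr r)) : Prop :=
  IsConnected (segre '' S)

/-- Dimension of a subset of the product of two projective spaces. -/
def pdimP {r : ℕ} (S : Set (Pr r × Pr r)) : WithBot ℕ∞ := pdim (segre '' S)

/-- The (ordered-pairs model of the) fibre of `f : I_Y → ℙ^r` over `z ∈ ℙ^r`: pairs of
distinct points of `Y` whose secant line passes through `z`, together with limits of such
(the secant cone of `Y` at `z`, upstairs). -/
def secPairs {r : ℕ} (Y : Set (Pr r)) (z : Pr r) : Set (Pr r × Pr r) :=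
  {p | p.1 ∈ Y ∧ p.2 ∈ Y ∧ p.1 ≠ p.2 ∧ z ∈ lineThrough p.1 p.2}

/-- The fibre of `f : I_Y → ℙ^r` over `z` (with its limit points). -/
def secFiber {r : ℕ} (Y : Set (Pr r)) (z : Pr r) : Set (Pr r × Pr r) :=
  closureP (secPairs Y z)

/-- The linear map `ℂ^b → ℂ^a` given by a matrix of coefficients. -/
def matLin {a b : ℕ} (w : Fin a × Fin b → ℂ) : (Fin b → ℂ) →ₗ[ℂ] (Fin a → ℂ) :=
  Matrix.mulVecLin (Matrix.of fun i j => w (i, j))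

/-- The image of a subset of `ℙ^{b-1}` under the linear projection `ℙ^{b-1} ⇢ ℙ^{a-1}`
given by a matrix. -/
def projImage {a b : ℕ} (w : Fin a × Fin b → ℂ) (Z : Set (PrV b)) : Set (PrV a) :=
  {z | ∃ x ∈ Z, ∃ c : ℂ, c ≠ 0 ∧ z.rep = c • matLin w x.rep}

/-- `X ⊆ ℙ^N` is the image of `X̃ ⊆ ℙ^{N+1}` under a bijective projection from a point
`Q ∉ X̃` (the centre `Q` being the projectivized kernel of the surjective linear map `L`). -/
def IsBijectiveProjectionOf {N : ℕ} (X : Set (Pr N)) (Xt : Set (Pr (N+1))) : Prop :=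
  ∃ L : (Fin (N+2) → ℂ) →ₗ[ℂ] (Fin (N+1) → ℂ), Function.Surjective L ∧
    (∀ x ∈ Xt, L x.rep ≠ 0) ∧
    X = {z | ∃ x ∈ Xt, ∃ c : ℂ, c ≠ 0 ∧ z.rep = c • L x.rep} ∧
    (∀ x ∈ Xt, ∀ y ∈ Xt, (∃ c : ℂ, L x.rep = c • L y.rep) → x = y)

/-- `X ⊆ ℙ^N` is linearly normal if it is not the image, under a bijective projection from
a point, of a nondegenerate subvariety of `ℙ^{N+1}`. -/
def LinearlyNormal {N : ℕ} (X : Set (Pr N)) : Prop :=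
  ¬ ∃ Xt : Set (Pr (N+1)), IsClosed Xt ∧ IsIrreducible Xt ∧ NondegenerateSet Xt ∧
      IsBijectiveProjectionOf X Xt

/-- Extension by zero `ℂ^a → ℂ^b` (for `a ≤ b`). -/
def padMap (a b : ℕ) : (Fin a → ℂ) →ₗ[ℂ] (Fin b → ℂ) where
  toFun v := fun j => if h : (j : ℕ) < a then v ⟨j, h⟩ else 0
  map_add' v w := by funext j; by_cases h : (j : ℕ) < a <;> simp [h]
  map_smul' c v := by funext j; by_cases h : (j : ℕ) < a <;> simp [h]

lemma padMap_ne_zero {a b : ℕ} (hab : a ≤ b) {v : Fin a → ℂ} (hv : v ≠ 0) :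
    padMap a b v ≠ 0 := by
  obtain ⟨i, hi⟩ := Function.ne_iff.mp hv
  intro h
  have h2 := congrFun h ⟨i, lt_of_lt_of_le i.isLt hab⟩
  simp only [padMap, LinearMap.coe_mk, AddHom.coe_mk, Pi.zero_apply] at h2
  rw [dif_pos i.isLt] at h2
  exact hi (by simpa using h2)

/-- A point of `ℙ^{a-1}` viewed in `ℙ^{b-1}` via the inclusion of the first `a`
coordinates. -/
def embPt {a b : ℕ} (hab : a ≤ b) (x : PrV a) : PrV b :=
  Projectivization.mk ℂ (padMap a b x.rep) (padMap_ne_zero hab x.rep_nonzero)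

/-- The join of two subsets of projective space: the union of all lines joining a point of
`A` to a point of `B`. -/
def joinSets {n : ℕ} (A B : Set (PrV n)) : Set (PrV n) :=
  ⋃ x ∈ A, ⋃ y ∈ B, lineThrough x y



/-- transcendence degree over ℂ as a natural number -/
def td (A : Type) [CommRing A] [Algebra ℂ A] : ℕ := (Algebra.trdeg ℂ A).toNat

lemma td_cast (A : Type) [CommRing A] [Algebra ℂ A] [Algebra.FiniteType ℂ A] :
    ((td A : ℕ) : Cardinal) = Algebra.trdeg ℂ A :=
  Cardinal.cast_toNat_of_lt_aleph0 (_root_.trdeg_lt_aleph0_of_finiteType)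

lemma td_le_of_injective {A B : Type} [CommRing A] [Algebra ℂ A] [Algebra.FiniteType ℂ A]
    [CommRing B] [Algebra ℂ B] [Algebra.FiniteType ℂ B] (f : A →ₐ[ℂ] B)
    (hf : Function.Injective f) : td A ≤ td B := by
  have := _root_.trdeg_le_of_injective f hf
  rw [← td_cast, ← td_cast] at this
  exact_mod_cast this

lemma td_le_of_surjective {A B : Type} [CommRing A] [Algebra ℂ A] [Algebra.FiniteType ℂ A]
    [CommRing B] [Algebra ℂ B] [Algebra.FiniteType ℂ B] (f : A →ₐ[ℂ] B)
    (hf : Function.Surjective f) : td B ≤ td A := by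
  have := _root_.trdeg_le_of_surjective f hf
  rw [← td_cast, ← td_cast] at this
  exact_mod_cast this

lemma td_mvPoly (σ : Type) [Fintype σ] : td (MvPolynomial σ ℂ) = Fintype.card σ := by
  simp [td]

/-- points with prescribed properties -/
lemma exists_pt {A : Type} [CommRing A] [Algebra ℂ A] [Algebra.FiniteType ℂ A]
    (I : Ideal A) (hI : I ≠ ⊤) : ∃ ξ : A →ₐ[ℂ] ℂ, ∀ a ∈ I, ξ a = 0 := by
  obtain ⟨M, hM, hIM⟩ := I.exists_le_maximal hI
  let _ : Field (A ⧸ M) := Ideal.Quotient.field M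
  have : Algebra.FiniteType ℂ (A ⧸ M) := inferInstance
  have hfin : Module.Finite ℂ (A ⧸ M) := finite_of_finite_type_of_isJacobsonRing _ _
  have hbij : Function.Bijective (algebraMap ℂ (A ⧸ M)) :=
    IsAlgClosed.algebraMap_bijective_of_isIntegral
  let e : ℂ ≃ₐ[ℂ] (A ⧸ M) := AlgEquiv.ofBijective (Algebra.ofId ℂ (A ⧸ M)) hbij
  refine ⟨(e.symm : (A ⧸ M) →ₐ[ℂ] ℂ).comp (Ideal.Quotient.mkₐ ℂ M), fun a ha => ?_⟩
  have : Ideal.Quotient.mkₐ ℂ M a = 0 := Ideal.Quotient.eq_zero_iff_mem.mpr (hIM ha)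
  simp only [AlgHom.comp_apply, this, map_zero]

lemma exists_pt_ne {A : Type} [CommRing A] [Algebra ℂ A] [Algebra.FiniteType ℂ A]
    (P : Ideal A) [P.IsPrime] {g : A} (hg : g ∉ P) :
    ∃ ξ : A →ₐ[ℂ] ℂ, (∀ a ∈ P, ξ a = 0) ∧ ξ g ≠ 0 := by
  obtain ⟨ξ, hξ⟩ := exists_pt (A := Localization.Away g)
    (P.map (algebraMap A (Localization.Away g))) (by
      have := IsLocalization.isPrime_of_isPrime_disjoint (Submonoid.powers g)
        (Localization.Away g) P inferInstance (by
          rw [Set.disjoint_left]; rintro _ ⟨n, rfl⟩ h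
          exact hg ((inferInstance : P.IsPrime).mem_of_pow_mem n h))
      exact this.ne_top)
  refine ⟨ξ.comp (IsScalarTower.toAlgHom ℂ A _), fun a ha => hξ _ (Ideal.mem_map_of_mem _ ha), ?_⟩
  have hu : IsUnit (algebraMap A (Localization.Away g) g) :=
    IsLocalization.Away.algebraMap_isUnit g
  exact (hu.map ξ).ne_zero

lemma eq_zero_of_pts {A : Type} [CommRing A] [IsDomain A] [Algebra ℂ A] [Algebra.FiniteType ℂ A]
    {a : A} (h : ∀ ξ : A →ₐ[ℂ] ℂ, ξ a = 0) : a = 0 := by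
  by_contra ha
  obtain ⟨ξ, -, h2⟩ := exists_pt_ne (⊥ : Ideal A) (g := a) (by simpa using ha)
  exact h2 (h ξ)

instance ker_pt_max {A : Type} [CommRing A] [Algebra ℂ A] (ξ : A →ₐ[ℂ] ℂ) :
    (RingHom.ker ξ).IsMaximal :=
  RingHom.ker_isMaximal_of_surjective ξ fun c => ⟨algebraMap ℂ A c, by simp⟩

lemma height_max_mvPoly (s : ℕ) (M : Ideal (MvPolynomial (Fin s) ℂ)) (hM : M.IsMaximal) :
    M.height = s := by
  have hdim : ringKrullDim (MvPolynomial (Fin s) ℂ) = ((s : ℕ∞) : WithBot ℕ∞) := by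
    rw [MvPolynomial.ringKrullDim_of_isNoetherianRing]; simp
  have hfin : FiniteRingKrullDim (MvPolynomial (Fin s) ℂ) := by
    rw [finiteRingKrullDim_iff_ne_bot_and_top, hdim]
    exact ⟨by simp, by exact_mod_cast (ENat.natCast_ne_top s)⟩
  obtain ⟨M0, hM0, h0⟩ := Ideal.exists_isMaximal_height (R := MvPolynomial (Fin s) ℂ)
  obtain ⟨ξ, hξ⟩ := exists_pt M hM.ne_top
  obtain ⟨ξ0, hξ0⟩ := exists_pt M0 hM0.ne_top
  have e1 : M = RingHom.ker ξ := hM.eq_of_le (RingHom.ker_ne_top _) hξ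
  have e0 : M0 = RingHom.ker ξ0 := hM0.eq_of_le (RingHom.ker_ne_top _) hξ0
  let φ : MvPolynomial (Fin s) ℂ →ₐ[ℂ] MvPolynomial (Fin s) ℂ :=
    aeval fun i => X i + C (ξ (X i) - ξ0 (X i))
  let ψ : MvPolynomial (Fin s) ℂ →ₐ[ℂ] MvPolynomial (Fin s) ℂ :=
    aeval fun i => X i - C (ξ (X i) - ξ0 (X i))
  let e : MvPolynomial (Fin s) ℂ ≃ₐ[ℂ] MvPolynomial (Fin s) ℂ :=
    AlgEquiv.ofAlgHom φ ψ (by ext i; simp [φ, ψ, algHom_C])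
      (by ext i; simp [φ, ψ, algHom_C])
  have hc : M = M0.comap (e : MvPolynomial (Fin s) ℂ ≃+* MvPolynomial (Fin s) ℂ) := by
    rw [e1, e0]
    have : ξ = ξ0.comp φ := by
      ext i; simp [φ, algHom_C]
    ext x
    rw [RingHom.mem_ker, this]
    rfl
  rw [hc, RingEquiv.height_comap]
  have : (M0.height : WithBot ℕ∞) = ((s : ℕ∞) : WithBot ℕ∞) := by
    rw [h0, hdim]
  exact_mod_cast this

lemma height_max {A : Type} [CommRing A] [IsDomain A] [Algebra ℂ A] [Algebra.FiniteType ℂ A]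
    (M : Ideal A) [hM : M.IsMaximal] : M.height = td A := by
  obtain ⟨s, g, hinj, hint⟩ := exists_integral_inj_algHom_of_fg ℂ A
  algebraize [g.toRingHom]
  have : FaithfulSMul (MvPolynomial (Fin s) ℂ) A :=
    (faithfulSMul_iff_algebraMap_injective _ _).mpr hinj
  have : Algebra.IsIntegral (MvPolynomial (Fin s) ℂ) A := ⟨hint⟩
  have hN : IsNoetherianRing A := Algebra.FiniteType.isNoetherianRing ℂ A
  have hp : (M.under (MvPolynomial (Fin s) ℂ)).IsMaximal := inferInstance
  have h1 := Ideal.height_eq_height_add_of_liesOver_of_hasGoingDown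
    (M.under (MvPolynomial (Fin s) ℂ)) M
  rw [height_max_mvPoly _ _ hp] at h1
  have hT : IsScalarTower ℂ (MvPolynomial (Fin s) ℂ) A := IsScalarTower.of_algHom g
  have h2 := _root_.trdeg_add_eq (R := ℂ) (S := MvPolynomial (Fin s) ℂ) (A := A)
  rw [(_root_.trdeg_eq_zero : Algebra.trdeg (MvPolynomial (Fin s) ℂ) A = 0), add_zero] at h2
  have h3 : td A = s := by
    rw [td, ← h2]; simp
  rw [h1, h3]
  have h4 : (M.map (Ideal.Quotient.mk ((M.under (MvPolynomial (Fin s) ℂ)).map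
      (algebraMap (MvPolynomial (Fin s) ℂ) A)))).height = 0 := by
    set J := (M.under (MvPolynomial (Fin s) ℂ)).map
      (algebraMap (MvPolynomial (Fin s) ℂ) A) with hJ
    have hJM : J ≤ M := Ideal.map_comap_le
    have hpr : (M.map (Ideal.Quotient.mk J)).IsPrime :=
      Ideal.isPrime_map_quotientMk_of_isPrime hJM
    rw [Ideal.height_eq_zero_iff]
    refine ⟨⟨hpr, bot_le⟩, fun N hN hNM => ?_⟩
    have hNp : N.IsPrime := hN.1
    have hN' : (N.comap (Ideal.Quotient.mk J)).IsPrime := inferInstance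
    have hle : M.under (MvPolynomial (Fin s) ℂ) ≤
        (N.comap (Ideal.Quotient.mk J)).under (MvPolynomial (Fin s) ℂ) := by
      intro x hx
      have : algebraMap (MvPolynomial (Fin s) ℂ) A x ∈ J := Ideal.mem_map_of_mem _ hx
      change Ideal.Quotient.mk J (algebraMap (MvPolynomial (Fin s) ℂ) A x) ∈ N
      rw [Ideal.Quotient.eq_zero_iff_mem.mpr this]
      exact N.zero_mem
    have hmx : ((N.comap (Ideal.Quotient.mk J)).under (MvPolynomial (Fin s) ℂ)).IsMaximal := by
      rwa [← hp.eq_of_le (Ideal.IsPrime.ne_top inferInstance) hle]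
    have hNm : (N.comap (Ideal.Quotient.mk J)).IsMaximal :=
      Ideal.isMaximal_of_isIntegral_of_isMaximal_comap (R := MvPolynomial (Fin s) ℂ) _ hmx
    have hNle : N.comap (Ideal.Quotient.mk J) ≤ M := by
      refine (Ideal.comap_mono hNM).trans ?_
      rw [Ideal.comap_map_of_surjective _ Ideal.Quotient.mk_surjective]
      refine sup_le le_rfl ?_
      intro x hx
      exact hJM (Ideal.Quotient.eq_zero_iff_mem.mp hx)
    have hEq := hNm.eq_of_le hM.ne_top hNle
    rw [← hEq, Ideal.map_comap_of_surjective _ Ideal.Quotient.mk_surjective]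
  rw [h4]; simp



lemma td_lt_of_surjective {A B : Type} [CommRing A] [IsDomain A] [Algebra ℂ A]
    [Algebra.FiniteType ℂ A] [CommRing B] [IsDomain B] [Algebra ℂ B] [Algebra.FiniteType ℂ B]
    (f : A →ₐ[ℂ] B) (hf : Function.Surjective f) {a : A} (ha : a ≠ 0) (hfa : f a = 0) :
    td B < td A := by
  by_contra hlt
  push Not at hlt
  obtain ⟨t, ht⟩ := exists_isTranscendenceBasis ℂ B
  choose y hy using fun b : t => hf b
  have hfy : f ∘ y = ((↑) : t → B) := by ext b; exact hy b
  have hx : AlgebraicIndependent ℂ y := AlgebraicIndependent.of_comp f (by rw [hfy]; exact ht.1)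
  have hb : IsTranscendenceBasis ℂ y := by
    refine hx.isTranscendenceBasis_of_trdeg_le (_root_.trdeg_lt_aleph0_of_finiteType) ?_
    rw [ht.cardinalMk_eq_trdeg, ← td_cast, ← td_cast]
    exact_mod_cast hlt
  have halg : Algebra.IsAlgebraic (Algebra.adjoin ℂ (Set.range y)) A := hb.isAlgebraic
  obtain ⟨r, hr, hdvd⟩ := (halg.isAlgebraic a).exists_nonzero_dvd
    (mem_nonZeroDivisors_of_ne_zero ha)
  obtain ⟨q, hq⟩ : (r : A) ∈ (aeval y : MvPolynomial t ℂ →ₐ[ℂ] A).range := by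
    rw [← Algebra.adjoin_range_eq_range_aeval]; exact r.2
  have hfr : f r = 0 := by
    obtain ⟨c, hc⟩ := hdvd
    have : (r : A) = a * c := hc
    rw [this, map_mul, hfa, zero_mul]
  have h0 : aeval ((↑) : t → B) q = 0 := by
    rw [← hfy, ← hfr, ← hq]
    exact (DFunLike.congr_fun (comp_aeval y f) q).symm
  have := ht.1.eq_zero_of_aeval_eq_zero q h0
  apply hr
  apply Subtype.ext
  rw [← hq, this]; simp

lemma td_quot_lt {A : Type} [CommRing A] [Algebra ℂ A] [Algebra.FiniteType ℂ A]
    {P Q : Ideal A} [P.IsPrime] [Q.IsPrime] (h : P < Q) : td (A ⧸ Q) < td (A ⧸ P) := by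
  obtain ⟨x, hxQ, hxP⟩ := Set.exists_of_ssubset h
  exact td_lt_of_surjective (Ideal.Quotient.factorₐ ℂ h.le)
    (Ideal.Quotient.factor_surjective h.le) (a := Ideal.Quotient.mk P x)
    (fun h0 => hxP (Ideal.Quotient.eq_zero_iff_mem.mp h0))
    (Ideal.Quotient.eq_zero_iff_mem.mpr hxQ)

lemma td_series {A : Type} [CommRing A] [Algebra ℂ A] [Algebra.FiniteType ℂ A]
    (n : ℕ) (p : Fin (n+1) → PrimeSpectrum A) (hp : StrictMono p) :
    td (A ⧸ (p (Fin.last n)).asIdeal) + n ≤ td (A ⧸ (p 0).asIdeal) := by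
  induction n with
  | zero => simp
  | succ n ih =>
    have h1 := ih (fun i => p i.castSucc) (fun i j hij => hp (by simpa using hij))
    have h2 : p (Fin.last n).castSucc < p (Fin.last (n+1)) := hp (Fin.castSucc_lt_last _)
    have h3 := td_quot_lt (A := A) (P := (p (Fin.last n).castSucc).asIdeal)
      (Q := (p (Fin.last (n+1))).asIdeal) h2
    have h4 : p ((0 : Fin (n+1)).castSucc) = p 0 := rfl
    rw [h4] at h1
    change _ ≤ _ at h1
    calc _ ≤ td (A ⧸ (p (Fin.last n).castSucc).asIdeal) + n := by omega
      _ ≤ _ := h1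

lemma krull {A : Type} [CommRing A] [IsDomain A] [Algebra ℂ A] [Algebra.FiniteType ℂ A]
    (ξ : A →ₐ[ℂ] ℂ) {ι : Type} [Fintype ι] (a : ι → A) (ha : ∀ i, ξ (a i) = 0) :
    ∃ P : Ideal A, P.IsPrime ∧ (∀ i, a i ∈ P) ∧ P ≤ RingHom.ker ξ ∧
      td A ≤ td (A ⧸ P) + Fintype.card ι := by
  classical
  have hN : IsNoetherianRing A := Algebra.FiniteType.isNoetherianRing ℂ A
  set I := Ideal.span (Set.range a) with hI
  have hIp : I ≤ RingHom.ker ξ := by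
    rw [hI, Ideal.span_le]; rintro _ ⟨i, rfl⟩; exact ha i
  have hp : (RingHom.ker ξ).IsPrime := (ker_pt_max ξ).isPrime
  have h1 := Ideal.height_le_height_add_spanFinrank_of_le hIp
  rw [height_max] at h1
  have hsp : (I.spanFinrank : ℕ∞) ≤ Fintype.card ι := by
    refine (Submodule.spanFinrank_span_le_encard _).trans ?_
    rw [← Set.image_univ]
    refine (Set.encard_image_le _ _).trans ?_
    simp
  have hpr : ((RingHom.ker ξ).map (Ideal.Quotient.mk I)).IsPrime :=
    Ideal.isPrime_map_quotientMk_of_isPrime hIp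
  obtain ⟨l, hl, hlen⟩ := ((RingHom.ker ξ).map (Ideal.Quotient.mk I)).exists_ltSeries_length_eq_height
  have hmono : StrictMono (fun i => PrimeSpectrum.comap (Ideal.Quotient.mk I) (l i)) := by
    intro i j hij
    have h := l.strictMono hij
    refine lt_of_le_of_ne ?_ ?_
    · exact Ideal.comap_mono h.le
    · intro he
      exact h.ne (PrimeSpectrum.comap_injective_of_surjective _ Ideal.Quotient.mk_surjective he)
  have h2 := td_series l.length _ hmono
  refine ⟨(PrimeSpectrum.comap (Ideal.Quotient.mk I) (l 0)).asIdeal, inferInstance,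
    fun i => ?_, ?_, ?_⟩
  · change Ideal.Quotient.mk I (a i) ∈ (l 0).asIdeal
    rw [Ideal.Quotient.eq_zero_iff_mem.mpr (Ideal.subset_span (Set.mem_range_self i))]
    exact Ideal.zero_mem _
  · have h3 : (l 0).asIdeal ≤ (RingHom.ker ξ).map (Ideal.Quotient.mk I) := by
      have := l.strictMono.monotone (Fin.zero_le (Fin.last l.length))
      change (l 0) ≤ RelSeries.last l at this
      rw [hl] at this
      exact this
    refine (Ideal.comap_mono h3).trans ?_
    rw [Ideal.comap_map_of_surjective _ Ideal.Quotient.mk_surjective]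
    refine sup_le le_rfl fun x hx => hIp (Ideal.Quotient.eq_zero_iff_mem.mp hx)
  · rw [← hlen] at h1
    have h4 : (td A : ℕ∞) ≤ (l.length : ℕ∞) + Fintype.card ι := h1.trans (by gcongr)
    have h5 : td A ≤ l.length + Fintype.card ι := by exact_mod_cast h4
    omega

/-- packaged version -/
lemma krull' {A : Type} [CommRing A] [IsDomain A] [Algebra ℂ A] [Algebra.FiniteType ℂ A]
    (ξ : A →ₐ[ℂ] ℂ) {ι : Type} [Fintype ι] (a : ι → A) (ha : ∀ i, ξ (a i) = 0) :
    ∃ (B : Type) (_ : CommRing B) (_ : IsDomain B) (_ : Algebra ℂ B) (_ : Algebra.FiniteType ℂ B)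
      (q : A →ₐ[ℂ] B) (η : B →ₐ[ℂ] ℂ), Function.Surjective q ∧ (∀ x, η (q x) = ξ x) ∧
      (∀ i, q (a i) = 0) ∧ td A ≤ td B + Fintype.card ι := by
  obtain ⟨P, hP, h1, h2, h3⟩ := krull ξ a ha
  refine ⟨A ⧸ P, inferInstance, inferInstance, inferInstance, inferInstance,
    Ideal.Quotient.mkₐ ℂ P, Ideal.Quotient.liftₐ P ξ (fun x hx => h2 hx),
    Ideal.Quotient.mkₐ_surjective ℂ P, fun x => rfl,
    fun i => Ideal.Quotient.eq_zero_iff_mem.mpr (h1 i), h3⟩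



/-- point derivations -/
def PDer {A : Type} [CommRing A] [Algebra ℂ A] (ξ : A →ₐ[ℂ] ℂ) : Submodule ℂ (A →ₗ[ℂ] ℂ) where
  carrier := {D | ∀ a b, D (a * b) = ξ a * D b + ξ b * D a}
  add_mem' := by
    intro D E hD hE a b
    simp only [LinearMap.add_apply, hD a b, hE a b]; ring
  zero_mem' := by intro a b; simp
  smul_mem' := by
    intro c D hD a b
    simp only [LinearMap.smul_apply, hD a b, smul_eq_mul]; ring

section
variable {A : Type} [CommRing A] [Algebra ℂ A] {ξ : A →ₐ[ℂ] ℂ}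

lemma PDer.mul {D : A →ₗ[ℂ] ℂ} (hD : D ∈ PDer ξ) (a b : A) :
    D (a * b) = ξ a * D b + ξ b * D a := hD a b

lemma PDer.one {D : A →ₗ[ℂ] ℂ} (hD : D ∈ PDer ξ) : D 1 = 0 := by
  have := hD 1 1
  simpa using this

lemma PDer.const {D : A →ₗ[ℂ] ℂ} (hD : D ∈ PDer ξ) (c : ℂ) : D (algebraMap ℂ A c) = 0 := by
  rw [Algebra.algebraMap_eq_smul_one, map_smul, PDer.one hD, smul_zero]

/-- pull back along an algebra map -/
lemma PDer.comp {B : Type} [CommRing B] [Algebra ℂ B] {η : B →ₐ[ℂ] ℂ} {D : B →ₗ[ℂ] ℂ}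
    (hD : D ∈ PDer η) (q : A →ₐ[ℂ] B) (hq : ∀ a, η (q a) = ξ a) :
    D ∘ₗ q.toLinearMap ∈ PDer ξ := by
  intro a b
  simp [map_mul, PDer.mul hD, hq]

lemma pt_aeval {σ : Type} (ξ : A →ₐ[ℂ] ℂ) (x : σ → A) (f : MvPolynomial σ ℂ) :
    ξ (aeval x f) = eval (fun j => ξ (x j)) f := by
  have := DFunLike.congr_fun (comp_aeval x ξ) f
  simp only [AlgHom.comp_apply] at this
  rw [this, aeval_eq_eval]

lemma pder_aeval {σ : Type} [Fintype σ] {D : A →ₗ[ℂ] ℂ} (hD : D ∈ PDer ξ) (x : σ → A)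
    (f : MvPolynomial σ ℂ) :
    D (aeval x f) = ∑ i, eval (fun j => ξ (x j)) (pderiv i f) * D (x i) := by
  classical
  induction f using MvPolynomial.induction_on with
  | C c => simp [PDer.const hD]
  | add p q hp hq => simp [hp, hq, add_mul, Finset.sum_add_distrib]
  | mul_X p i hp =>
    rw [map_mul, aeval_X, PDer.mul hD, hp, pt_aeval]
    simp only [Derivation.leibniz, pderiv_X, smul_eq_mul, map_add, map_mul, eval_X, add_mul,
      Finset.sum_add_distrib, Finset.mul_sum]
    congr 1
    · rw [Finset.sum_eq_single i]
      · simp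
      · intro j _ hj; simp [Ne.symm hj]
      · simp
    · exact Finset.sum_congr rfl fun j _ => by ring

lemma td_zero_of_pder [IsDomain A] [Algebra.FiniteType ℂ A] 
    (h : ∀ D ∈ PDer ξ, D = 0) : td A = 0 := by
  have hN : IsNoetherianRing A := Algebra.FiniteType.isNoetherianRing ℂ A
  have hid : IsIdempotentElem (RingHom.ker ξ) := by
    refine le_antisymm Ideal.mul_le_left fun a ha => ?_
    by_contra hn
    let S : Submodule ℂ A := (RingHom.ker ξ * RingHom.ker ξ).restrictScalars ℂ
    obtain ⟨f, hf, hS⟩ := Submodule.exists_le_ker_of_notMem (p := S) (v := a) hn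
    let D : A →ₗ[ℂ] ℂ := f - (f.comp (Algebra.linearMap ℂ A)).comp ξ.toLinearMap
    have hDa : ∀ a, D a = f (a - algebraMap ℂ A (ξ a)) := by intro a; simp [D]
    have hD : D ∈ PDer ξ := by
      intro a b
      have key : a * b - algebraMap ℂ A (ξ (a * b)) =
          (a - algebraMap ℂ A (ξ a)) * (b - algebraMap ℂ A (ξ b)) +
          (ξ a • (b - algebraMap ℂ A (ξ b)) + ξ b • (a - algebraMap ℂ A (ξ a))) := by
        simp only [Algebra.smul_def, map_mul]; ring
      rw [hDa, hDa, hDa, key, map_add, map_add, map_smul, map_smul]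
      have : f ((a - algebraMap ℂ A (ξ a)) * (b - algebraMap ℂ A (ξ b))) = 0 := by
        apply hS
        exact Ideal.mul_mem_mul (by simp [RingHom.mem_ker]) (by simp [RingHom.mem_ker])
      rw [this]; simp
    have h0 := h D hD
    have : D a = f a := by rw [hDa, show ξ a = 0 from ha]; simp
    rw [h0] at this
    exact hf this.symm
  have hbt := (Ideal.isIdempotentElem_iff_eq_bot_or_top _ (IsNoetherian.noetherian _)).mp hid
  rcases hbt with hb | ht
  · have hinj : Function.Injective ξ := (injective_iff_map_eq_zero ξ).mpr fun a ha => by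
      have : a ∈ RingHom.ker ξ := ha
      rwa [hb] at this
    have h2 := td_le_of_injective ξ hinj
    have h3 : td ℂ = 0 := by
      rw [td, (_root_.trdeg_eq_zero : Algebra.trdeg ℂ ℂ = 0)]; simp
    omega
  · exact absurd ht (RingHom.ker_ne_top _)

lemma td_le_of_pder [IsDomain A] [Algebra.FiniteType ℂ A] {ι : Type} [Fintype ι] (a : ι → A)
    (h : ∀ D ∈ PDer ξ, (∀ i, D (a i) = 0) → D = 0) : td A ≤ Fintype.card ι := by
  obtain ⟨B, _, _, _, _, q, η, hq, hη, hqa, htd⟩ :=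
    krull' ξ (fun i => a i - algebraMap ℂ A (ξ (a i))) (by simp)
  have : td B = 0 := by
    refine td_zero_of_pder (ξ := η) fun D hD => ?_
    have h1 := h _ (PDer.comp hD q hη) (fun i => by
      have h2 := hqa i
      rw [map_sub, sub_eq_zero] at h2
      simp only [LinearMap.comp_apply, AlgHom.toLinearMap_apply, h2, AlgHom.commutes, PDer.const hD])
    ext b
    obtain ⟨c, rfl⟩ := hq b
    exact DFunLike.congr_fun h1 c
  omega

lemma td_le_finrank [IsDomain A] [Algebra.FiniteType ℂ A] {σ : Type} [Fintype σ] (x : σ → A)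
    (W : Submodule ℂ (σ → ℂ)) (h1 : ∀ D ∈ PDer ξ, (fun i => D (x i)) ∈ W)
    (h2 : ∀ D ∈ PDer ξ, (∀ i, D (x i) = 0) → D = 0) : td A ≤ Module.finrank ℂ W := by
  classical
  obtain ⟨Q, hQ⟩ := W.exists_isCompl
  let b := Module.finBasis ℂ W
  let p := W.projectionOnto Q hQ
  let ℓ : Fin (Module.finrank ℂ W) → (σ → ℂ) →ₗ[ℂ] ℂ := fun j => (b.coord j).comp p
  have := td_le_of_pder (ξ := ξ) (fun j => ∑ i, ℓ j (Pi.single i 1) • x i) (fun D hD h0 => by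
    apply h2 D hD
    have h3 : (⟨_, h1 D hD⟩ : W) = 0 := by
      apply b.ext_elem
      intro j
      have h4 : ℓ j (fun i => D (x i)) = 0 := by
        have h5 : (fun i => D (x i)) = ∑ i, D (x i) • (Pi.single i (1:ℂ) : σ → ℂ) := by
          ext k; simp [Finset.sum_apply, Pi.single_apply]
        rw [h5, map_sum, ← h0 j, map_sum]
        exact Finset.sum_congr rfl fun i _ => by simp [mul_comm]
      have h6 : p (fun i => D (x i)) = ⟨_, h1 D hD⟩ :=
        Submodule.projectionOnto_apply_left hQ ⟨_, h1 D hD⟩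
      simp only [ℓ, LinearMap.comp_apply, h6] at h4
      simpa using h4
    intro i
    exact congrFun (congrArg Subtype.val h3) i)
  simpa using this
end



lemma alg_const {B : Type} [CommRing B] [IsDomain B] [Algebra ℂ B] (η : B →ₐ[ℂ] ℂ) {t : B}
    (ht : IsAlgebraic ℂ t) : t = algebraMap ℂ B (η t) := by
  obtain ⟨c, hc⟩ := IsAlgClosed.algebraMap_bijective_of_isIntegral
    (k := ℂ) (K := integralClosure ℂ B) |>.2 ⟨t, ht.isIntegral⟩
  have h : t = algebraMap ℂ B c := congrArg Subtype.val hc.symm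
  rw [h]; simp

lemma alg_const_poly {B : Type} [CommRing B] [IsDomain B] [Algebra ℂ B] (η : B →ₐ[ℂ] ℂ) {t : B}
    (p : Polynomial ℂ) (hp : p ≠ 0) (ht : Polynomial.aeval t p = 0) :
    t = algebraMap ℂ B (η t) := alg_const η ⟨p, hp, ht⟩

lemma td_zero_of_const {B : Type} [CommRing B] [IsDomain B] [Algebra ℂ B]
    [Algebra.FiniteType ℂ B] (η : B →ₐ[ℂ] ℂ) (h : ∀ b, b = algebraMap ℂ B (η b)) : td B = 0 := by
  have : Function.Injective η := (injective_iff_map_eq_zero η).mpr fun b hb => by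
    rw [h b, hb, map_zero]
  have h2 := td_le_of_injective η this
  have h3 : td ℂ = 0 := by
    rw [td, (_root_.trdeg_eq_zero : Algebra.trdeg ℂ ℂ = 0)]; simp
  omega

lemma fibre_lemma {E T : Type} [CommRing E] [IsDomain E] [Algebra ℂ E] [Algebra.FiniteType ℂ E]
    [CommRing T] [IsDomain T] [Algebra ℂ T] [Algebra.FiniteType ℂ T]
    (b : E →ₐ[ℂ] T) (ξ : T →ₐ[ℂ] ℂ) :
    ∃ (B : Type) (_ : CommRing B) (_ : IsDomain B) (_ : Algebra ℂ B) (_ : Algebra.FiniteType ℂ B)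
      (q : T →ₐ[ℂ] B) (η : B →ₐ[ℂ] ℂ), Function.Surjective q ∧ (∀ x, η (q x) = ξ x) ∧
      (∀ e, q (b e) = algebraMap ℂ B (ξ (b e))) ∧ td T ≤ td B + td E := by
  obtain ⟨s, g, hinj, hint⟩ := exists_integral_inj_algHom_of_fg ℂ E
  have hs : s ≤ td E := by
    have := td_le_of_injective g hinj
    simpa [td_mvPoly] using this
  obtain ⟨B, _, _, _, _, q, η, hq, hη, hqa, htd⟩ :=
    krull' ξ (fun i => b (g (X i)) - algebraMap ℂ T (ξ (b (g (X i))))) (by simp)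
  refine ⟨B, _, ‹_›, _, ‹_›, q, η, hq, hη, fun e => ?_, ?_⟩
  · have h1 : ∀ f, q (b (g f)) = algebraMap ℂ B (ξ (b (g f))) := by
      intro f
      have : (q.comp b).comp g = (Algebra.ofId ℂ B).comp ((ξ.comp b).comp g) := by
        ext i
        have := hqa i
        rw [map_sub, sub_eq_zero] at this
        simpa using this
      exact DFunLike.congr_fun this f
    have h2 : IsIntegral ℂ (q (b e)) := by
      obtain ⟨p, hp, hpe⟩ := hint e
      refine ⟨p.map (((ξ.comp b).comp g) : MvPolynomial (Fin s) ℂ →+* ℂ), hp.map _, ?_⟩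
      rw [Polynomial.eval₂_map]
      have h3 : (algebraMap ℂ B).comp (((ξ.comp b).comp g) : MvPolynomial (Fin s) ℂ →+* ℂ) =
          ((q.comp b : E →ₐ[ℂ] B) : E →+* B).comp (g : MvPolynomial (Fin s) ℂ →+* E) := by
        refine RingHom.ext fun f => ?_
        simpa using (h1 f).symm
      rw [h3]
      have h4 := congrArg (q.comp b) hpe
      rw [map_zero] at h4
      rw [← h4]
      exact (Polynomial.hom_eval₂ p (g : MvPolynomial (Fin s) ℂ →+* E)
        ((q.comp b : E →ₐ[ℂ] B) : E →+* B) e).symm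
    have := alg_const η h2.isAlgebraic
    rw [this, hη]
  · simp at htd; omega

lemma chevalley {A B : Type} [CommRing A] [IsDomain A] [Algebra ℂ A] [Algebra.FiniteType ℂ A]
    [CommRing B] [IsDomain B] [Algebra ℂ B] [Algebra.FiniteType ℂ B] (f : A →ₐ[ℂ] B)
    (hf : Function.Injective f) : ∃ g : A, g ≠ 0 ∧
      ∀ ξ : A →ₐ[ℂ] ℂ, ξ g ≠ 0 → ∃ η : B →ₐ[ℂ] ℂ, ∀ a, η (f a) = ξ a := by
  have hN : IsNoetherianRing A := Algebra.FiniteType.isNoetherianRing ℂ A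
  have hft : (f : A →+* B).FiniteType := by
    refine RingHom.FiniteType.of_comp_finiteType (f := algebraMap ℂ A) ?_
    rw [f.comp_algebraMap]
    exact (RingHom.finiteType_algebraMap (A := ℂ) (B := B)).mpr inferInstance
  have hfp : (f : A →+* B).FinitePresentation := RingHom.FinitePresentation.of_finiteType.mp hft
  obtain ⟨S, hS⟩ := PrimeSpectrum.exists_constructibleSetData_iff.mpr
    (PrimeSpectrum.isConstructible_range_comap hfp)
  have hbot : (⟨⊥, Ideal.isPrime_bot⟩ : PrimeSpectrum A) ∈ S.toSet := by
    rw [hS]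
    refine ⟨⟨⊥, Ideal.isPrime_bot⟩, ?_⟩
    ext x
    simpa [PrimeSpectrum.comap] using (map_eq_zero_iff f hf)
  simp only [PrimeSpectrum.ConstructibleSetData.toSet, Set.mem_iUnion] at hbot
  obtain ⟨c, hc, hc1⟩ := hbot
  obtain ⟨h1, h2⟩ := hc1
  have hg0 : ∀ i, c.g i = 0 := fun i => by simpa using h1 (Set.mem_range_self i)
  refine ⟨c.f, fun h0 => h2 (by simp [h0]), fun ξ hξ => ?_⟩
  have hm : (⟨RingHom.ker ξ, (ker_pt_max ξ).isPrime⟩ : PrimeSpectrum A) ∈ S.toSet := by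
    simp only [PrimeSpectrum.ConstructibleSetData.toSet, Set.mem_iUnion]
    refine ⟨c, hc, ?_, ?_⟩
    · rintro _ ⟨i, rfl⟩; rw [hg0]; exact Ideal.zero_mem _
    · intro h; exact hξ (by simpa using h)
  rw [hS] at hm
  obtain ⟨Q, hQ⟩ := hm
  obtain ⟨η, hη⟩ := exists_pt Q.asIdeal Q.2.ne_top
  refine ⟨η, fun a => ?_⟩
  have : a - algebraMap ℂ A (ξ a) ∈ (PrimeSpectrum.comap (f : A →+* B) Q).asIdeal := by
    rw [hQ]; simp [RingHom.mem_ker]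
  have h5 := hη _ this
  simpa [sub_eq_zero] using h5

lemma td_mvPolynomial {B : Type} [CommRing B] [IsDomain B] [Algebra ℂ B] 
    [Algebra.FiniteType ℂ B] (ι : Type) [Fintype ι] :
    td (MvPolynomial ι B) = td B + Fintype.card ι := by
  have h := _root_.trdeg_add_eq (R := ℂ) (S := B) (A := MvPolynomial ι B)
  rw [MvPolynomial.trdeg_of_isDomain, ← td_cast] at h
  rw [td, ← h]
  simp


open TensorProduct

def ptL {A B : Type} [CommRing A] [Algebra ℂ A] [CommRing B] [Algebra ℂ B] (η : A →ₐ[ℂ] ℂ) :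
    A ⊗[ℂ] B →ₐ[ℂ] B :=
  Algebra.TensorProduct.lift ((Algebra.ofId ℂ B).comp η) (AlgHom.id ℂ B) (fun _ _ => mul_comm _ _)

lemma ptL_repr {A B ι : Type} [CommRing A] [Algebra ℂ A] [CommRing B] [Algebra ℂ B]
    (b : Module.Basis ι ℂ B) (η : A →ₐ[ℂ] ℂ) (p : A ⊗[ℂ] B) (i : ι) :
    b.repr (ptL η p) i = η ((Algebra.TensorProduct.basis A b).repr p i) := by
  induction p with
  | zero => simp
  | add x y hx hy => simp [hx, hy]
  | tmul x y =>
    have : ptL η (x ⊗ₜ[ℂ] y) = η x • y := by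
      rw [Algebra.smul_def]; exact Algebra.TensorProduct.lift_tmul _ _ _ _ _
    rw [this]; simp

theorem tensor_domain (A B : Type) [CommRing A] [IsDomain A] [Algebra ℂ A] [Algebra.FiniteType ℂ A]
    [CommRing B] [IsDomain B] [Algebra ℂ B] : IsDomain (A ⊗[ℂ] B) := by
  let b := Module.Basis.ofVectorSpace ℂ B
  let e := Algebra.TensorProduct.basis A b
  have : Nontrivial (A ⊗[ℂ] B) := inferInstance
  have : NoZeroDivisors (A ⊗[ℂ] B) := ⟨by
    intro p q hpq
    by_contra! hcon
    obtain ⟨hp, hq⟩ := hcon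
    have hp' : e.repr p ≠ 0 := by simpa using hp
    have hq' : e.repr q ≠ 0 := by simpa using hq
    obtain ⟨i, hi⟩ := Finsupp.ne_iff.mp hp'
    obtain ⟨j, hj⟩ := Finsupp.ne_iff.mp hq'
    have hne : e.repr p i * e.repr q j ≠ 0 := mul_ne_zero hi hj
    have : ∃ η : A →ₐ[ℂ] ℂ, η (e.repr p i * e.repr q j) ≠ 0 := by
      by_contra! h
      exact hne (eq_zero_of_pts h)
    obtain ⟨η, hη⟩ := this
    rw [map_mul] at hη
    have h1 := left_ne_zero_of_mul hη
    have h2 := right_ne_zero_of_mul hη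
    rw [← ptL_repr] at h1 h2
    have h3 : ptL η p * ptL η q = 0 := by rw [← map_mul, hpq, map_zero]
    rcases mul_eq_zero.mp h3 with h | h
    · exact h1 (by rw [h]; simp)
    · exact h2 (by rw [h]; simp)⟩
  exact NoZeroDivisors.to_isDomain _

lemma exists_indep (B : Type) [CommRing B] [IsDomain B] [Algebra ℂ B] [Algebra.FiniteType ℂ B] :
    ∃ x : Fin (td B) → B, IsTranscendenceBasis ℂ x := by
  have hinj : FaithfulSMul ℂ B := inferInstance
  obtain ⟨s, hs⟩ := exists_isTranscendenceBasis ℂ B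
  have h1 := hs.cardinalMk_eq_trdeg
  rw [← td_cast] at h1
  have : Finite s := by
    rw [← Cardinal.lt_aleph0_iff_finite, h1]; exact Cardinal.natCast_lt_aleph0
  have : Fintype s := Fintype.ofFinite s
  rw [Cardinal.mk_fintype, Nat.cast_inj] at h1
  let e := (Fintype.equivFinOfCardEq h1)
  exact ⟨_, hs.comp_equiv e.symm⟩

instance ft_tensor (A B : Type) [CommRing A] [Algebra ℂ A] [Algebra.FiniteType ℂ A]
    [CommRing B] [Algebra ℂ B] [Algebra.FiniteType ℂ B] : Algebra.FiniteType ℂ (A ⊗[ℂ] B) :=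
  Algebra.FiniteType.trans (S := A) inferInstance inferInstance

theorem td_tensor (A B : Type) [CommRing A] [IsDomain A] [Algebra ℂ A] [Algebra.FiniteType ℂ A]
    [CommRing B] [IsDomain B] [Algebra ℂ B] [Algebra.FiniteType ℂ B] :
    td A + td B ≤ td (A ⊗[ℂ] B) := by
  have := tensor_domain A B
  obtain ⟨x, hx⟩ := exists_indep B
  have h1 : Function.Injective (aeval x : MvPolynomial (Fin (td B)) ℂ →ₐ[ℂ] B) := hx.1
  let f : A ⊗[ℂ] MvPolynomial (Fin (td B)) ℂ →ₐ[ℂ] A ⊗[ℂ] B :=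
    Algebra.TensorProduct.map (AlgHom.id ℂ A) (aeval x)
  have hf : Function.Injective f :=
    Module.Flat.lTensor_preserves_injective_linearMap (M := A) (aeval x).toLinearMap h1
  let e := (MvPolynomial.algebraTensorAlgEquiv (σ := Fin (td B)) ℂ A).restrictScalars ℂ
  have h2 := td_le_of_injective (f.comp (e.symm : MvPolynomial (Fin (td B)) A →ₐ[ℂ] _))
    (by rw [AlgHom.coe_comp]; exact hf.comp e.symm.injective)
  rw [td_mvPolynomial] at h2
  simpa using h2


lemma gs_smooth {A ι : Type} [Fintype ι] [CommRing A] [IsDomain A] [Algebra ℂ A]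
    [Algebra.FiniteType ℂ A] [Algebra (MvPolynomial ι ℂ) A] [IsScalarTower ℂ (MvPolynomial ι ℂ) A]
    (hinj : Function.Injective (algebraMap (MvPolynomial ι ℂ) A)) :
    ∃ h : A, h ≠ 0 ∧ Algebra.FormallySmooth (MvPolynomial ι ℂ) (Localization.Away h) := by
  have hft : Algebra.FiniteType (MvPolynomial ι ℂ) A :=
    Algebra.FiniteType.of_restrictScalars_finiteType ℂ _ _
  have hfp : Algebra.FinitePresentation (MvPolynomial ι ℂ) A :=
    Algebra.FinitePresentation.of_finiteType.mp hft
  have : FaithfulSMul (MvPolynomial ι ℂ) A := (faithfulSMul_iff_algebraMap_injective _ _).mpr hinj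
  let K := FractionRing (MvPolynomial ι ℂ)
  let L := FractionRing A
  have : FaithfulSMul (MvPolynomial ι ℂ) L := by
    rw [faithfulSMul_iff_algebraMap_injective,
      IsScalarTower.algebraMap_eq (MvPolynomial ι ℂ) A L, RingHom.coe_comp]
    exact (IsFractionRing.injective A L).comp hinj
  let _ : Algebra K L := FractionRing.liftAlgebra (MvPolynomial ι ℂ) L
  have : IsScalarTower (MvPolynomial ι ℂ) K L := FractionRing.isScalarTower_liftAlgebra _ _
  have : Algebra.EssFiniteType (MvPolynomial ι ℂ) L :=
    have : Algebra.EssFiniteType A L := .of_isLocalization L (nonZeroDivisors A)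
    .comp (MvPolynomial ι ℂ) A L
  have : Algebra.EssFiniteType K L := .of_comp (MvPolynomial ι ℂ) K L
  have : CharZero K := IsFractionRing.charZero (MvPolynomial ι ℂ)
  have h1 : Algebra.FormallySmooth K L := Algebra.FormallySmooth.of_perfectField
  have h2 : Algebra.FormallySmooth (MvPolynomial ι ℂ) K :=
    .of_isLocalization (nonZeroDivisors _)
  have h3 : Algebra.FormallySmooth (MvPolynomial ι ℂ) L := .comp _ K L
  have hloc : IsLocalization (nonZeroDivisors A) (Localization.AtPrime (⊥ : Ideal A)) := by
    have : (⊥ : Ideal A).primeCompl = nonZeroDivisors A := by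
      ext x; simp [Ideal.primeCompl, mem_nonZeroDivisors_iff_ne_zero]
    rw [← this]; infer_instance
  have e := IsLocalization.algEquiv (nonZeroDivisors A) L (Localization.AtPrime (⊥ : Ideal A))
  have h4 : Algebra.IsSmoothAt (MvPolynomial ι ℂ) (⊥ : Ideal A) :=
    Algebra.FormallySmooth.of_equiv (e.restrictScalars (MvPolynomial ι ℂ))
  obtain ⟨f, hf, h5⟩ := Algebra.IsSmoothAt.exists_notMem_smooth (MvPolynomial ι ℂ) (⊥ : Ideal A)
  exact ⟨f, by simpa using hf, h5.1⟩

lemma gs_lift {A ι : Type} [Fintype ι] [CommRing A] [Algebra ℂ A]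
    [Algebra (MvPolynomial ι ℂ) A] [IsScalarTower ℂ (MvPolynomial ι ℂ) A]
    (h : A) (hs : Algebra.FormallySmooth (MvPolynomial ι ℂ) (Localization.Away h))
    (ξ : A →ₐ[ℂ] ℂ) (hξ : ξ h ≠ 0) (u : ι → ℂ) :
    ∃ D ∈ PDer ξ, ∀ i, D (algebraMap (MvPolynomial ι ℂ) A (X i)) = u i := by
  let x : ι → ℂ := fun i => ξ (algebraMap (MvPolynomial ι ℂ) A (X i))
  let y : ι → DualNumber ℂ := fun i => TrivSqZeroExt.inl (x i) + TrivSqZeroExt.inr (u i)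
  let algB : Algebra (MvPolynomial ι ℂ) (DualNumber ℂ) :=
    (aeval y : MvPolynomial ι ℂ →ₐ[ℂ] DualNumber ℂ).toRingHom.toAlgebra
  have hfst : ∀ p : MvPolynomial ι ℂ, TrivSqZeroExt.fst (algebraMap (MvPolynomial ι ℂ) (DualNumber ℂ) p)
      = ξ (algebraMap (MvPolynomial ι ℂ) A p) := by
    intro p
    have : ((TrivSqZeroExt.fstHom ℂ ℂ ℂ).comp (aeval y : MvPolynomial ι ℂ →ₐ[ℂ] DualNumber ℂ)) =
       ξ.comp (IsScalarTower.toAlgHom ℂ (MvPolynomial ι ℂ) A) := by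
      ext i; simp [y, x]
    exact DFunLike.congr_fun this p
  let I : Ideal (DualNumber ℂ) := RingHom.ker (TrivSqZeroExt.fstHom ℂ ℂ ℂ)
  have hI : IsNilpotent I := by
    refine ⟨2, (pow_two I).trans ?_⟩
    rw [Ideal.zero_eq_bot, eq_bot_iff, Ideal.mul_le]
    intro a ha b hb
    have ha' : a.fst = 0 := ha
    have hb' : b.fst = 0 := hb
    rw [Ideal.mem_bot]
    ext <;> simp [ha', hb']
  have hu : IsUnit ((ξ : A →+* ℂ) h) := isUnit_iff_ne_zero.mpr hξ
  let φ : Localization.Away h →+* ℂ := IsLocalization.Away.lift h hu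
  have hφ : ∀ a, φ (algebraMap A _ a) = ξ a := fun a => IsLocalization.Away.lift_eq h hu a
  let g : Localization.Away h →ₐ[MvPolynomial ι ℂ] DualNumber ℂ ⧸ I :=
    { toRingHom := ((Ideal.Quotient.mk I).comp (TrivSqZeroExt.inlHom ℂ ℂ)).comp φ
      commutes' := by
        intro p
        simp only [RingHom.toMonoidHom_eq_coe, OneHom.toFun_eq_coe, MonoidHom.toOneHom_coe, MonoidHom.coe_coe]
        change Ideal.Quotient.mk I (TrivSqZeroExt.inl (φ (algebraMap _ _ p))) =
          Ideal.Quotient.mk I (algebraMap _ _ p)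
        rw [Ideal.Quotient.eq]
        rw [IsScalarTower.algebraMap_apply (MvPolynomial ι ℂ) A, hφ]
        change TrivSqZeroExt.fst _ = 0
        rw [TrivSqZeroExt.fst_sub, hfst]; simp }
  obtain ⟨f, hf⟩ := Algebra.FormallySmooth.exists_lift I hI g
  have hf1 : ∀ a, (f (algebraMap A _ a)).fst = ξ a := by
    intro a
    have := DFunLike.congr_fun hf (algebraMap A _ a)
    change Ideal.Quotient.mk I (f (algebraMap A _ a)) =
      Ideal.Quotient.mk I (TrivSqZeroExt.inl (φ (algebraMap _ _ a))) at this
    rw [Ideal.Quotient.eq, hφ] at this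
    have h2 : TrivSqZeroExt.fst (f (algebraMap A _ a) - TrivSqZeroExt.inl (ξ a)) = 0 := this
    rw [TrivSqZeroExt.fst_sub, sub_eq_zero] at h2
    simpa using h2
  have hfX : ∀ p : MvPolynomial ι ℂ, f (algebraMap A _ (algebraMap (MvPolynomial ι ℂ) A p)) = aeval y p := by
    intro p
    rw [← IsScalarTower.algebraMap_apply (MvPolynomial ι ℂ) A, f.commutes]; rfl
  have hfC : ∀ c : ℂ, f (algebraMap A _ (algebraMap ℂ A c)) = algebraMap ℂ (DualNumber ℂ) c := by
    intro c
    rw [IsScalarTower.algebraMap_apply ℂ (MvPolynomial ι ℂ) A, hfX]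
    exact (aeval y).commutes c
  let D : A →ₗ[ℂ] ℂ :=
    { toFun := fun a => (f (algebraMap A _ a)).snd
      map_add' := by intro a b; simp
      map_smul' := by
        intro c a
        rw [Algebra.smul_def, map_mul, map_mul, hfC, TrivSqZeroExt.snd_mul]
        simp [TrivSqZeroExt.algebraMap_eq_inl'] }
  refine ⟨D, ?_, ?_⟩
  · intro a b
    change (f (algebraMap A _ (a * b))).snd = ξ a * (f (algebraMap A _ b)).snd + ξ b * (f (algebraMap A _ a)).snd
    rw [map_mul, map_mul, ← hf1, ← hf1]
    simp [mul_comm]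
  · intro i
    change (f (algebraMap A _ (algebraMap _ _ (X i)))).snd = u i
    rw [hfX]; simp [y]

theorem generic_smooth {A ι : Type} [Fintype ι] [CommRing A] [Algebra ℂ A]
    [Algebra.FiniteType ℂ A] (ℓ : ι → A) : ∃ G : MvPolynomial ι ℂ, G ≠ 0 ∧
    ∀ ξ : A →ₐ[ℂ] ℂ, eval (fun i => ξ (ℓ i)) G ≠ 0 → ∀ u : ι → ℂ, ∃ D ∈ PDer ξ, ∀ i, D (ℓ i) = u i := by
  have hN : IsNoetherianRing A := Algebra.FiniteType.isNoetherianRing ℂ A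
  suffices H : ∀ I : Ideal A, ∃ G : MvPolynomial ι ℂ, G ≠ 0 ∧
    ∀ ξ : A →ₐ[ℂ] ℂ, (∀ a ∈ I, ξ a = 0) → eval (fun i => ξ (ℓ i)) G ≠ 0 →
      ∀ u : ι → ℂ, ∃ D ∈ PDer ξ, ∀ i, D (ℓ i) = u i by
    obtain ⟨G, hG, h⟩ := H ⊥
    exact ⟨G, hG, fun ξ => h ξ (by simp)⟩
  intro I
  induction I using WellFoundedGT.induction with
  | ind I ih =>
  by_cases htop : I = ⊤
  · refine ⟨1, one_ne_zero, fun ξ hξ => ?_⟩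
    have := hξ 1 (by simp [htop])
    simp at this
  by_cases hprime : I.IsPrime
  · let _ : Algebra (MvPolynomial ι ℂ) (A ⧸ I) :=
      (aeval (fun i => Ideal.Quotient.mk I (ℓ i)) : MvPolynomial ι ℂ →ₐ[ℂ] A ⧸ I).toRingHom.toAlgebra
    have hst : IsScalarTower ℂ (MvPolynomial ι ℂ) (A ⧸ I) := 
      IsScalarTower.of_algebraMap_eq fun c =>
        ((aeval (fun i => Ideal.Quotient.mk I (ℓ i)) : MvPolynomial ι ℂ →ₐ[ℂ] A ⧸ I).commutes c).symm
    by_cases hinj : Function.Injective (algebraMap (MvPolynomial ι ℂ) (A ⧸ I))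
    · obtain ⟨h, hh, hsm⟩ := gs_smooth hinj
      obtain ⟨h, rfl⟩ := Ideal.Quotient.mk_surjective h
      have hhI : h ∉ I := fun hc => hh (Ideal.Quotient.eq_zero_iff_mem.mpr hc)
      obtain ⟨G, hG, hGI⟩ := ih (I ⊔ Ideal.span {h}) (by
        refine lt_of_le_of_ne le_sup_left fun hc => hhI ?_
        rw [hc]; exact Ideal.mem_sup_right (Ideal.mem_span_singleton_self h))
      refine ⟨G, hG, fun ξ hξ hξG u => ?_⟩
      by_cases hξh : ξ h = 0
      · refine hGI ξ ?_ hξG u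
        have : I ⊔ Ideal.span {h} ≤ RingHom.ker ξ := by
          refine sup_le (fun a ha => hξ a ha) ?_
          rw [Ideal.span_le]; simpa using hξh
        exact fun a ha => this ha
      · let ξ' : A ⧸ I →ₐ[ℂ] ℂ := Ideal.Quotient.liftₐ I ξ hξ
        have hξ' : ∀ a, ξ' (Ideal.Quotient.mk I a) = ξ a := fun a => rfl
        obtain ⟨D, hD, hDu⟩ := gs_lift _ hsm ξ' hξh u
        refine ⟨D ∘ₗ (Ideal.Quotient.mkₐ ℂ I).toLinearMap, PDer.comp hD _ hξ', fun i => ?_⟩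
        rw [← hDu i]
        change D _ = D (aeval _ (X i))
        rw [aeval_X]; rfl
    · rw [injective_iff_map_eq_zero] at hinj
      push Not at hinj
      obtain ⟨G, hG, hG0⟩ := hinj
      refine ⟨G, hG0, fun ξ hξ hξG => ?_⟩
      exfalso; apply hξG
      rw [← pt_aeval]
      apply hξ
      rw [← Ideal.Quotient.eq_zero_iff_mem, ← hG]
      change Ideal.Quotient.mkₐ ℂ I _ = aeval _ G
      rw [MvPolynomial.comp_aeval_apply]; rfl
  · rw [Ideal.isPrime_iff] at hprime
    push Not at hprime
    obtain ⟨a, b, hab, ha, hb⟩ := hprime htop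
    have key : ∀ c, c ∉ I → I < I ⊔ Ideal.span {c} := fun c hc => by
      refine lt_of_le_of_ne le_sup_left fun h => hc ?_
      rw [h]; exact Ideal.mem_sup_right (Ideal.mem_span_singleton_self c)
    obtain ⟨G1, h1, H1⟩ := ih _ (key a ha)
    obtain ⟨G2, h2, H2⟩ := ih _ (key b hb)
    refine ⟨G1 * G2, mul_ne_zero h1 h2, fun ξ hξ hG => ?_⟩
    rw [map_mul] at hG
    have key2 : ∀ c, ξ c = 0 → ∀ a ∈ I ⊔ Ideal.span {c}, ξ a = 0 := fun c hc => by
      have : I ⊔ Ideal.span {c} ≤ RingHom.ker ξ := by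
        refine sup_le (fun a ha => hξ a ha) ?_
        rw [Ideal.span_le]; simpa using hc
      exact fun a ha => this ha
    have := hξ _ hab
    rw [map_mul] at this
    rcases mul_eq_zero.mp this with h | h
    · exact H1 ξ (key2 _ h) (left_ne_zero_of_mul hG)
    · exact H2 ξ (key2 _ h) (right_ne_zero_of_mul hG)


abbrev MP (n : ℕ) := MvPolynomial (Fin n) ℂ

lemma aeval_mul_hom {ι D : Type} [CommRing D] [Algebra ℂ D] {f : MvPolynomial ι ℂ} {d : ℕ}
    (hf : f.IsHomogeneous d) (c : D) (x : ι → D) :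
    aeval (fun i => c * x i) f = c ^ d * aeval x f := by
  rw [aeval_def, aeval_def, eval₂_eq, eval₂_eq, Finset.mul_sum]
  refine Finset.sum_congr rfl fun m hm => ?_
  have := hf (mem_support_iff.mp hm)
  rw [Finsupp.weight_apply, Finsupp.sum] at this
  simp only [mul_pow, Finset.prod_mul_distrib, Finset.prod_pow_eq_pow_sum]
  simp at this
  rw [this]; ring

lemma eval_smul_hom {ι : Type} {f : MvPolynomial ι ℂ} {d : ℕ}
    (hf : f.IsHomogeneous d) (c : ℂ) (x : ι → ℂ) : eval (c • x) f = c ^ d * eval x f := by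
  have := aeval_mul_hom hf c x
  simp at this
  exact this

lemma sum_comp {ι : Type} (f : MvPolynomial ι ℂ) :
    ∑ d ∈ Finset.range (f.totalDegree + 1), homogeneousComponent d f = f :=
  sum_homogeneousComponent f

lemma aeval_mul_sum {ι D : Type} [CommRing D] [Algebra ℂ D] (f : MvPolynomial ι ℂ) 
    (c : D) (x : ι → D) : aeval (fun i => c * x i) f =
      ∑ d ∈ Finset.range (f.totalDegree + 1), c ^ d * aeval x (homogeneousComponent d f) := by
  conv_lhs => rw [← sum_comp f]
  rw [map_sum]
  exact Finset.sum_congr rfl fun d _ => aeval_mul_hom (homogeneousComponent_isHomogeneous d f) c x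

/-- restriction of a polynomial to a line through origin, as a polynomial in `t` -/
def lineP {ι : Type} (f : MvPolynomial ι ℂ) (v : ι → ℂ) : Polynomial ℂ :=
  aeval (fun i => Polynomial.X * Polynomial.C (v i)) f

lemma lineP_eval {ι : Type} (f : MvPolynomial ι ℂ) (v : ι → ℂ) (t : ℂ) :
    (lineP f v).eval t = eval (t • v) f := by
  have : (Polynomial.aeval t).comp (aeval (fun i => Polynomial.X * Polynomial.C (v i)) :
      MvPolynomial ι ℂ →ₐ[ℂ] Polynomial ℂ) = aeval (t • v) := by
    ext i; simp; ring
  have := DFunLike.congr_fun this f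
  simpa [lineP, coe_aeval_eq_eval] using this

lemma lineP_mul {ι : Type} (f g : MvPolynomial ι ℂ) (v : ι → ℂ) :
    lineP (f * g) v = lineP f v * lineP g v := map_mul _ _ _

lemma lineP_coeff {ι : Type} (f : MvPolynomial ι ℂ) (v : ι → ℂ) (d : ℕ) :
    (lineP f v).coeff d = eval v (homogeneousComponent d f) := by
  have h : lineP f v = ∑ d ∈ Finset.range (f.totalDegree + 1), Polynomial.X ^ d * Polynomial.C (eval v (homogeneousComponent d f)) := by
    rw [lineP, aeval_mul_sum]
    refine Finset.sum_congr rfl fun d _ => ?_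
    congr 1
    have : (aeval (fun i => Polynomial.C (v i)) : MvPolynomial ι ℂ →ₐ[ℂ] Polynomial ℂ) =
      (Algebra.ofId ℂ (Polynomial ℂ)).comp (aeval v) := by ext i; simp
    rw [this]
    simp
  rw [h, Polynomial.finsetSum_coeff]
  simp only [mul_comm (Polynomial.X ^ _), Polynomial.coeff_C_mul_X_pow]
  rw [Finset.sum_ite_eq]
  split_ifs with h2
  · rfl
  · rw [homogeneousComponent_eq_zero]; · simp
    simp at h2; omega

lemma lineP_zero {ι : Type} {f : MvPolynomial ι ℂ} {v : ι → ℂ}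
    (h : ∀ t : ℂ, t ≠ 0 → eval (t • v) f = 0) : lineP f v = 0 := by
  apply Polynomial.eq_zero_of_infinite_isRoot
  refine Set.Infinite.mono (s := {0}ᶜ) ?_ (Set.finite_singleton (0:ℂ)).infinite_compl
  intro t ht
  change (lineP f v).eval t = 0
  rw [lineP_eval]; exact h t ht

lemma mk_eq_iff {n : ℕ} {v : Fin n → ℂ} (hv : v ≠ 0) (x : PrV n) :
    Projectivization.mk ℂ v hv = x ↔ ∃ c : ℂ, c ≠ 0 ∧ v = c • x.rep := by
  conv_lhs => rw [← x.mk_rep]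
  rw [Projectivization.mk_eq_mk_iff']
  constructor
  · rintro ⟨c, hc⟩
    refine ⟨c, ?_, hc.symm⟩
    rintro rfl; simp at hc; exact hv hc.symm
  · rintro ⟨c, _, hc⟩; exact ⟨c, hc.symm⟩

lemma mem_pZero {n : ℕ} {f : MP n} {x : PrV n} : x ∈ pZero f ↔ lineP f x.rep = 0 := by
  constructor
  · intro h
    apply lineP_zero
    intro t ht
    exact h _ (smul_ne_zero ht x.rep_nonzero) ((mk_eq_iff _ _).mpr ⟨t, ht, rfl⟩)
  · intro h v hv hx
    obtain ⟨c, hc, rfl⟩ := (mk_eq_iff _ _).mp hx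
    rw [← lineP_eval, h]; simp

lemma mem_pZero_hom {n d : ℕ} {f : MP n} (hf : f.IsHomogeneous d) {x : PrV n} :
    x ∈ pZero f ↔ eval x.rep f = 0 := by
  constructor
  · intro h; exact h _ x.rep_nonzero x.mk_rep
  · intro h v hv hx
    obtain ⟨c, hc, rfl⟩ := (mk_eq_iff _ _).mp hx
    rw [eval_smul_hom hf, h, mul_zero]

lemma mem_pZero_comp {n : ℕ} {f : MP n} {x : PrV n} :
    x ∈ pZero f ↔ ∀ d, x ∈ pZero (homogeneousComponent d f) := by
  simp only [mem_pZero_hom (homogeneousComponent_isHomogeneous _ f), ← lineP_coeff]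
  rw [mem_pZero, Polynomial.ext_iff]; simp

lemma mem_idealOf {n : ℕ} {S : Set (PrV n)} {f : MP n} : f ∈ idealOf S ↔ ∀ x ∈ S, x ∈ pZero f :=
  Iff.rfl

lemma idealOf_comp {n : ℕ} {S : Set (PrV n)} {f : MP n} (hf : f ∈ idealOf S) (d : ℕ) :
    homogeneousComponent d f ∈ idealOf S := fun _ hx => mem_pZero_comp.mp (hf hx) d

lemma pZero_closed {n : ℕ} (f : MP n) : IsClosed (pZero f) :=
  ⟨TopologicalSpace.isOpen_generateFrom_of_mem ⟨f, rfl⟩⟩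

lemma open_sep {n : ℕ} {U : Set (PrV n)} (hU : IsOpen U) : ∀ x ∈ U, ∃ (g : MP n) (d : ℕ),
    g.IsHomogeneous d ∧ x ∉ pZero g ∧ ∀ y, y ∉ U → y ∈ pZero g := by
  change TopologicalSpace.GenerateOpen _ U at hU
  induction hU with
  | basic s hs =>
    obtain ⟨f, rfl⟩ := hs
    intro x hx
    rw [mem_compl_iff, mem_pZero_comp] at hx
    push Not at hx
    obtain ⟨d, hd⟩ := hx
    refine ⟨_, d, homogeneousComponent_isHomogeneous d f, hd, fun y hy => ?_⟩
    rw [mem_compl_iff, not_not] at hy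
    exact mem_pZero_comp.mp hy d
  | univ =>
    intro x _
    refine ⟨1, 0, isHomogeneous_one _ _, ?_, fun y hy => (hy trivial).elim⟩
    rw [mem_pZero_hom (isHomogeneous_one _ _)]; simp
  | inter s t _ _ h1 h2 =>
    intro x hx
    obtain ⟨g1, d1, a1, b1, c1⟩ := h1 x hx.1
    obtain ⟨g2, d2, a2, b2, c2⟩ := h2 x hx.2
    refine ⟨g1 * g2, _, a1.mul a2, ?_, ?_⟩
    · rw [mem_pZero_hom (a1.mul a2)]
      rw [mem_pZero_hom a1] at b1
      rw [mem_pZero_hom a2] at b2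
      simp [b1, b2]
    · intro y hy
      rw [mem_pZero, lineP_mul]
      by_cases h : y ∈ s
      · have : y ∉ t := fun ht => hy ⟨h, ht⟩
        rw [mem_pZero.mp (c2 y this), mul_zero]
      · rw [mem_pZero.mp (c1 y h), zero_mul]
  | sUnion S _ ih =>
    rintro x ⟨s, hs, hx⟩
    obtain ⟨g, d, a, b, c⟩ := ih s hs x hx
    exact ⟨g, d, a, b, fun y hy => c y fun h => hy ⟨s, hs, h⟩⟩

lemma closed_sep {n : ℕ} {S : Set (PrV n)} (hS : IsClosed S) {x : PrV n} (hx : x ∉ S) :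
    ∃ (g : MP n) (d : ℕ), g.IsHomogeneous d ∧ eval x.rep g ≠ 0 ∧ g ∈ idealOf S := by
  obtain ⟨g, d, a, b, c⟩ := open_sep hS.isOpen_compl x hx
  exact ⟨g, d, a, by rwa [mem_pZero_hom a] at b, fun y hy => c y (by simpa using hy)⟩

lemma idealOf_mono {n : ℕ} {S T : Set (PrV n)} (h : S ⊆ T) : idealOf T ≤ idealOf S :=
  fun _ hf => h.trans hf

lemma idealOf_closure {n : ℕ} (S : Set (PrV n)) : idealOf (closure S) = idealOf S :=
  le_antisymm (idealOf_mono subset_closure)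
    fun f hf => closure_minimal (show S ⊆ pZero f from hf) (pZero_closed f)

lemma idealOf_prime {n : ℕ} {S : Set (PrV n)} (hS : IsIrreducible S) : (idealOf S).IsPrime := by
  refine ⟨?_, ?_⟩
  · rw [Ideal.ne_top_iff_one]
    intro h
    obtain ⟨x, hx⟩ := hS.1
    have := (mem_pZero_hom (isHomogeneous_one _ _)).mp (mem_idealOf.mp h x hx)
    simp at this
  · intro f g hfg
    have h1 : S ⊆ pZero f ∪ pZero g := by
      intro x hx
      have := mem_pZero.mp (hfg hx)
      rw [lineP_mul] at this
      rcases mul_eq_zero.mp this with h | h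
      · exact Or.inl (mem_pZero.mpr h)
      · exact Or.inr (mem_pZero.mpr h)
    exact isPreirreducible_iff_isClosed_union_isClosed.mp hS.2 _ _ (pZero_closed f) (pZero_closed g) h1

/-- `D`-valued point of the zero scheme of `I` -/
def OnC {n : ℕ} (I : Ideal (MP n)) {D : Type} [CommRing D] [Algebra ℂ D] (x : Fin n → D) : Prop :=
  ∀ f ∈ I, aeval x f = 0

def HomI {n : ℕ} (I : Ideal (MP n)) : Prop := ∀ f ∈ I, ∀ d, homogeneousComponent d f ∈ I

lemma homI_idealOf {n : ℕ} (S : Set (PrV n)) : HomI (idealOf S) := fun _ hf d => idealOf_comp hf d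

lemma OnC.smul {n : ℕ} {I : Ideal (MP n)} (hI : HomI I) {D : Type} [CommRing D] [Algebra ℂ D]
    {x : Fin n → D} (hx : OnC I x) (c : D) : OnC I (c • x) := by
  intro f hf
  have := aeval_mul_sum f c x
  refine this.trans (Finset.sum_eq_zero fun d _ => ?_)
  rw [hx _ (hI f hf d), mul_zero]

lemma OnC.map {n : ℕ} {I : Ideal (MP n)} {D E : Type} [CommRing D] [Algebra ℂ D] [CommRing E]
    [Algebra ℂ E] {x : Fin n → D} (hx : OnC I x) (q : D →ₐ[ℂ] E) : OnC I (fun i => q (x i)) := by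
  intro f hf
  have := comp_aeval_apply q f (f := x)
  rw [← this, hx f hf, map_zero]

lemma onC_eval {n : ℕ} {I : Ideal (MP n)} {v : Fin n → ℂ} : OnC I v ↔ ∀ f ∈ I, eval v f = 0 := by
  simp [OnC, coe_aeval_eq_eval]

lemma onC_rep {n : ℕ} {S : Set (PrV n)} {x : PrV n} (hx : x ∈ S) : OnC (idealOf S) x.rep :=
  onC_eval.mpr fun _ hf => hf hx _ x.rep_nonzero x.mk_rep

lemma onC_mk {n : ℕ} {S : Set (PrV n)} (hS : IsClosed S) {v : Fin n → ℂ} (hv : v ≠ 0)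
    (h : OnC (idealOf S) v) : Projectivization.mk ℂ v hv ∈ S := by
  by_contra hx
  obtain ⟨g, d, a, b, c⟩ := closed_sep hS hx
  apply b
  obtain ⟨k, hk, e⟩ := (mk_eq_iff hv _).mp rfl
  have h1 := onC_eval.mp h g c
  rw [e] at h1
  rw [eval_smul_hom a] at h1
  exact (mul_eq_zero.mp h1).resolve_left (pow_ne_zero _ hk)


/-- coordinates on the quotient -/
def xq {n : ℕ} (I : Ideal (MP n)) (i : Fin n) : MP n ⧸ I := Ideal.Quotient.mk I (X i)

lemma aeval_xq {n : ℕ} (I : Ideal (MP n)) (f : MP n) : aeval (xq I) f = Ideal.Quotient.mk I f := by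
  have : (aeval (xq I) : MP n →ₐ[ℂ] MP n ⧸ I) = Ideal.Quotient.mkₐ ℂ I := by
    ext i; simp [xq]
  rw [this]; rfl

lemma onC_xq {n : ℕ} (I : Ideal (MP n)) : OnC I (xq I) := fun f hf => by
  rw [aeval_xq, Ideal.Quotient.eq_zero_iff_mem]; exact hf

def hq {n : ℕ} {I : Ideal (MP n)} {D : Type} [CommRing D] [Algebra ℂ D] {x : Fin n → D}
    (hx : OnC I x) : MP n ⧸ I →ₐ[ℂ] D := Ideal.Quotient.liftₐ I (aeval x) hx

@[simp] lemma hq_xq {n : ℕ} {I : Ideal (MP n)} {D : Type} [CommRing D] [Algebra ℂ D] {x : Fin n → D}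
    (hx : OnC I x) (i : Fin n) : hq hx (xq I i) = x i := by
  change aeval x (X i) = x i; simp

lemma hom_ext_xq {n : ℕ} {I : Ideal (MP n)} {D : Type} [CommRing D] [Algebra ℂ D]
    {f g : MP n ⧸ I →ₐ[ℂ] D} (h : ∀ i, f (xq I i) = g (xq I i)) : f = g := by
  apply Ideal.Quotient.algHom_ext
  apply MvPolynomial.algHom_ext
  exact h

lemma taylor {ι D : Type} [Fintype ι] [CommRing D] [Algebra ℂ D] (f : MvPolynomial ι ℂ)
    (x v : ι → D) (u : D) : ∃ w, aeval (fun i => x i + u * v i) f =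
      aeval x f + u * ∑ i, aeval x (pderiv i f) * v i + u ^ 2 * w := by
  classical
  induction f using MvPolynomial.induction_on with
  | C a => exact ⟨0, by simp⟩
  | add p q hp hq =>
    obtain ⟨w1, h1⟩ := hp
    obtain ⟨w2, h2⟩ := hq
    refine ⟨w1 + w2, ?_⟩
    simp only [map_add, h1, h2, add_mul, Finset.sum_add_distrib]; ring
  | mul_X p j hp =>
    obtain ⟨w, h⟩ := hp
    refine ⟨w * (x j + u * v j) + (∑ i, aeval x (pderiv i p) * v i) * v j, ?_⟩
    have : ∑ i, aeval x (pderiv i (p * X j)) * v i =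
        (∑ i, aeval x (pderiv i p) * v i) * x j + aeval x p * v j := by
      simp only [pderiv_mul, map_add, map_mul, aeval_X, add_mul, Finset.sum_add_distrib]
      congr 1
      · rw [Finset.sum_mul]; exact Finset.sum_congr rfl fun i _ => by ring
      · rw [Finset.sum_eq_single j]
        · simp
        · intro i _ hi; rw [pderiv_X_of_ne (Ne.symm hi)]; simp
        · simp
    rw [this, map_mul, h, map_mul, aeval_X, aeval_X]; ring

def dot {ι D : Type} [Fintype ι] [CommRing D] [Algebra ℂ D] (f : MvPolynomial ι ℂ) (x v : ι → D) : D :=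
  ∑ i, aeval x (pderiv i f) * v i

lemma jacLin_apply {n : ℕ} (f : MP n) (v u : Fin n → ℂ) :
    jacLin f v u = ∑ i, eval v (pderiv i f) * u i := by
  simp [jacLin]

def TanI {n : ℕ} (I : Ideal (MP n)) (v : Fin n → ℂ) : Submodule ℂ (Fin n → ℂ) :=
  ⨅ f ∈ I, LinearMap.ker (jacLin f v)

lemma mem_TanI {n : ℕ} {I : Ideal (MP n)} {v u : Fin n → ℂ} :
    u ∈ TanI I v ↔ ∀ f ∈ I, ∑ i, eval v (pderiv i f) * u i = 0 := by
  simp [TanI, Submodule.mem_iInf, jacLin_apply]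

lemma affTangent_eq {n : ℕ} (S : Set (PrV n)) (v : Fin n → ℂ) : affTangent S v = TanI (idealOf S) v := rfl

def dpt {ι : Type} (v u : ι → ℂ) : ι → DualNumber ℂ :=
  fun i => TrivSqZeroExt.inl (v i) + TrivSqZeroExt.inr (u i)

lemma aeval_dpt {ι : Type} [Fintype ι] (f : MvPolynomial ι ℂ) (v u : ι → ℂ) :
    aeval (dpt v u) f = TrivSqZeroExt.inl (eval v f) +
      TrivSqZeroExt.inr (∑ i, eval v (pderiv i f) * u i) := by
  have hD : (TrivSqZeroExt.sndHom ℂ ℂ : DualNumber ℂ →ₗ[ℂ] ℂ) ∈ PDer (TrivSqZeroExt.fstHom ℂ ℂ ℂ) := by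
    intro a b
    simp [mul_comm]
  ext
  · have := pt_aeval (TrivSqZeroExt.fstHom ℂ ℂ ℂ) (dpt v u) f
    simpa [dpt] using this
  · have := pder_aeval hD (dpt v u) f
    simpa [dpt] using this

lemma mem_TanI_iff {n : ℕ} {I : Ideal (MP n)} {v u : Fin n → ℂ} (hv : OnC I v) :
    u ∈ TanI I v ↔ OnC I (dpt v u) := by
  rw [mem_TanI]
  refine forall₂_congr fun f hf => ?_
  rw [aeval_dpt, onC_eval.mp hv f hf]
  constructor
  · intro h; rw [h]; simp
  · intro h; have := congrArg TrivSqZeroExt.snd h; simpa using this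

lemma TanI_smul {n : ℕ} {I : Ideal (MP n)} (hI : HomI I) {v : Fin n → ℂ} (hv : OnC I v)
    {c : ℂ} (hc : c ≠ 0) : TanI I (c • v) = TanI I v := by
  have key : ∀ (v u : Fin n → ℂ) (c : ℂ), c ≠ 0 → OnC I v → u ∈ TanI I v → u ∈ TanI I (c • v) := by
    intro v u c hc hv hu
    have h1 := ((mem_TanI_iff hv).mp hu).smul hI (algebraMap ℂ _ c)
    have h2 : (algebraMap ℂ (DualNumber ℂ) c) • dpt v u = dpt (c • v) (c • u) := by
      funext i
      ext <;> simp [dpt, TrivSqZeroExt.algebraMap_eq_inl]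
    rw [h2] at h1
    have h3 := (mem_TanI_iff (hv.smul hI c)).mpr h1
    exact ((TanI I (c • v)).smul_mem_iff hc).mp h3
  apply le_antisymm
  · intro u hu
    have := key (c • v) u c⁻¹ (inv_ne_zero hc) (hv.smul hI c) hu
    rwa [inv_smul_smul₀ hc] at this
  · intro u hu; exact key v u c hc hv hu

lemma pder_TanI {n : ℕ} {I : Ideal (MP n)} {A : Type} [CommRing A] [Algebra ℂ A] {x : Fin n → A}
    (hx : OnC I x) {ξ : A →ₐ[ℂ] ℂ} {D : A →ₗ[ℂ] ℂ} (hD : D ∈ PDer ξ) :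
    (fun i => D (x i)) ∈ TanI I (fun i => ξ (x i)) := by
  rw [mem_TanI]
  intro f hf
  rw [← pder_aeval hD x f, hx f hf, map_zero]

lemma pder_ext_xq {n : ℕ} {I : Ideal (MP n)} {ξ : MP n ⧸ I →ₐ[ℂ] ℂ} {D : MP n ⧸ I →ₗ[ℂ] ℂ}
    (hD : D ∈ PDer ξ) (h : ∀ i, D (xq I i) = 0) : D = 0 := by
  ext a
  obtain ⟨f, rfl⟩ := Ideal.Quotient.mk_surjective a
  rw [← aeval_xq, pder_aeval hD]
  simp [h]

lemma td_le_TanI {n : ℕ} {I : Ideal (MP n)} [I.IsPrime] {v : Fin n → ℂ} (hv : OnC I v) :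
    td (MP n ⧸ I) ≤ Module.finrank ℂ (TanI I v) := by
  have e : (fun i => hq hv (xq I i)) = v := by funext i; simp
  refine td_le_finrank (ξ := hq hv) (xq I) (TanI I v) (fun D hD => ?_) (fun D hD h => pder_ext_xq hD h)
  have := pder_TanI (onC_xq I) hD
  rwa [e] at this

lemma irr_lt {n : ℕ} {S : Set (PrV n)} (hS : S.Nonempty) :
    idealOf S < RingHom.ker (aeval (0 : Fin n → ℂ) : MP n →ₐ[ℂ] ℂ) := by
  obtain ⟨x, hx⟩ := hS
  have hle : idealOf S ≤ RingHom.ker (aeval (0 : Fin n → ℂ) : MP n →ₐ[ℂ] ℂ) := by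
    intro f hf
    have h1 := mem_pZero.mp (hf hx)
    have := lineP_eval f x.rep 0
    rw [h1] at this
    rw [RingHom.mem_ker]
    simpa using this.symm
  refine lt_of_le_of_ne hle fun h => ?_
  obtain ⟨j, hj⟩ := Function.ne_iff.mp x.rep_nonzero
  have : (X j : MP n) ∈ idealOf S := by rw [h, RingHom.mem_ker]; simp
  have := (onC_eval.mp (onC_rep hx)) _ this
  simp at this; exact hj this

lemma td_ge {n m : ℕ} {S : Set (PrV n)} (hcl : IsClosed S)
    (hdim : pdim S = ((m : ℕ∞) : WithBot ℕ∞)) [(idealOf S).IsPrime] : m + 1 ≤ td (MP n ⧸ idealOf S) := by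
  have hne : Nonempty (TopologicalSpace.IrreducibleCloseds S) := by
    rw [pdim, topologicalKrullDim] at hdim
    by_contra h
    rw [not_nonempty_iff] at h
    rw [Order.krullDim_eq_bot] at hdim
    exact WithBot.coe_ne_bot hdim.symm
  obtain ⟨l, hl⟩ : ∃ l : LTSeries (TopologicalSpace.IrreducibleCloseds S), l.length = m := by
    rw [pdim, topologicalKrullDim] at hdim
    exact (Order.le_krullDim_iff).mp hdim.ge
  subst hl
  let T : Fin (l.length + 1) → Set (PrV n) := fun i => Subtype.val '' ((l i : TopologicalSpace.IrreducibleCloseds S) : Set S)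
  have hTc : ∀ i, IsClosed (T i) := fun i => hcl.isClosedMap_subtype_val _ (l i).isClosed
  have hTi : ∀ i, IsIrreducible (T i) := fun i => (l i).isIrreducible.image _ continuous_subtype_val.continuousOn
  have hlt : ∀ i j, i < j → idealOf (T j) < idealOf (T i) := by
    intro i j hij
    have h1 : l i < l j := l.strictMono hij
    have h2 : ((l i : TopologicalSpace.IrreducibleCloseds S) : Set S) ⊂ (l j : Set S) := h1
    refine lt_of_le_of_ne (idealOf_mono (Set.image_mono h2.1)) fun h => h2.2 fun x hx => ?_
    by_contra hxi
    have : (x : PrV n) ∉ T i := by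
      rintro ⟨y, hy, hyx⟩
      rw [Subtype.ext hyx] at hy; exact hxi hy
    obtain ⟨g, d, a, b, c⟩ := closed_sep (hTc i) this
    rw [← h] at c
    exact b (onC_eval.mp (onC_rep (S := T j) ⟨x, hx, rfl⟩) g c)
  let p : Fin (l.length + 1 + 1) → PrimeSpectrum (MP n) :=
    Fin.snoc (α := fun _ => PrimeSpectrum (MP n)) (fun i => ⟨idealOf (T i.rev), idealOf_prime (hTi _)⟩)
      ⟨RingHom.ker (aeval (0 : Fin n → ℂ) : MP n →ₐ[ℂ] ℂ), RingHom.ker_isPrime _⟩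
  have hp : StrictMono p := by
    intro i j hij
    induction j using Fin.lastCases with
    | last =>
      induction i using Fin.lastCases with
      | last => exact (lt_irrefl _ hij).elim
      | cast i =>
        simp only [p, Fin.snoc_last, Fin.snoc_castSucc]
        exact irr_lt (hTi _).1
    | cast j =>
      induction i using Fin.lastCases with
      | last => exact absurd hij (not_lt.mpr (Fin.le_last _))
      | cast i =>
        simp only [p, Fin.snoc_castSucc]
        exact hlt _ _ (Fin.rev_lt_rev.mpr (by simpa using hij))
  have h1 := td_series _ p hp
  have h0 : (p 0).asIdeal = idealOf (T (Fin.last _)) := by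
    have : (0 : Fin (l.length + 1 + 1)) = Fin.castSucc 0 := rfl
    rw [this]; simp only [p, Fin.snoc_castSucc]; simp
  have h2 : idealOf S ≤ (p 0).asIdeal := by
    rw [h0]; apply idealOf_mono; rintro _ ⟨y, _, rfl⟩; exact y.2
  have h3 : td (MP n ⧸ (p 0).asIdeal) ≤ td (MP n ⧸ idealOf S) := td_le_of_surjective (Ideal.Quotient.factorₐ ℂ h2) (Ideal.Quotient.factor_surjective h2)
  omega


lemma exists_other {n : ℕ} (hn : 2 ≤ n) {Z : Set (PrV n)} (hnd : NondegenerateSet Z) (x : PrV n) :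
    ∃ y ∈ Z, y ≠ x := by
  by_contra! h
  have : Submodule.span ℂ {x.rep} < ⊤ := by
    refine lt_top_iff_ne_top.mpr fun hc => ?_
    have h1 := finrank_span_singleton (K := ℂ) x.rep_nonzero
    rw [hc, finrank_top] at h1
    simp at h1; omega
  obtain ⟨φ, hφ, hle⟩ := Submodule.exists_le_ker_of_lt_top _ this
  refine hnd {y | φ y.rep = 0} ⟨φ, hφ, rfl⟩ fun y hy => ?_
  rw [h y hy]
  exact hle (Submodule.mem_span_singleton_self _)

lemma onC_lift {n : ℕ} {S : Set (PrV n)} (hS : IsClosed S) {v : Fin n → ℂ} (hv : v ≠ 0)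
    (h : OnC (idealOf S) v) : ∃ x ∈ S, ∃ c : ℂ, c ≠ 0 ∧ v = c • x.rep :=
  ⟨_, onC_mk hS hv h, (mk_eq_iff hv _).mp rfl⟩

lemma secant_poly {n : ℕ} (hn : 2 ≤ n) {Z : Set (PrV n)} (hcl : IsClosed Z)
    (hnd : NondegenerateSet Z) (hproj : secantVariety Z ≠ Set.univ) :
    ∃ (F : MP n) (d : ℕ), F.IsHomogeneous d ∧ F ≠ 0 ∧ eval 0 F = 0 ∧
      ∀ a b : Fin n → ℂ, OnC (idealOf Z) a → OnC (idealOf Z) b → eval (a + b) F = 0 := by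
  obtain ⟨x, hx⟩ := (Set.ne_univ_iff_exists_notMem _).mp hproj
  obtain ⟨g, d, h1, h2, h3⟩ := closed_sep isClosed_closure hx
  obtain ⟨j, hj⟩ := Function.ne_iff.mp x.rep_nonzero
  have hz : eval (0 : Fin n → ℂ) (g * X j) = 0 := by simp
  refine ⟨g * X j, d + 1, h1.mul (isHomogeneous_X _ _), ?_, hz, ?_⟩
  · intro h
    have := congrArg (eval x.rep) h
    simp [h2] at this
    exact hj this
  · intro a b ha hb
    by_cases hab : a + b = 0
    · rw [hab, hz]
    rw [map_mul]
    apply mul_eq_zero_of_left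
    suffices H : Projectivization.mk ℂ (a + b) hab ∈ secantVariety Z from
      h3 H _ hab rfl
    apply subset_closure
    obtain ⟨k, hk, e⟩ := (mk_eq_iff hab _).mp rfl
    set z := Projectivization.mk ℂ (a + b) hab
    have key : ∀ x ∈ Z, ∀ y ∈ Z, x ≠ y → a + b ∈ Submodule.span ℂ {x.rep, y.rep} →
        z ∈ (⋃ x ∈ Z, ⋃ y ∈ Z, ⋃ _ : x ≠ y, lineThrough x y) := by
      intro x hx y hy hxy hm
      simp only [mem_iUnion]
      refine ⟨x, hx, y, hy, hxy, ?_⟩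
      rw [e] at hm
      exact (Submodule.smul_mem_iff _ hk).mp hm
    have key1 : ∀ x ∈ Z, a + b ∈ Submodule.span ℂ {x.rep} →
        z ∈ (⋃ x ∈ Z, ⋃ y ∈ Z, ⋃ _ : x ≠ y, lineThrough x y) := by
      intro x hx hm
      obtain ⟨y, hy, hyx⟩ := exists_other hn hnd x
      exact key x hx y hy hyx.symm (Submodule.span_mono (by simp) hm)
    by_cases ha0 : a = 0
    · have hb0 : b ≠ 0 := by rintro rfl; simp [ha0] at hab
      obtain ⟨y, hy, c, hc, e2⟩ := onC_lift hcl hb0 hb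
      refine key1 y hy ?_
      rw [ha0, e2, zero_add]; exact Submodule.smul_mem _ _ (Submodule.mem_span_singleton_self _)
    obtain ⟨x, hx, c, hc, e1⟩ := onC_lift hcl ha0 ha
    by_cases hb0 : b = 0
    · refine key1 x hx ?_
      rw [hb0, e1, add_zero]; exact Submodule.smul_mem _ _ (Submodule.mem_span_singleton_self _)
    obtain ⟨y, hy, c', hc', e2⟩ := onC_lift hcl hb0 hb
    by_cases hxy : x = y
    · subst hxy
      refine key1 x hx ?_
      rw [e1, e2]
      exact Submodule.add_mem _ (Submodule.smul_mem _ _ (Submodule.mem_span_singleton_self _))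
        (Submodule.smul_mem _ _ (Submodule.mem_span_singleton_self _))
    · refine key x hx y hy hxy ?_
      rw [e1, e2]
      exact Submodule.add_mem _ (Submodule.smul_mem _ _ (Submodule.subset_span (by simp)))
        (Submodule.smul_mem _ _ (Submodule.subset_span (by simp)))

lemma aff_open_sep {σ : Type} {U : Set (σ → ℂ)} (hU : @IsOpen _ (affTop σ) U) :
    ∀ x ∈ U, ∃ g : MvPolynomial σ ℂ, eval x g ≠ 0 ∧ ∀ y, eval y g ≠ 0 → y ∈ U := by
  change TopologicalSpace.GenerateOpen _ U at hU
  induction hU with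
  | basic s hs => obtain ⟨f, rfl⟩ := hs; intro x hx; exact ⟨f, hx, fun y hy => hy⟩
  | univ => exact fun x _ => ⟨1, by simp, fun y _ => trivial⟩
  | inter s t _ _ h1 h2 =>
    intro x hx
    obtain ⟨g1, a1, b1⟩ := h1 x hx.1
    obtain ⟨g2, a2, b2⟩ := h2 x hx.2
    refine ⟨g1 * g2, by simp [a1, a2], fun y hy => ?_⟩
    rw [map_mul] at hy
    exact ⟨b1 y (left_ne_zero_of_mul hy), b2 y (right_ne_zero_of_mul hy)⟩
  | sUnion S _ ih =>
    rintro x ⟨s, hs, hx⟩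
    obtain ⟨g, a, b⟩ := ih s hs x hx
    exact ⟨g, a, fun y hy => ⟨s, hs, b y hy⟩⟩

lemma exists_eval_ne {σ : Type} {f : MvPolynomial σ ℂ} (hf : f ≠ 0) : ∃ x, eval x f ≠ 0 := by
  by_contra! h
  exact hf (MvPolynomial.funext fun x => by simp [h x])

lemma genericAff_of_poly {σ : Type} {P : (σ → ℂ) → Prop} {G : MvPolynomial σ ℂ} (hG : G ≠ 0)
    (h : ∀ w, eval w G ≠ 0 → P w) : GenericAff P := by
  refine ⟨{w | eval w G ≠ 0}, TopologicalSpace.isOpen_generateFrom_of_mem ⟨G, rfl⟩, ?_, h⟩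
  let _ := affTop σ
  rw [dense_iff_inter_open]
  rintro O hO ⟨x, hx⟩
  obtain ⟨g, hg, hgO⟩ := aff_open_sep hO x hx
  have hg0 : g ≠ 0 := by rintro rfl; simp at hg
  obtain ⟨y, hy⟩ := exists_eval_ne (mul_ne_zero hg0 hG)
  rw [map_mul] at hy
  exact ⟨y, hgO y (left_ne_zero_of_mul hy), right_ne_zero_of_mul hy⟩

/-- signed maximal minors -/
def kap {r : ℕ} {D : Type} [CommRing D] (w : Fin (r+1) × Fin (r+2) → D) (j : Fin (r+2)) : D :=
  (-1) ^ (j : ℕ) * Matrix.det (Matrix.of fun i k : Fin (r+1) => w (i, j.succAbove k))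

lemma kap_map {r : ℕ} {D E : Type} [CommRing D] [CommRing E] (q : D →+* E)
    (w : Fin (r+1) × Fin (r+2) → D) (j : Fin (r+2)) : q (kap w j) = kap (fun p => q (w p)) j := by
  simp only [kap, map_mul, map_pow, map_neg, map_one, RingHom.map_det]; rfl

lemma matLin_apply {a b : ℕ} (w : Fin a × Fin b → ℂ) (v : Fin b → ℂ) (i : Fin a) :
    matLin w v i = ∑ j, w (i, j) * v j := by
  simp [matLin, Matrix.mulVec, dotProduct]

lemma matLin_kap {r : ℕ} (w : Fin (r+1) × Fin (r+2) → ℂ) : matLin w (kap w) = 0 := by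
  funext i
  rw [matLin_apply]
  let N : Matrix (Fin (r+2)) (Fin (r+2)) ℂ := Matrix.of (Fin.cons (fun j => w (i, j)) (fun i j => w (i, j)))
  have h1 : N.det = 0 := by
    apply Matrix.det_zero_of_row_eq (i := 0) (j := i.succ) (Fin.succ_ne_zero i).symm
    rfl
  rw [Matrix.det_succ_row_zero] at h1
  rw [Pi.zero_apply, ← h1]
  refine Finset.sum_congr rfl fun j _ => ?_
  have : (Matrix.of fun i k : Fin (r+1) => w (i, j.succAbove k)) = N.submatrix Fin.succ j.succAbove := by
    ext a b; simp [N]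
  rw [kap, this]; simp [N]; ring

lemma kap_poly_ne {r d : ℕ} {F : MP (r+2)} (hF : F.IsHomogeneous d) (hF0 : F ≠ 0) :
    (aeval (fun j => kap (D := MvPolynomial (Fin (r+1) × Fin (r+2)) ℂ) (fun p => X p) j) F :
      MvPolynomial (Fin (r+1) × Fin (r+2)) ℂ) ≠ 0 ∧ ∀ w, 
      eval w (aeval (fun j => kap (D := MvPolynomial (Fin (r+1) × Fin (r+2)) ℂ) (fun p => X p) j) F) =
        eval (kap w) F := by
  have h2 : ∀ w, eval w (aeval (fun j => kap (D := MvPolynomial (Fin (r+1) × Fin (r+2)) ℂ) (fun p => X p) j) F) =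
        eval (kap w) F := by
    intro w
    have := pt_aeval (aeval w : MvPolynomial (Fin (r+1) × Fin (r+2)) ℂ →ₐ[ℂ] ℂ)
      (fun j => kap (D := MvPolynomial (Fin (r+1) × Fin (r+2)) ℂ) (fun p => X p) j) F
    simp only [aeval_eq_eval] at this
    refine this.trans ?_
    congr 2
    funext j
    have h3 := kap_map (eval w) (fun p => (X p : MvPolynomial (Fin (r+1) × Fin (r+2)) ℂ)) j
    simpa using h3
  refine ⟨?_, h2⟩
  obtain ⟨v, hv⟩ := exists_eval_ne (mul_ne_zero hF0 (X_ne_zero (R := ℂ) (0 : Fin (r+2))))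
  rw [map_mul, eval_X] at hv
  have hv0 := right_ne_zero_of_mul hv
  have hvF := left_ne_zero_of_mul hv
  let w : Fin (r+1) × Fin (r+2) → ℂ := fun p => Fin.cases (- v p.1.succ / v 0) (fun k => if p.1 = k then 1 else 0) p.2
  have hk0 : kap w 0 = 1 := by
    have : (Matrix.of fun i k : Fin (r+1) => w (i, (0 : Fin (r+2)).succAbove k)) = 1 := by
      ext i k; simp [w, Matrix.one_apply]
    rw [kap, this]; simp
  have hk : ∀ i : Fin (r+1), kap w i.succ = v i.succ / v 0 := by
    intro i
    have := congrFun (matLin_kap w) i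
    rw [matLin_apply, Fin.sum_univ_succ, hk0] at this
    simp [w] at this
    rw [neg_div] at this
    linear_combination this
  have hkv : v = v 0 • kap w := by
    funext j
    refine Fin.cases ?_ (fun i => ?_) j
    · simp [hk0]
    · simp [hk]; field_simp
  intro hc
  have h4 := h2 w
  rw [hc] at h4
  rw [hkv, eval_smul_hom hF, ← h4] at hvF
  simp at hvF

lemma ker_span_kap {r : ℕ} {w : Fin (r+1) × Fin (r+2) → ℂ} (hs : Function.Surjective (matLin w))
    (hk : kap w ≠ 0) (u : Fin (r+2) → ℂ) (hu : matLin w u = 0) : ∃ c : ℂ, u = c • kap w := by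
  have h1 : Module.finrank ℂ (LinearMap.ker (matLin w)) = 1 := by
    have := LinearMap.finrank_range_add_finrank_ker (matLin w)
    rw [LinearMap.range_eq_top.mpr hs, finrank_top] at this
    simp at this; omega
  have h2 := (finrank_eq_one_iff_of_nonzero' (⟨kap w, matLin_kap w⟩ : LinearMap.ker (matLin w))
    (by simpa [Subtype.ext_iff] using hk)).mp h1 ⟨u, hu⟩
  obtain ⟨c, hc⟩ := h2
  exact ⟨c, (congrArg Subtype.val hc).symm⟩


def LD {a b : ℕ} {D : Type} [CommRing D] [Algebra ℂ D] (w : Fin a × Fin b → ℂ) (x : Fin b → D) : Fin a → D :=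
  fun i => ∑ j, w (i, j) • x j

def lam {b : ℕ} {D : Type} [CommRing D] [Algebra ℂ D] (l : Fin b → ℂ) (x : Fin b → D) : D := ∑ j, l j • x j

section
variable {a b : ℕ} {D E : Type} [CommRing D] [Algebra ℂ D] [CommRing E] [Algebra ℂ E]
  (w : Fin a × Fin b → ℂ) (l : Fin b → ℂ)

lemma LD_eq (v : Fin b → ℂ) : LD w v = matLin w v := by
  funext i; simp [LD, matLin_apply]

lemma LD_add (x y : Fin b → D) : LD w (x + y) = LD w x + LD w y := by
  funext i; simp [LD, Finset.sum_add_distrib]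

lemma LD_sub (x y : Fin b → D) : LD w (x - y) = LD w x - LD w y := by
  funext i; simp [LD, smul_sub, Finset.sum_sub_distrib]

lemma LD_smul (c : D) (x : Fin b → D) : LD w (c • x) = c • LD w x := by
  funext i; simp [LD, Finset.mul_sum]

lemma lam_add (x y : Fin b → D) : lam l (x + y) = lam l x + lam l y := by
  simp [lam, Finset.sum_add_distrib]

lemma lam_sub (x y : Fin b → D) : lam l (x - y) = lam l x - lam l y := by
  simp [lam, smul_sub, Finset.sum_sub_distrib]

lemma lam_smul (c : D) (x : Fin b → D) : lam l (c • x) = c * lam l x := by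
  simp [lam, Finset.mul_sum]

lemma LD_map {F : Type} [FunLike F D E] [LinearMapClass F ℂ D E] (q : F) (x : Fin b → D) (i : Fin a) :
    q (LD w x i) = LD w (fun j => q (x j)) i := by
  simp [LD, map_sum]

lemma LD_map' (q : D →ₗ[ℂ] ℂ) (x : Fin b → D) (i : Fin a) :
    q (LD w x i) = LD w (fun j => q (x j)) i := by
  simp [LD, map_sum]

lemma lam_map (q : D →ₐ[ℂ] E) (x : Fin b → D) :
    q (lam l x) = lam l (fun j => q (x j)) := by
  simp [lam, map_sum]

lemma lam_map' (q : D →ₗ[ℂ] ℂ) (x : Fin b → D) :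
    q (lam l x) = lam l (fun j => q (x j)) := by
  simp [lam, map_sum]
end

def cst {b : ℕ} (D : Type) [CommRing D] [Algebra ℂ D] (o : Fin b → ℂ) : Fin b → D := fun j => algebraMap ℂ D (o j)

lemma LD_cst {a b : ℕ} {D : Type} [CommRing D] [Algebra ℂ D] (w : Fin a × Fin b → ℂ) (o : Fin b → ℂ) :
    LD w (cst D o) = cst D (LD w o) := by
  funext i; simp [LD, cst, Algebra.smul_def]

lemma lam_cst {b : ℕ} {D : Type} [CommRing D] [Algebra ℂ D] (l : Fin b → ℂ) (o : Fin b → ℂ) :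
    lam l (cst D o) = algebraMap ℂ D (lam l o) := by
  simp [lam, cst, Algebra.smul_def]

/-- Linear data: `w` a projection with kernel `o`, section `S`, and complementary form `l`. -/
structure LinData {n N : ℕ} (w : Fin N × Fin n → ℂ) (o : Fin n → ℂ) (S : Fin n × Fin N → ℂ) (l : Fin n → ℂ) : Prop where
  dec : ∀ {D : Type} [CommRing D] [Algebra ℂ D] (x : Fin n → D), x = LD S (LD w x) + lam l x • cst D o
  wo : LD w o = 0
  lo : lam l o = 1
  wS : ∀ y : Fin N → ℂ, LD w (LD S y) = y

lemma lin_data {r : ℕ} {w : Fin (r+1) × Fin (r+2) → ℂ} (hs : Function.Surjective (matLin w))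
    (hk : kap w ≠ 0) : ∃ S l, LinData w (kap w) S l := by
  obtain ⟨T, hT⟩ := LinearMap.exists_rightInverse_of_surjective (matLin w) (LinearMap.range_eq_top.mpr hs)
  have hT' : ∀ y, matLin w (T y) = y := fun y => by
    have := DFunLike.congr_fun hT y; simpa using this
  let S : Fin (r+2) × Fin (r+1) → ℂ := fun p => T (Pi.single p.2 1) p.1
  have hS : ∀ y, LD S y = T y := by
    intro y
    funext j
    conv_rhs => rw [pi_eq_sum_univ' y]
    simp only [map_sum, map_smul, Finset.sum_apply, Pi.smul_apply, smul_eq_mul]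
    simp only [LD, S, smul_eq_mul]
    exact Finset.sum_congr rfl fun i _ => by rw [mul_comm]
  have h1 : ∀ k : Fin (r+2), ∃ c : ℂ, (Pi.single k 1 : Fin (r+2) → ℂ) - T (matLin w (Pi.single k 1)) = c • kap w :=
    fun k => ker_span_kap hs hk _ (by rw [map_sub, hT', sub_self])
  choose l hl using h1
  have hd : ∀ {D : Type} [CommRing D] [Algebra ℂ D] (x : Fin (r+2) → D),
      x = LD S (LD w x) + lam l x • cst D (kap w) := by
    intro D _ _ x
    funext j
    have h2 : ∀ k, (if j = k then 1 else 0 : ℂ) = ∑ i, S (j, i) * w (i, k) + l k * kap w j := by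
      intro k
      have h3 := congrFun (hl k) j
      rw [← hS, Pi.sub_apply, sub_eq_iff_eq_add, Pi.smul_apply, smul_eq_mul] at h3
      simp only [LD, Pi.single_apply, matLin_apply, smul_eq_mul] at h3
      rw [h3, add_comm]
      congr 1
      exact Finset.sum_congr rfl fun i _ => by simp
    have h3 : x j = ∑ k, (if j = k then 1 else 0 : ℂ) • x k := by simp
    rw [h3]
    simp only [h2, add_smul, Finset.sum_add_distrib, Finset.sum_smul, mul_smul]
    simp only [Pi.add_apply, LD, Finset.smul_sum, Pi.smul_apply, smul_eq_mul, lam, cst]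
    rw [Finset.sum_comm, Finset.sum_mul]
    congr 1
    refine Finset.sum_congr rfl fun k _ => ?_
    simp only [Algebra.smul_def]; ring
  have hwo : LD w (kap w) = 0 := by rw [LD_eq, matLin_kap]
  refine ⟨S, l, hd, hwo, ?_, fun y => by rw [hS, LD_eq, hT']⟩
  have h4 := hd (kap w)
  rw [hwo] at h4
  obtain ⟨j, hj⟩ := Function.ne_iff.mp hk
  have h5 := congrFun h4 j
  simp [LD, cst] at h5
  have h6 : (1 - lam l (kap w)) * kap w j = 0 := by linear_combination h5
  have h7 := (mul_eq_zero.mp h6).resolve_right hj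
  linear_combination -h7

/-- restriction of a homogeneous form to a line, leading coefficient -/
lemma line_lead {ι A : Type} [CommRing A] [Algebra ℂ A] {F : MvPolynomial ι ℂ} {d : ℕ}
    (hF : F.IsHomogeneous d) (a : ι → A) (o : ι → ℂ) :
    (aeval (fun j => Polynomial.C (a j) + Polynomial.C (algebraMap ℂ A (o j)) * Polynomial.X) F :
      Polynomial A).natDegree ≤ d ∧
    (aeval (fun j => Polynomial.C (a j) + Polynomial.C (algebraMap ℂ A (o j)) * Polynomial.X) F :
      Polynomial A).coeff d = algebraMap ℂ A (eval o F) := by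
  classical
  set g : ι → Polynomial A := fun j => Polynomial.C (a j) + Polynomial.C (algebraMap ℂ A (o j)) * Polynomial.X with hg
  have h1 : ∀ (m : ι →₀ ℕ) (s : Finset ι), (∏ i ∈ s, g i ^ m i).natDegree ≤ ∑ i ∈ s, m i ∧
      (∏ i ∈ s, g i ^ m i).coeff (∑ i ∈ s, m i) = ∏ i ∈ s, (algebraMap ℂ A (o i)) ^ m i := by
    intro m s
    induction s using Finset.induction_on with
    | empty => simp
    | insert i s hi ih =>
      rw [Finset.prod_insert hi, Finset.sum_insert hi, Finset.prod_insert hi]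
      have h2 : (g i).natDegree ≤ 1 := by
        simp only [hg]; rw [add_comm]; exact Polynomial.natDegree_linear_le
      have h3 : (g i ^ m i).natDegree ≤ m i := by
        refine Polynomial.natDegree_pow_le.trans ?_
        nlinarith
      refine ⟨Polynomial.natDegree_mul_le.trans (Nat.add_le_add h3 ih.1), ?_⟩
      rw [Polynomial.coeff_mul_add_eq_of_natDegree_le h3 ih.1, ih.2]
      congr 1
      have := Polynomial.coeff_pow_of_natDegree_le (m := m i) h2
      rw [mul_one] at this
      rw [this]; simp [hg]
  have hdeg : ∀ m ∈ F.support, ∑ i ∈ m.support, m i = d := by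
    intro m hm
    have := hF (mem_support_iff.mp hm)
    rw [Finsupp.weight_apply, Finsupp.sum] at this
    simpa using this
  rw [aeval_def, eval₂_eq]
  constructor
  · refine Polynomial.natDegree_sum_le_of_forall_le _ _ fun m hm => ?_
    rw [Polynomial.algebraMap_apply]
    refine (Polynomial.natDegree_C_mul_le _ _).trans ?_
    rw [← hdeg m hm]; exact (h1 m _).1
  · rw [Polynomial.finsetSum_coeff, eval_eq, map_sum]
    refine Finset.sum_congr rfl fun m hm => ?_
    rw [Polynomial.algebraMap_apply, Polynomial.coeff_C_mul]
    conv_lhs => rw [← hdeg m hm, (h1 m _).2]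
    simp

lemma lam_integral {n N d : ℕ} {w : Fin N × Fin n → ℂ} {o : Fin n → ℂ} {S : Fin n × Fin N → ℂ} {l : Fin n → ℂ}
    (L : LinData w o S l) {F : MP n} (hF : F.IsHomogeneous d) (hFo : eval o F ≠ 0)
    {D : Type} [CommRing D] [Algebra ℂ D] {x : Fin n → D} (hx : aeval x F = 0) :
    (aeval (LD w x) : MP N →ₐ[ℂ] D).toRingHom.IsIntegralElem (lam l x) := by
  obtain ⟨h1, h2⟩ := line_lead hF (A := MP N) (LD S (fun i => X i)) o
  set P := (aeval (fun j => Polynomial.C ((LD S (fun i => (X i : MP N))) j) + Polynomial.C (algebraMap ℂ (MP N) (o j)) * Polynomial.X) F : Polynomial (MP N)) with hP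
  refine ⟨P * Polynomial.C (algebraMap ℂ (MP N) (eval o F)⁻¹), ?_, ?_⟩
  · apply Polynomial.monic_of_natDegree_le_of_coeff_eq_one d
    · exact (Polynomial.natDegree_mul_C_le _ _).trans h1
    · rw [Polynomial.coeff_mul_C, h2, ← map_mul, mul_inv_cancel₀ hFo, map_one]
  · rw [Polynomial.eval₂_mul]
    suffices P.eval₂ (aeval (LD w x) : MP N →ₐ[ℂ] D).toRingHom (lam l x) = 0 by rw [this, zero_mul]
    let g : Polynomial (MP N) →ₐ[ℂ] D := { Polynomial.eval₂RingHom (aeval (LD w x) : MP N →ₐ[ℂ] D).toRingHom (lam l x) with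
      commutes' := fun c => by
        change Polynomial.eval₂ _ _ (Polynomial.C (algebraMap ℂ (MP N) c)) = _
        rw [Polynomial.eval₂_C]; exact AlgHom.commutes _ c }
    have hgd : ∀ p, g p = p.eval₂ (aeval (LD w x) : MP N →ₐ[ℂ] D).toRingHom (lam l x) := fun _ => rfl
    change g P = 0
    rw [hP, comp_aeval_apply, ← hx]
    congr 2
    funext j
    conv_rhs => rw [L.dec x]
    rw [hgd]
    simp only [Pi.add_apply, Polynomial.eval₂_add, Polynomial.eval₂_C, Polynomial.eval₂_mul, Polynomial.eval₂_X]
    congr 1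
    · change aeval (LD w x) (LD S (fun i => (X i : MP N)) j) = _
      rw [LD_map]; simp
    · change aeval (LD w x) (algebraMap ℂ (MP N) (o j)) * _ = _
      rw [AlgHom.commutes, mul_comm]; rfl

lemma x_integral {n N d : ℕ} {w : Fin N × Fin n → ℂ} {o : Fin n → ℂ} {S : Fin n × Fin N → ℂ} {l : Fin n → ℂ}
    (L : LinData w o S l) {F : MP n} (hF : F.IsHomogeneous d) (hFo : eval o F ≠ 0)
    {D : Type} [CommRing D] [Algebra ℂ D] {x : Fin n → D} (hx : aeval x F = 0) (j : Fin n) :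
    (aeval (LD w x) : MP N →ₐ[ℂ] D).toRingHom.IsIntegralElem (x j) := by
  have h1 := lam_integral L hF hFo hx
  have h3 : ∀ c : ℂ, (aeval (LD w x) : MP N →ₐ[ℂ] D).toRingHom.IsIntegralElem (algebraMap ℂ D c) := by
    intro c
    have := (aeval (LD w x) : MP N →ₐ[ℂ] D).toRingHom.isIntegralElem_map (x := algebraMap ℂ _ c)
    have e : (aeval (LD w x) : MP N →ₐ[ℂ] D).toRingHom (algebraMap ℂ _ c) = algebraMap ℂ D c := AlgHom.commutes _ c
    rwa [e] at this
  have h2 : ∀ i, (aeval (LD w x) : MP N →ₐ[ℂ] D).toRingHom.IsIntegralElem (LD w x i) := by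
    intro i
    have := (aeval (LD w x) : MP N →ₐ[ℂ] D).toRingHom.isIntegralElem_map (x := X i)
    simpa using this
  have h4 : LD S (LD w x) j = aeval (LD w x) (LD S (fun i => (X i : MP N)) j) := by
    rw [LD_map]; simp
  rw [L.dec x, Pi.add_apply, h4, ]
  apply RingHom.IsIntegralElem.add
  · rw [← L.dec x]
    exact (aeval (LD w x) : MP N →ₐ[ℂ] D).toRingHom.isIntegralElem_map
  · simp only [Pi.smul_apply, smul_eq_mul]
    rw [← L.dec x]
    exact RingHom.IsIntegralElem.mul _ h1 (h3 _)

lemma lift_pt {A B : Type} [CommRing A] [Algebra ℂ A] [CommRing B] [Algebra ℂ B] [Algebra.FiniteType ℂ B]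
    (f : A →ₐ[ℂ] B) (hf : f.toRingHom.IsIntegral) (ξ : A →ₐ[ℂ] ℂ) (h : ∀ a, f a = 0 → ξ a = 0) :
    ∃ η : B →ₐ[ℂ] ℂ, ∀ a, η (f a) = ξ a := by
  algebraize [f.toRingHom]
  have : Algebra.IsIntegral A B := ⟨hf⟩
  obtain ⟨Q, hQ, hc⟩ := Ideal.exists_ideal_over_maximal_of_isIntegral (S := B) (RingHom.ker ξ) (fun a ha => h a ha)
  obtain ⟨η, hη⟩ := exists_pt Q hQ.ne_top
  refine ⟨η, fun a => ?_⟩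
  have h1 : a - algebraMap ℂ A (ξ a) ∈ RingHom.ker ξ := by simp [RingHom.mem_ker]
  rw [← hc] at h1
  have h2 := hη _ h1
  have h3 : algebraMap A B (a - algebraMap ℂ A (ξ a)) = f a - algebraMap ℂ B (ξ a) := by
    change f (a - algebraMap ℂ A (ξ a)) = _
    simp
  rw [h3, map_sub, AlgHom.commutes, sub_eq_zero] at h2
  exact h2


def SecF {n : ℕ} (I : Ideal (MP n)) (F : MP n) : Prop :=
  ∀ a b : Fin n → ℂ, OnC I a → OnC I b → eval (a + b) F = 0

section
variable {n N d : ℕ} {I : Ideal (MP n)} {F : MP n} 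

lemma onC_zero {D : Type} [CommRing D] [Algebra ℂ D] (hI : HomI I) {x : Fin n → D} (hx : OnC I x) :
    OnC I (0 : Fin n → D) := by
  have := hx.smul hI 0; simpa using this

lemma onC_pts {D : Type} [CommRing D] [Algebra ℂ D] [IsDomain D] [Algebra.FiniteType ℂ D] {x : Fin n → D}
    (h : ∀ ξ : D →ₐ[ℂ] ℂ, OnC I (fun i => ξ (x i))) : OnC I x := by
  intro f hf
  apply eq_zero_of_pts
  intro ξ
  have := h ξ f hf
  rw [comp_aeval_apply]; exact this

lemma F_add {D : Type} [CommRing D] [Algebra ℂ D] [IsDomain D] [Algebra.FiniteType ℂ D] 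
    (hS : SecF I F) {x y : Fin n → D} (hx : OnC I x) (hy : OnC I y) : aeval (x + y) F = 0 := by
  apply eq_zero_of_pts
  intro ξ
  rw [comp_aeval_apply]
  have := hS _ _ (hx.map ξ) (hy.map ξ)
  rw [← coe_aeval_eq_eval] at this
  have e : (fun i => ξ ((x + y) i)) = (fun i => ξ (x i)) + (fun i => ξ (y i)) := by funext i; simp
  rw [e]; exact this

lemma F_sub {D : Type} [CommRing D] [Algebra ℂ D] [IsDomain D] [Algebra.FiniteType ℂ D] (hI : HomI I)
    (hS : SecF I F) {x y : Fin n → D} (hx : OnC I x) (hy : OnC I y) : aeval (x - y) F = 0 := by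
  have := F_add hS hx (hy.smul hI (-1))
  convert this using 2
  simp [sub_eq_add_neg]

lemma F_one {D : Type} [CommRing D] [Algebra ℂ D] [IsDomain D] [Algebra.FiniteType ℂ D] (hI : HomI I)
    (hS : SecF I F) {x : Fin n → D} (hx : OnC I x) : aeval x F = 0 := by
  have := F_add hS hx (onC_zero hI hx)
  simpa using this

lemma aeval_cst {D : Type} [CommRing D] [Algebra ℂ D] (o : Fin n → ℂ) (F : MP n) :
    aeval (cst D o) F = algebraMap ℂ D (eval o F) := by
  have := comp_aeval_apply (Algebra.ofId ℂ D) F (f := o)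
  rw [← coe_aeval_eq_eval]
  exact this.symm

lemma lemK {D : Type} [CommRing D] [Algebra ℂ D] [IsDomain D] [Algebra.FiniteType ℂ D] (hI : HomI I)
    (hS : SecF I F) (hF : F.IsHomogeneous d) {o : Fin n → ℂ} (hFo : eval o F ≠ 0)
    {x y : Fin n → D} (hx : OnC I x) (hy : OnC I y) {c : D} (h : x - y = c • cst D o) : c = 0 := by
  have h1 := F_sub hI hS hx hy
  have h2 : aeval (c • cst D o) F = c ^ d * aeval (cst D o) F := aeval_mul_hom hF c _
  rw [h, h2, aeval_cst] at h1
  rcases mul_eq_zero.mp h1 with h3 | h3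
  · exact eq_zero_of_pow_eq_zero h3
  · exact absurd ((map_eq_zero _).mp h3) hFo

variable {w : Fin N × Fin n → ℂ} {o : Fin n → ℂ} {S : Fin n × Fin N → ℂ} {l : Fin n → ℂ}

lemma LinData.ker (L : LinData w o S l) {D : Type} [CommRing D] [Algebra ℂ D] {x y : Fin n → D}
    (h : LD w x = LD w y) : x - y = (lam l x - lam l y) • cst D o := by
  have h1 := L.dec (x - y)
  rw [LD_sub, h, sub_self, lam_sub] at h1
  rw [h1]
  have : LD S (0 : Fin N → D) = 0 := by funext i; simp [LD]
  rw [this, zero_add]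

lemma L_inj (L : LinData w o S l) {D : Type} [CommRing D] [Algebra ℂ D] [IsDomain D] [Algebra.FiniteType ℂ D] (hI : HomI I)
    (hS : SecF I F) (hF : F.IsHomogeneous d) (hFo : eval o F ≠ 0)
    {x y : Fin n → D} (hx : OnC I x) (hy : OnC I y) (h : LD w x = LD w y) : x = y := by
  have h1 := L.ker h
  rw [lemK hI hS hF hFo hx hy h1, zero_smul, sub_eq_zero] at h1
  exact h1

def Lst (w : Fin N × Fin n → ℂ) : MP N →ₐ[ℂ] MP n := aeval (LD w (fun i => (X i : MP n)))

lemma aeval_Lst (w : Fin N × Fin n → ℂ) {D : Type} [CommRing D] [Algebra ℂ D] (x : Fin n → D) (f : MP N) :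
    aeval x (Lst w f) = aeval (LD w x) f := by
  rw [Lst, comp_aeval_apply]
  congr 2; funext i; rw [LD_map]; simp

lemma eval_Lst (w : Fin N × Fin n → ℂ) (x : Fin n → ℂ) (f : MP N) :
    eval x (Lst w f) = eval (LD w x) f := by
  have := aeval_Lst w x f
  simpa [coe_aeval_eq_eval] using this

lemma onC_comap {D : Type} [CommRing D] [Algebra ℂ D] {x : Fin n → D} (hx : OnC I x) :
    OnC (I.comap (Lst w)) (LD w x) := fun f hf => by
  rw [← aeval_Lst]; exact hx _ hf

/-- points of the projected cone lift -/
lemma lift_proj (L : LinData w o S l) (hF : F.IsHomogeneous d) (hFo : eval o F ≠ 0) (hFI : F ∈ I)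
    {v : Fin N → ℂ} (hv : OnC (I.comap (Lst w)) v) : ∃ x, OnC I x ∧ LD w x = v := by
  let f : MP N →ₐ[ℂ] MP n ⧸ I := aeval (LD w (xq I))
  have hf : ∀ p, f p = Ideal.Quotient.mk I (Lst w p) := fun p => by
    rw [← aeval_xq, aeval_Lst]
  have hi : f.toRingHom.IsIntegral := by
    intro a
    obtain ⟨p, rfl⟩ := Ideal.Quotient.mk_surjective a
    rw [← aeval_xq]
    have hx := x_integral L hF hFo (x := xq I) (onC_xq I F hFI)
    induction p using MvPolynomial.induction_on with
    | C c => 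
      have := f.toRingHom.isIntegralElem_map (x := C c)
      have e : f.toRingHom (C c) = aeval (xq I) (C c) := by
        change f (algebraMap ℂ _ c) = aeval (xq I) (algebraMap ℂ _ c)
        rw [AlgHom.commutes, AlgHom.commutes]
      rwa [e] at this
    | add p q h1 h2 => rw [map_add]; exact h1.add _ h2
    | mul_X p i h1 => rw [map_mul, aeval_X]; exact h1.mul _ (hx i)
  obtain ⟨η, hη⟩ := lift_pt f hi (aeval v) (fun p hp => hv p (by
    rw [hf, Ideal.Quotient.eq_zero_iff_mem] at hp; exact hp))
  refine ⟨fun i => η (xq I i), (onC_xq I).map η, ?_⟩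
  funext i
  rw [← LD_map]
  have := hη (X i)
  simpa [f] using this
end

lemma rep_mk {n : ℕ} {v : Fin n → ℂ} (hv : v ≠ 0) : ∃ c : ℂ, c ≠ 0 ∧ (Projectivization.mk ℂ v hv).rep = c • v := by
  obtain ⟨c', hc', e⟩ := (mk_eq_iff hv _).mp rfl
  refine ⟨c'⁻¹, inv_ne_zero hc', ?_⟩
  generalize (Projectivization.mk ℂ v hv).rep = y at *
  rw [e, smul_smul, inv_mul_cancel₀ hc', one_smul]

section
variable {r d : ℕ} {F : MP (r+2)} {w : Fin (r+1) × Fin (r+2) → ℂ}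
   {o : Fin (r+2) → ℂ} {S : Fin (r+2) × Fin (r+1) → ℂ} {l : Fin (r+2) → ℂ}

lemma idealOf_proj {W : Set (Pr (r+1))} (hne : ∀ x ∈ W, matLin w x.rep ≠ 0) :
    idealOf (projImage w W) = (idealOf W).comap (Lst w) := by
  ext f
  rw [Ideal.mem_comap, mem_idealOf, mem_idealOf]
  constructor
  · intro h x hx v hv hvx
    obtain ⟨c, hc, rfl⟩ := (mk_eq_iff hv x).mp hvx
    rw [eval_Lst, LD_eq]
    have h1 : matLin w (c • x.rep) ≠ 0 := by rw [map_smul]; exact smul_ne_zero hc (hne x hx)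
    refine h (Projectivization.mk ℂ _ h1) ?_ _ h1 rfl
    obtain ⟨c', hc', e⟩ := rep_mk h1
    refine ⟨x, hx, c' * c, mul_ne_zero hc' hc, ?_⟩
    rw [e, mul_smul, map_smul]
  · rintro h z ⟨x, hx, c, hc, e⟩ v hv hvz
    obtain ⟨c', hc', rfl⟩ := (mk_eq_iff hv z).mp hvz
    have h1 := h x hx ((c' * c) • x.rep) (smul_ne_zero (mul_ne_zero hc' hc) x.rep_nonzero) ((mk_eq_iff _ _).mpr ⟨_, mul_ne_zero hc' hc, rfl⟩)
    rw [eval_Lst, LD_eq, map_smul, mul_smul] at h1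
    rw [e]; exact h1

lemma mem_proj_of {W : Set (Pr (r+1))} (hW : IsClosed W) {v : Fin (r+2) → ℂ} (hv : OnC (idealOf W) v)
    {z : Pr r} {c : ℂ} (hc : c ≠ 0) (h : z.rep = c • LD w v) : z ∈ projImage w W := by
  have hv0 : v ≠ 0 := by
    rintro rfl
    rw [LD_eq, map_zero, smul_zero] at h
    exact z.rep_nonzero h
  obtain ⟨x, hx, c', hc', e⟩ := onC_lift hW hv0 hv
  refine ⟨x, hx, c * c', mul_ne_zero hc hc', ?_⟩
  rw [h, e, LD_eq, map_smul, smul_smul]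

lemma proj_closed (L : LinData w o S l) (hF : F.IsHomogeneous d) (hFo : eval o F ≠ 0) 
    {W : Set (Pr (r+1))} (hW : IsClosed W) (hFI : F ∈ idealOf W) (hne : ∀ x ∈ W, matLin w x.rep ≠ 0) :
    IsClosed (projImage w W) := by
  have : projImage w W = ⋂ f ∈ idealOf (projImage w W), pZero f := by
    apply Set.Subset.antisymm
    · exact Set.subset_iInter₂ fun f hf => hf
    · intro z hz
      rw [Set.mem_iInter₂] at hz
      have h1 : OnC (idealOf (projImage w W)) z.rep := onC_eval.mpr fun f hf => hz f hf _ z.rep_nonzero z.mk_rep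
      rw [idealOf_proj hne] at h1
      obtain ⟨x, hx, e⟩ := lift_proj L hF hFo hFI h1
      exact mem_proj_of hW hx one_ne_zero (by rw [e, one_smul])
  rw [this]
  exact isClosed_biInter fun f _ => pZero_closed f

lemma F_mem {W Z : Set (Pr (r+1))} (hWZ : W ⊆ Z) (hF : F.IsHomogeneous d) (hS : SecF (idealOf Z) F) : F ∈ idealOf W := by
  intro x hx
  rw [mem_pZero_hom hF]
  have := hS x.rep 0 (onC_rep (hWZ hx)) (onC_zero (homI_idealOf Z) (onC_rep (hWZ hx)))
  simpa using this

lemma proj_pdim (L : LinData w o S l) (hF : F.IsHomogeneous d) (hFo : eval o F ≠ 0) 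
    {Z : Set (Pr (r+1))} (hZ : IsClosed Z) (hS : SecF (idealOf Z) F) (hne : ∀ x ∈ Z, matLin w x.rep ≠ 0) :
    pdim (projImage w Z) = pdim Z := by
  have hmem : ∀ x : Z, Projectivization.mk ℂ _ (hne x.1 x.2) ∈ projImage w Z := by
    intro x
    obtain ⟨c', hc', e⟩ := rep_mk (hne x.1 x.2)
    exact ⟨x, x.2, c', hc', e⟩
  let g : Z → projImage w Z := fun x => ⟨_, hmem x⟩
  have hg : IsHomeomorph g := by
    rw [isHomeomorph_iff_continuous_isClosedMap_bijective]
    refine ⟨?_, ?_, ?_, ?_⟩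
    · apply Continuous.subtype_mk
      rw [continuous_generateFrom_iff]
      rintro _ ⟨f, rfl⟩
      have : (fun x : Z => Projectivization.mk ℂ _ (hne x.1 x.2)) ⁻¹' (pZero f)ᶜ = (Subtype.val ⁻¹' (pZero (Lst w f)))ᶜ := by
        rw [Set.preimage_compl]
        congr 1
        ext x
        simp only [Set.mem_preimage]
        constructor
        · intro h v hv hvx
          obtain ⟨c, hc, rfl⟩ := (mk_eq_iff hv _).mp hvx
          rw [eval_Lst, LD_eq, map_smul]
          refine h _ (smul_ne_zero hc (hne x.1 x.2)) ?_
          rw [Projectivization.mk_eq_mk_iff']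
          exact ⟨c, rfl⟩
        · intro h v hv hvx
          rw [Projectivization.mk_eq_mk_iff'] at hvx
          obtain ⟨c, hc⟩ := hvx
          have hc0 : c ≠ 0 := by rintro rfl; rw [zero_smul] at hc; exact hv hc.symm
          have := h (c • x.1.rep) (smul_ne_zero hc0 x.1.rep_nonzero) ((mk_eq_iff _ _).mpr ⟨c, hc0, rfl⟩)
          rw [eval_Lst, LD_eq, map_smul, hc] at this
          exact this
      rw [this]
      exact ((pZero_closed _).preimage continuous_subtype_val).isOpen_compl
    · intro W hW
      have h1 : IsClosed (Subtype.val '' W : Set (Pr (r+1))) := hZ.isClosedMap_subtype_val _ hW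
      have h2 : (Subtype.val '' W : Set (Pr (r+1))) ⊆ Z := by rintro _ ⟨x, _, rfl⟩; exact x.2
      have h3 := proj_closed L hF hFo h1 (F_mem h2 hF hS) (fun x hx => hne x (h2 hx))
      have h4 : g '' W = Subtype.val ⁻¹' (projImage w (Subtype.val '' W)) := by
        ext z
        constructor
        · rintro ⟨x, hx, rfl⟩
          obtain ⟨c', hc', e⟩ := rep_mk (hne x.1 x.2)
          exact ⟨x, ⟨x, hx, rfl⟩, c', hc', e⟩
        · rintro ⟨_, ⟨x, hx, rfl⟩, c, hc, e⟩
          refine ⟨x, hx, ?_⟩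
          apply Subtype.ext
          change Projectivization.mk ℂ _ (hne x.1 x.2) = z.1
          rw [mk_eq_iff]
          exact ⟨c⁻¹, inv_ne_zero hc, by rw [e, smul_smul, inv_mul_cancel₀ hc, one_smul]⟩
      rw [h4]
      exact h3.preimage continuous_subtype_val
    · intro x y hxy
      have h1 : Projectivization.mk ℂ _ (hne x.1 x.2) = Projectivization.mk ℂ _ (hne y.1 y.2) := congrArg Subtype.val hxy
      rw [Projectivization.mk_eq_mk_iff'] at h1
      obtain ⟨c, hc⟩ := h1
      have h2 : LD w (c • y.1.rep) = LD w x.1.rep := by rw [LD_eq, LD_eq, map_smul, hc]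
      have h3 := L_inj L (homI_idealOf Z) hS hF hFo ((onC_rep y.2).smul (homI_idealOf Z) c) (onC_rep x.2) h2
      apply Subtype.ext
      rw [← x.1.mk_rep]
      rw [mk_eq_iff]
      refine ⟨c, ?_, h3.symm⟩
      rintro rfl
      rw [zero_smul] at h3
      exact x.1.rep_nonzero h3.symm
    · rintro ⟨z, x, hx, c, hc, e⟩
      refine ⟨⟨x, hx⟩, ?_⟩
      apply Subtype.ext
      change Projectivization.mk ℂ _ (hne x hx) = z
      rw [mk_eq_iff]
      exact ⟨c⁻¹, inv_ne_zero hc, by rw [e, smul_smul, inv_mul_cancel₀ hc, one_smul]⟩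
  exact hg.topologicalKrullDim_eq.symm

lemma proj_nondeg {Z : Set (Pr (r+1))} (hs : Function.Surjective (matLin w)) (hnd : NondegenerateSet Z)
    (hne : ∀ x ∈ Z, matLin w x.rep ≠ 0) : NondegenerateSet (projImage w Z) := by
  rintro H ⟨φ, hφ, rfl⟩ hsub
  refine hnd _ ⟨φ ∘ₗ matLin w, ?_, rfl⟩ ?_
  · intro h
    apply hφ
    ext1 i
    ext
    obtain ⟨u, hu⟩ := hs (LinearMap.single ℂ (fun _ => ℂ) i 1)
    have := DFunLike.congr_fun h u
    simp only [LinearMap.comp_apply, hu] at this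
    simpa using this
  · intro x hx
    obtain ⟨c', hc', e⟩ := rep_mk (hne x hx)
    have h1 := hsub (a := Projectivization.mk ℂ _ (hne x hx)) ⟨x, hx, c', hc', e⟩
    change φ _ = 0 at h1
    change φ (matLin w x.rep) = 0
    rw [e, map_smul, smul_eq_mul] at h1
    exact (mul_eq_zero.mp h1).resolve_left hc'
end


lemma dualJ {A : Type} [CommRing A] [Algebra ℂ A] (η : A →ₐ[ℂ] ℂ) (U : Ideal A) (hU : U ≤ RingHom.ker η)
    (hm : ∀ a b, η a = 0 → η b = 0 → a * b ∈ U) {a : A} (ha : η a = 0) (haU : a ∉ U) :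
    ∃ D ∈ PDer η, (∀ u ∈ U, D u = 0) ∧ D a ≠ 0 := by
  obtain ⟨f, h1, h2⟩ := Submodule.exists_le_ker_of_notMem (p := U.restrictScalars ℂ) (v := a) haU
  have hf : ∀ u ∈ U, f u = 0 := fun u hu => h2 hu
  refine ⟨f - f 1 • η.toLinearMap, ?_, ?_, ?_⟩
  · intro x y
    have h3 := hf _ (hm (x - algebraMap ℂ A (η x)) (y - algebraMap ℂ A (η y)) (by simp) (by simp))
    have h4 : (x - algebraMap ℂ A (η x)) * (y - algebraMap ℂ A (η y)) =
      x * y - η x • y - η y • x + (η x * η y) • (1 : A) := by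
      simp only [Algebra.smul_def, map_mul]; ring
    rw [h4, map_add, map_sub, map_sub, map_smul, map_smul, map_smul] at h3
    simp only [smul_eq_mul] at h3
    simp only [LinearMap.sub_apply, LinearMap.smul_apply, AlgHom.toLinearMap_apply, map_mul, smul_eq_mul]
    linear_combination h3
  · intro u hu
    have : η u = 0 := hU hu
    simp [hf u hu, this]
  · simp [ha, h1]

lemma exists_forms {V : Type} [AddCommGroup V] [Module ℂ V] [FiniteDimensional ℂ V] (T : Submodule ℂ V) {o : V}
    (ho : o ∈ T) (ho0 : o ≠ 0) : ∃ ψ : V →ₗ[ℂ] (Fin (Module.finrank ℂ T - 1) → ℂ), ∀ u ∈ T, ψ u = 0 → ∃ c : ℂ, u = c • o := by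
  let o' : T := ⟨o, ho⟩
  have ho' : o' ≠ 0 := fun h => ho0 (congrArg Subtype.val h)
  have h1 : Module.finrank ℂ (T ⧸ Submodule.span ℂ {o'}) = Module.finrank ℂ (Fin (Module.finrank ℂ T - 1) → ℂ) := by
    have := Submodule.finrank_quotient_add_finrank (Submodule.span ℂ {o'})
    rw [finrank_span_singleton ho'] at this
    simp; omega
  let e := LinearEquiv.ofFinrankEq _ _ h1
  obtain ⟨ψ, hψ⟩ := LinearMap.exists_extend (e.toLinearMap ∘ₗ Submodule.mkQ _)
  refine ⟨ψ, fun u hu h => ?_⟩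
  have h2 := DFunLike.congr_fun hψ ⟨u, hu⟩
  simp only [LinearMap.comp_apply, Submodule.subtype_apply, h, LinearEquiv.coe_coe] at h2
  have h3 := (LinearEquiv.map_eq_zero_iff e).mp h2.symm
  rw [Submodule.mkQ_apply, Submodule.Quotient.mk_eq_zero, Submodule.mem_span_singleton] at h3
  obtain ⟨c, hc⟩ := h3
  exact ⟨c, (congrArg Subtype.val hc).symm⟩

section
variable {n N d : ℕ} {I : Ideal (MP n)} {F : MP n} 
variable {w : Fin N × Fin n → ℂ} {o : Fin n → ℂ} {S : Fin n × Fin N → ℂ} {l : Fin n → ℂ}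

lemma onC_cst {D : Type} [CommRing D] [Algebra ℂ D] {v : Fin n → ℂ} (hv : OnC I v) : OnC I (cst D v) :=
  hv.map (Algebra.ofId ℂ D)

lemma o_not_tan [I.IsPrime] (hI : HomI I) (hS : SecF I F) (hF : F.IsHomogeneous d) (hFo : eval o F ≠ 0)
    (hlo : lam l o = 1) {v : Fin n → ℂ} (hv : OnC I v) (hfr : Module.finrank ℂ (TanI I v) = td (MP n ⧸ I)) :
    o ∉ TanI I v := by
  intro ho
  have ho0 : o ≠ 0 := by rintro rfl; simp [lam] at hlo
  obtain ⟨ψ, hψ⟩ := exists_forms _ ho ho0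
  have hpos : 0 < Module.finrank ℂ (TanI I v) := 
    Module.finrank_pos_iff_exists_ne_zero.mpr ⟨⟨o, ho⟩, fun h => ho0 (congrArg Subtype.val h)⟩
  obtain ⟨B, _, _, _, _, q, η, hqs, hη, hqa, htd⟩ := krull' (hq hv)
    (fun i => ∑ j, ψ (Pi.single j 1) i • (xq I j - algebraMap ℂ _ (v j))) (by simp)
  have htdB : td B ≠ 0 := by simp at htd; omega
  have hDo : ∀ D ∈ PDer η, ∃ c : ℂ, ∀ j, D (q (xq I j)) = c * o j := by
    intro D hD
    have hD' := PDer.comp hD q hη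
    have h1 := pder_TanI (onC_xq I) hD'
    simp only [hq_xq] at h1
    obtain ⟨c, hc⟩ := hψ _ h1 (by
      funext i
      conv_lhs => rw [pi_eq_sum_univ' (fun j => (D ∘ₗ q.toLinearMap) (xq I j))]
      have h2 := congrArg D (hqa i)
      simp only [map_sum, map_smul, map_sub, AlgHom.commutes, PDer.const hD, sub_zero, map_zero] at h2
      simp only [map_sum, map_smul, Finset.sum_apply, Pi.smul_apply, smul_eq_mul, LinearMap.comp_apply,
        AlgHom.toLinearMap_apply, Pi.zero_apply]
      rw [← h2]
      exact Finset.sum_congr rfl fun j _ => by rw [smul_eq_mul, mul_comm])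
    exact ⟨c, fun j => by have := congrFun hc j; simpa using this⟩
  have hD0 : ∀ D ∈ PDer η, (∀ j, D (q (xq I j)) = 0) → D = 0 := by
    intro D hD h
    have := pder_ext_xq (PDer.comp hD q hη) h
    ext b
    obtain ⟨a, rfl⟩ := hqs b
    exact DFunLike.congr_fun this a
  obtain ⟨D, hD, hDne⟩ : ∃ D ∈ PDer η, D ≠ 0 := by
    by_contra! h
    exact htdB (td_zero_of_pder h)
  obtain ⟨c, hc⟩ := hDo D hD
  have hc0 : c ≠ 0 := by
    rintro rfl
    exact hDne (hD0 D hD fun j => by rw [hc, zero_mul])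
  let δ : Fin n → B := fun j => q (xq I j) - algebraMap ℂ B (v j)
  have hηδ : ∀ j, η (δ j) = 0 := fun j => by simp [δ, hη]
  let t : B := lam l δ
  have hDt : ∀ E ∈ PDer η, ∀ c : ℂ, (∀ j, E (q (xq I j)) = c * o j) → E t = c := by
    intro E hE c hc
    rw [lam_map']
    have : (fun j => E (δ j)) = c • o := by
      funext j; simp [δ, PDer.const hE, hc]
    rw [this, lam_smul, hlo, mul_one]
  have hηt : η t = 0 := by
    rw [lam_map]; simp [hηδ, lam]
  have ht0 : t ≠ 0 := by
    intro h
    have := hDt D hD c hc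
    rw [h, map_zero] at this
    exact hc0 this.symm
  have hN : IsNoetherianRing B := Algebra.FiniteType.isNoetherianRing ℂ B
  obtain ⟨s, hs1, hs⟩ := Submodule.exists_sub_one_mem_and_smul_le_of_fg_of_le_sup (I := RingHom.ker η)
    (N := Ideal.span {t}) (N' := RingHom.ker η) (P := RingHom.ker η) (IsNoetherian.noetherian _) le_rfl (by
      intro a ha
      by_contra haU
      obtain ⟨E, hE, h1, h2⟩ := dualJ η (Ideal.span {t} ⊔ RingHom.ker η • RingHom.ker η)
        (sup_le (by rw [Ideal.span_singleton_le_iff_mem]; exact hηt) Submodule.smul_le_right)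
        (fun a b ha hb => Ideal.mem_sup_right (Submodule.smul_mem_smul ha hb)) ha haU
      obtain ⟨c, hc⟩ := hDo E hE
      have h3 := hDt E hE c hc
      rw [h1 t (Ideal.mem_sup_left (Ideal.mem_span_singleton_self t))] at h3
      apply h2
      rw [hD0 E hE (fun j => by rw [hc, ← h3, zero_mul])]; rfl)
  have hηs : η s = 1 := by
    have : η (s - 1) = 0 := hs1
    rw [map_sub, map_one, sub_eq_zero] at this; exact this
  have h1 : ∀ j, ∃ g, t * g = s * δ j := by
    intro j
    have : s • δ j ∈ Ideal.span {t} := hs (Submodule.smul_mem_pointwise_smul _ _ _ (hηδ j))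
    rw [Ideal.mem_span_singleton] at this
    obtain ⟨g, hg⟩ := this
    exact ⟨g, by rw [← hg]; rfl⟩
  choose g hg using h1
  have hFδ : aeval δ F = 0 := F_sub hI hS ((onC_xq I).map q) (onC_cst hv)
  have hFg : aeval g F = 0 := by
    have h2 := aeval_mul_hom hF s δ
    simp only [← hg] at h2
    rw [aeval_mul_hom hF, hFδ, mul_zero] at h2
    exact (mul_eq_zero.mp h2).resolve_left (pow_ne_zero _ ht0)
  have hgo : (fun j => η (g j)) = o := by
    funext j
    have h2 := congrArg D (hg j)
    rw [PDer.mul hD, PDer.mul hD, hηt, hηδ, hηs, hDt D hD c hc] at h2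
    have h3 : D (δ j) = c * o j := by simp [δ, PDer.const hD, hc]
    rw [h3] at h2
    apply mul_left_cancel₀ hc0
    linear_combination h2
  have h4 := congrArg η hFg
  rw [comp_aeval_apply, hgo, map_zero] at h4
  exact hFo h4

lemma mp_integral (L : LinData w o S l) (hF : F.IsHomogeneous d) (hFo : eval o F ≠ 0) (hFI : F ∈ I) :
    (aeval (LD w (xq I)) : MP N →ₐ[ℂ] MP n ⧸ I).toRingHom.IsIntegral := by
  intro a
  obtain ⟨p, rfl⟩ := Ideal.Quotient.mk_surjective a
  rw [← aeval_xq]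
  have hx := x_integral L hF hFo (x := xq I) (onC_xq I F hFI)
  induction p using MvPolynomial.induction_on with
  | C c => 
    have := (aeval (LD w (xq I)) : MP N →ₐ[ℂ] MP n ⧸ I).toRingHom.isIntegralElem_map (x := C c)
    have e : (aeval (LD w (xq I)) : MP N →ₐ[ℂ] MP n ⧸ I).toRingHom (C c) = aeval (xq I) (C c) := by
      change (aeval (LD w (xq I)) : MP N →ₐ[ℂ] MP n ⧸ I) (algebraMap ℂ _ c) = aeval (xq I) (algebraMap ℂ _ c)
      rw [AlgHom.commutes, AlgHom.commutes]
    rwa [e] at this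
  | add p q h1 h2 => rw [map_add]; exact h1.add _ h2
  | mul_X p i h1 => rw [map_mul, aeval_X]; exact h1.mul _ (hx i)

lemma tan_pder {u v : Fin n → ℂ} (hv : OnC I v) (hu : u ∈ TanI I v) :
    ∃ D ∈ PDer (hq hv), ∀ i, D (xq I i) = u i := by
  have h := (mem_TanI_iff hv).mp hu
  refine ⟨(TrivSqZeroExt.sndHom ℂ ℂ : DualNumber ℂ →ₗ[ℂ] ℂ) ∘ₗ (hq h).toLinearMap, ?_, ?_⟩
  · have h2 : (TrivSqZeroExt.fstHom ℂ ℂ ℂ).comp (hq h) = hq hv := by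
      apply hom_ext_xq
      intro i
      simp [dpt]
    intro a b
    have ha : (hq h a).fst = hq hv a := DFunLike.congr_fun h2 a
    have hb : (hq h b).fst = hq hv b := DFunLike.congr_fun h2 b
    simp [ha, hb]
    ring
  · intro i
    simp [dpt]

lemma proj_tan [I.IsPrime] (hI : HomI I) (L : LinData w o S l) (hS : SecF I F) (hF : F.IsHomogeneous d) (hFo : eval o F ≠ 0)
    (hFI : F ∈ I) {v : Fin n → ℂ} (hv : OnC I v) (hfr : Module.finrank ℂ (TanI I v) = td (MP n ⧸ I)) 
    {u' : Fin N → ℂ} (hu' : u' ∈ TanI (I.comap (Lst w)) (LD w v)) : ∃ u ∈ TanI I v, LD w u = u' := by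
  have hoT := o_not_tan hI hS hF hFo L.lo hv hfr
  set I' := I.comap (Lst w) with hI'
  let f : MP N ⧸ I' →ₐ[ℂ] MP n ⧸ I := hq (onC_comap (onC_xq I))
  have hfx : ∀ i, f (xq I' i) = LD w (xq I) i := fun i => hq_xq _ i
  have hfmk : ∀ p, f (Ideal.Quotient.mk I' p) = Ideal.Quotient.mk I (Lst w p) := by
    intro p; rw [← aeval_xq, ← aeval_xq, aeval_Lst, comp_aeval_apply]; simp only [hfx]
  have hfinj : Function.Injective f := by
    rw [injective_iff_map_eq_zero]
    intro a ha
    obtain ⟨p, rfl⟩ := Ideal.Quotient.mk_surjective a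
    rw [hfmk, Ideal.Quotient.eq_zero_iff_mem] at ha
    rw [Ideal.Quotient.eq_zero_iff_mem]; exact ha
  have hfint : f.toRingHom.IsIntegral := by
    have h1 := mp_integral L hF hFo hFI
    have h2 : (aeval (LD w (xq I)) : MP N →ₐ[ℂ] MP n ⧸ I).toRingHom = f.toRingHom.comp (Ideal.Quotient.mk I') := by
      apply RingHom.ext
      intro p
      change aeval (LD w (xq I)) p = f (Ideal.Quotient.mk I' p)
      rw [hfmk, ← aeval_xq, aeval_Lst]
    rw [h2] at h1
    exact RingHom.IsIntegral.tower_top _ _ h1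
  let y := LD w v
  have hy : OnC I' y := onC_comap hv
  let ξ := hq hv
  let ξ' := hq hy
  have hξ : ∀ a, ξ (f a) = ξ' a := by
    have : ξ.comp f = ξ' := by
      apply hom_ext_xq
      intro i
      simp only [AlgHom.comp_apply, hfx, ξ, ξ', hq_xq]
      rw [LD_map]; simp [y]
    exact fun a => DFunLike.congr_fun this a
  obtain ⟨D', hD', hD'x⟩ := tan_pder hy hu'
  algebraize [f.toRingHom]
  have hsc : IsScalarTower ℂ (MP N ⧸ I') (MP n ⧸ I) := IsScalarTower.of_algebraMap_eq fun c => (f.commutes c).symm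
  have hint : Algebra.IsIntegral (MP N ⧸ I') (MP n ⧸ I) := ⟨hfint⟩
  have hft : Algebra.FiniteType (MP N ⧸ I') (MP n ⧸ I) := Algebra.FiniteType.of_restrictScalars_finiteType ℂ _ _
  have hfin : Module.Finite (MP N ⧸ I') (MP n ⧸ I) := Algebra.IsIntegral.finite
  have hal : ∀ a, algebraMap (MP N ⧸ I') (MP n ⧸ I) a = f a := fun _ => rfl
  set a0 : Ideal (MP n ⧸ I) := (RingHom.ker ξ').map f with ha0
  have ha0le : a0 ≤ RingHom.ker ξ := by
    rw [ha0, Ideal.map_le_iff_le_comap]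
    intro a ha
    rw [Ideal.mem_comap, RingHom.mem_ker, hξ]; exact ha
  -- tangent computation
  obtain ⟨s, hs1, hs⟩ := Submodule.exists_sub_one_mem_and_smul_le_of_fg_of_le_sup (I := RingHom.ker ξ)
    (N := a0) (N' := RingHom.ker ξ) (P := RingHom.ker ξ) (IsNoetherian.noetherian _) le_rfl (by
      intro a ha
      by_contra haU
      obtain ⟨E, hE, h1, h2⟩ := dualJ ξ (a0 ⊔ RingHom.ker ξ • RingHom.ker ξ)
        (sup_le ha0le Submodule.smul_le_right)
        (fun a b ha hb => Ideal.mem_sup_right (Submodule.smul_mem_smul ha hb)) ha haU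
      have h3 := pder_TanI (onC_xq I) hE
      have e1 : (fun i => ξ (xq I i)) = v := by funext i; simp [ξ]
      rw [e1] at h3
      set u := fun i => E (xq I i) with hu
      have h4 : LD w u = 0 := by
        funext i
        have h5 := h1 (f (xq I' i - algebraMap ℂ _ (y i))) (Ideal.mem_sup_left (Ideal.mem_map_of_mem _ (by
          rw [RingHom.mem_ker]; simp [ξ'])))
        rw [map_sub, map_sub, AlgHom.commutes, PDer.const hE, sub_zero, hfx, LD_map'] at h5
        exact h5
      have h6 := L.ker (x := u) (y := 0) (by rw [h4]; funext i; simp [LD])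
      have h8 : u = lam l u • o := by
        have : lam l (0 : Fin n → ℂ) = 0 := by simp [lam]
        rw [sub_zero, this, sub_zero] at h6; exact h6
      have h7 : lam l u ≠ 0 := by
        intro h
        rw [h, zero_smul] at h8
        apply h2
        rw [pder_ext_xq hE (fun i => congrFun h8 i)]; rfl
      apply hoT
      rw [h8] at h3
      exact (Submodule.smul_mem_iff _ h7).mp h3)
  have hξs : ξ s = 1 := by
    have : ξ (s - 1) = 0 := hs1
    rw [map_sub, map_one, sub_eq_zero] at this; exact this
  have huniq : Ideal.span {s} ⊔ a0 = ⊤ := by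
    by_contra h
    obtain ⟨ζ, hζ⟩ := exists_pt _ h
    have h1 : ∀ i, ζ (LD w (xq I) i) = y i := by
      intro i
      have := hζ (f (xq I' i - algebraMap ℂ _ (y i))) (Ideal.mem_sup_right (Ideal.mem_map_of_mem _ (by
          rw [RingHom.mem_ker]; simp [ξ'])))
      rw [map_sub, map_sub, AlgHom.commutes, AlgHom.commutes, sub_eq_zero, hfx] at this
      exact this
    have h2 : (fun i => ζ (xq I i)) = v := by
      refine L_inj L hI hS hF hFo ((onC_xq I).map ζ) hv ?_
      funext i
      rw [← LD_map]; exact h1 i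
    have h3 : ζ = ξ := by
      apply hom_ext_xq
      intro i
      have := congrFun h2 i
      simp [ξ, this]
    have h4 := hζ s (Ideal.mem_sup_left (Ideal.mem_span_singleton_self s))
    rw [h3, hξs] at h4
    exact one_ne_zero h4
  have hma : RingHom.ker ξ ≤ a0 := by
    intro a ha
    have h1 : (1 : MP n ⧸ I) ∈ Ideal.span {s} ⊔ a0 := by rw [huniq]; trivial
    obtain ⟨b, hb, c, hc, hbc⟩ := Submodule.mem_sup.mp h1
    obtain ⟨b', rfl⟩ := Ideal.mem_span_singleton.mp hb
    have h2 : a = b' * (s * a) + a * c := by linear_combination -a * hbc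
    rw [h2]
    exact a0.add_mem (a0.mul_mem_left _ (hs (Submodule.smul_mem_pointwise_smul _ _ _ ha))) (a0.mul_mem_left _ hc)
  obtain ⟨t, ht1, ht⟩ := Submodule.exists_sub_one_mem_and_smul_le_of_fg_of_le_sup (R := MP N ⧸ I') (I := RingHom.ker ξ')
    (N := LinearMap.range (Algebra.linearMap (MP N ⧸ I') (MP n ⧸ I))) (N' := ⊤) (P := ⊤) hfin.fg_top le_rfl (by
      intro a _
      have h1 : a - algebraMap ℂ _ (ξ a) ∈ RingHom.ker ξ := by simp [RingHom.mem_ker]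
      have h2 := hma h1
      have h3 : a - algebraMap ℂ _ (ξ a) ∈ RingHom.ker ξ' • (⊤ : Submodule (MP N ⧸ I') (MP n ⧸ I)) := by
        rw [Ideal.smul_top_eq_map]; exact h2
      rw [← add_sub_cancel (algebraMap ℂ (MP n ⧸ I) (ξ a)) a]
      refine Submodule.add_mem_sup ⟨algebraMap ℂ _ (ξ a), ?_⟩ h3
      change f (algebraMap ℂ _ (ξ a)) = _
      rw [AlgHom.commutes])
  have hξt : ξ' t = 1 := by
    have : ξ' (t - 1) = 0 := ht1
    rw [map_sub, map_one, sub_eq_zero] at this; exact this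
  have h1 : ∀ a, ∃ b, f b = f t * a := by
    intro a
    obtain ⟨b, hb⟩ := ht (Submodule.smul_mem_pointwise_smul a t ⊤ trivial)
    refine ⟨b, ?_⟩
    change f b = t • a at hb
    rw [hb, Algebra.smul_def]; rfl
  choose g hg using h1
  have hξg : ∀ a, ξ' (g a) = ξ a := fun a => by
    rw [← hξ, hg, map_mul, hξ, hξt, one_mul]
  let G : MP n ⧸ I →ₗ[ℂ] MP N ⧸ I' :=
    { toFun := g
      map_add' := fun a b => hfinj (by rw [hg, map_add, hg, hg]; ring)
      map_smul' := fun c a => hfinj (by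
        rw [hg, RingHom.id_apply, map_smul, hg]; exact mul_smul_comm _ _ _) }
  have hG : ∀ a, G a = g a := fun _ => rfl
  let D : MP n ⧸ I →ₗ[ℂ] ℂ := D' ∘ₗ G - D' t • ξ.toLinearMap
  have hDd : ∀ a, D a = D' (g a) - D' t * ξ a := fun _ => rfl
  have hD : D ∈ PDer ξ := by
    intro a b
    have h1 : t * g (a * b) = g a * g b := hfinj (by simp only [map_mul, hg]; ring)
    have h2 := congrArg D' h1
    rw [PDer.mul hD', PDer.mul hD'] at h2
    change ξ' t * _ + ξ' (g (a * b)) * _ = ξ' (g a) * _ + ξ' (g b) * _ at h2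
    rw [hξg, hξg, hξg, hξt, map_mul] at h2
    simp only [hDd, map_mul]
    linear_combination h2
  refine ⟨fun i => D (xq I i), ?_, ?_⟩
  · have := pder_TanI (onC_xq I) hD
    have e1 : (fun i => ξ (xq I i)) = v := by funext i; simp [ξ]
    rwa [e1] at this
  · funext i
    rw [← LD_map' w D, ← hfx, hDd, hξ, ← hD'x]
    have h1 : g (f (xq I' i)) = t * xq I' i := hfinj (by rw [hg, map_mul])
    rw [h1, PDer.mul hD']
    change ξ' t * _ + _ - _ * ξ' _ = _
    rw [hξt]
    change _ + ξ' _ * _ - _ = _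
    ring
end
lemma smooth_data {n m : ℕ} {Z : Set (PrV n)} (hcl : IsClosed Z) [(idealOf Z).IsPrime] (hsm : IsSmoothSet Z)
    (hdim : pdim Z = ((m : ℕ∞) : WithBot ℕ∞)) {v : Fin n → ℂ} (hv0 : v ≠ 0) (hv : OnC (idealOf Z) v) :
    Module.finrank ℂ (TanI (idealOf Z) v) = m + 1 ∧ td (MP n ⧸ idealOf Z) = m + 1 := by
  obtain ⟨x, hx, c, hc, rfl⟩ := onC_lift hcl hv0 hv
  rw [TanI_smul (homI_idealOf Z) (onC_rep hx) hc]
  have h1 := hsm x hx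
  rw [IsSmoothPt, hdim, affTangent_eq] at h1
  have h2 : Module.finrank ℂ (TanI (idealOf Z) x.rep) = m + 1 := by exact_mod_cast h1
  have h3 := td_ge hcl hdim
  have h4 := td_le_TanI (onC_rep hx)
  omega

lemma proj_smooth {r d m : ℕ} {F : MP (r+2)} {w : Fin (r+1) × Fin (r+2) → ℂ}
    {o : Fin (r+2) → ℂ} {S : Fin (r+2) × Fin (r+1) → ℂ} {l : Fin (r+2) → ℂ}
    (L : LinData w o S l) (hF : F.IsHomogeneous d) (hFo : eval o F ≠ 0) 
    {Z : Set (Pr (r+1))} (hZ : IsClosed Z) (hirr : IsIrreducible Z) (hsm : IsSmoothSet Z)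
    (hdim : pdim Z = ((m : ℕ∞) : WithBot ℕ∞)) (hS : SecF (idealOf Z) F) (hne : ∀ x ∈ Z, matLin w x.rep ≠ 0) :
    IsSmoothSet (projImage w Z) := by
  intro z hz
  have hp := idealOf_prime hirr
  have hdY := proj_pdim L hF hFo hZ hS hne
  have hcY := proj_closed L hF hFo hZ (F_mem subset_rfl hF hS) hne
  rw [IsSmoothPt, hdY, hdim, affTangent_eq]
  have hI' := idealOf_proj hne
  have hpY : (idealOf (projImage w Z)).IsPrime := by rw [hI']; exact Ideal.comap_isPrime _ _
  have h1 := td_ge hcY (hdY.trans hdim)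
  have h2 := td_le_TanI (onC_rep hz)
  obtain ⟨x, hx, c, hc, e⟩ := hz
  have hv : OnC (idealOf Z) (c • x.rep) := (onC_rep hx).smul (homI_idealOf Z) c
  have e' : z.rep = LD w (c • x.rep) := by rw [e, LD_eq, map_smul]
  obtain ⟨h3, h4⟩ := smooth_data hZ hsm hdim (smul_ne_zero hc x.rep_nonzero) hv
  have h5 : TanI (idealOf (projImage w Z)) z.rep ≤ (TanI (idealOf Z) (c • x.rep)).map (matLin w) := by
    intro u' hu'
    rw [e', hI'] at hu'
    obtain ⟨u, hu, e⟩ := proj_tan (homI_idealOf Z) L hS hF hFo (F_mem subset_rfl hF hS) hv (h3.trans h4.symm) hu'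
    exact ⟨u, hu, by rw [← LD_eq, e]⟩
  have h6 := (Submodule.finrank_mono h5).trans (Submodule.finrank_map_le _ _)
  have h7 : Module.finrank ℂ (TanI (idealOf (projImage w Z)) z.rep) = m + 1 :=
    le_antisymm (h6.trans h3.le) (h1.trans h2)
  rw [h7]; rfl

section
open TensorProduct

lemma subalg_xq {n : ℕ} {I : Ideal (MP n)} (U : Subalgebra ℂ (MP n ⧸ I)) (h : ∀ i, xq I i ∈ U) : U = ⊤ := by
  rw [eq_top_iff]
  rintro a -
  obtain ⟨p, rfl⟩ := Ideal.Quotient.mk_surjective a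
  rw [← aeval_xq]
  induction p using MvPolynomial.induction_on with
  | C c => rw [← algebraMap_eq, AlgHom.commutes]; exact U.algebraMap_mem c
  | add p q h1 h2 => rw [map_add]; exact U.add_mem h1 h2
  | mul_X p i h1 => rw [map_mul, aeval_X]; exact U.mul_mem h1 (h i)

lemma subalg_tensor {A B : Type} [CommRing A] [Algebra ℂ A] [CommRing B] [Algebra ℂ B] (U : Subalgebra ℂ (A ⊗[ℂ] B))
    (hA : ∀ a, a ⊗ₜ 1 ∈ U) (hB : ∀ b, 1 ⊗ₜ b ∈ U) : U = ⊤ := by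
  rw [eq_top_iff]
  rintro a -
  induction a using TensorProduct.induction_on with
  | zero => exact U.zero_mem
  | tmul a b => 
    have := U.mul_mem (hA a) (hB b)
    simpa using this
  | add x y hx hy => exact U.add_mem hx hy

lemma prod_alg (A B : Type) [CommRing A] [Algebra ℂ A] [CommRing B] [Algebra ℂ B] [IsDomain A] [IsDomain B]
    [Algebra.FiniteType ℂ A] [Algebra.FiniteType ℂ B] :
    ∃ (T : Type) (_ : CommRing T) (_ : IsDomain T) (_ : Algebra ℂ T) (_ : Algebra.FiniteType ℂ T)
      (i : A →ₐ[ℂ] T) (j : B →ₐ[ℂ] T),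
      (∀ (D : Type) [CommRing D] [Algebra ℂ D] (f : A →ₐ[ℂ] D) (g : B →ₐ[ℂ] D),
        ∃ h : T →ₐ[ℂ] D, (∀ a, h (i a) = f a) ∧ (∀ b, h (j b) = g b)) ∧
      td A + td B ≤ td T ∧
      (∀ U : Subalgebra ℂ T, (∀ a, i a ∈ U) → (∀ b, j b ∈ U) → U = ⊤) := by
  refine ⟨A ⊗[ℂ] B, inferInstance, tensor_domain A B, inferInstance, inferInstance,
    Algebra.TensorProduct.includeLeft, Algebra.TensorProduct.includeRight, ?_, td_tensor A B,
    fun U h1 h2 => subalg_tensor U h1 h2⟩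
  intro D _ _ f g
  exact ⟨Algebra.TensorProduct.lift f g (fun _ _ => Commute.all _ _), by simp, by simp⟩

/-- subalgebra of homs: surjectivity check -/
lemma incl_xq {n : ℕ} {I : Ideal (MP n)} {B : Type} [CommRing B] [Algebra ℂ B] (g : MP n ⧸ I →ₐ[ℂ] B)
    (U : Subalgebra ℂ B) (h : ∀ i, g (xq I i) ∈ U) (a : MP n ⧸ I) : g a ∈ U := by
  have := subalg_xq (U.comap g) h
  have h1 : a ∈ U.comap g := by rw [this]; trivial
  exact h1

lemma coneify {κ B : Type} [Finite κ] [CommRing B] [IsDomain B] [Algebra ℂ B] [Algebra.FiniteType ℂ B] (z : κ → B)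
    (hz : ∀ U : Subalgebra ℂ B, (∀ k, z k ∈ U) → U = ⊤) (η : B →ₐ[ℂ] ℂ) :
    ∃ (T : Type) (_ : CommRing T) (_ : IsDomain T) (_ : Algebra ℂ T) (_ : Algebra.FiniteType ℂ T)
      (Z : κ → T) (ι : T →ₐ[ℂ] Polynomial B) (τ : T →ₐ[ℂ] B) (ξ0 : T →ₐ[ℂ] ℂ), Function.Injective ι ∧
      (∀ k, ι (Z k) = Polynomial.X * Polynomial.C (z k)) ∧ (∀ k, τ (Z k) = z k) ∧ (∀ k, ξ0 (Z k) = 0) ∧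
      td B ≤ td T ∧ (∀ U : Subalgebra ℂ T, (∀ k, Z k ∈ U) → U = ⊤) := by
  let g : κ → Polynomial B := fun k => Polynomial.X * Polynomial.C (z k)
  let T := Algebra.adjoin ℂ (Set.range g)
  have hft : Algebra.FiniteType ℂ T := T.fg_iff_finiteType.mp (by
    have := Subalgebra.fg_adjoin_finset (R := ℂ) (Set.finite_range g).toFinset
    simpa [T] using this)
  have hev : ∀ c : B, ∃ e : Polynomial B →ₐ[ℂ] B, ∀ k, e (g k) = c * z k := fun c =>
    ⟨(Polynomial.aeval c : Polynomial B →ₐ[B] B).restrictScalars ℂ, fun k => by simp [g]; ring⟩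
  obtain ⟨e1, he1⟩ := hev 1
  obtain ⟨e0, he0⟩ := hev 0
  let Z : κ → T := fun k => ⟨g k, Algebra.subset_adjoin ⟨k, rfl⟩⟩
  refine ⟨T, inferInstance, inferInstance, inferInstance, hft, Z, T.val, e1.comp T.val, (η.comp e0).comp T.val,
    Subtype.val_injective, fun k => rfl, ?_, ?_, ?_, ?_⟩
  · intro k; change e1 (g k) = _; rw [he1, one_mul]
  · intro k; change η (e0 (g k)) = _; rw [he0, zero_mul, map_zero]
  · apply td_le_of_surjective (e1.comp T.val)
    rw [← AlgHom.range_eq_top]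
    apply hz
    intro k
    exact ⟨Z k, by change e1 (g k) = _; rw [he1, one_mul]⟩
  · intro U hU
    have h1 : T ≤ U.map T.val := by
      apply Algebra.adjoin_le
      rintro _ ⟨k, rfl⟩
      exact ⟨Z k, hU k, rfl⟩
    rw [eq_top_iff]
    rintro a -
    obtain ⟨b, hb, e⟩ := h1 a.2
    have : b = a := Subtype.ext e
    rwa [← this]

lemma sub_forms {N : ℕ} (P : Submodule ℂ (Fin N → ℂ)) : ∃ ψ : Fin (N - Module.finrank ℂ P) → (Fin N → ℂ),
    ∀ z, (∀ i, lam (ψ i) z = 0) ↔ z ∈ P := by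
  have h1 : Module.finrank ℂ ((Fin N → ℂ) ⧸ P) = Module.finrank ℂ (Fin (N - Module.finrank ℂ P) → ℂ) := by
    have := Submodule.finrank_quotient_add_finrank P
    simp at this ⊢; omega
  let e := LinearEquiv.ofFinrankEq _ _ h1
  let g : (Fin N → ℂ) →ₗ[ℂ] _ := e.toLinearMap ∘ₗ P.mkQ
  refine ⟨fun i j => g (Pi.single j 1) i, fun z => ?_⟩
  have h2 : ∀ i, lam (fun j => g (Pi.single j 1) i) z = g z i := by
    intro i
    conv_rhs => rw [pi_eq_sum_univ' z]
    simp only [map_sum, map_smul, Finset.sum_apply, Pi.smul_apply, smul_eq_mul, lam]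
    exact Finset.sum_congr rfl fun j _ => mul_comm _ _
  simp only [h2]
  have h3 : z ∈ P ↔ g z = 0 := by
    change _ ↔ e (P.mkQ z) = 0
    rw [LinearEquiv.map_eq_zero_iff, Submodule.mkQ_apply, Submodule.Quotient.mk_eq_zero]
  rw [h3]
  constructor
  · intro h; funext i; exact h i
  · intro h i; exact congrFun h i

/-- second-order: SecF over arbitrary algebras -/
lemma F_add' {n : ℕ} {I : Ideal (MP n)} [I.IsPrime] {F : MP n} {D : Type} [CommRing D] [Algebra ℂ D]
    (hS : SecF I F) {x y : Fin n → D} (hx : OnC I x) (hy : OnC I y) : aeval (x + y) F = 0 := by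
  obtain ⟨T, _, _, _, _, i, j, hT, -, -⟩ := prod_alg (MP n ⧸ I) (MP n ⧸ I)
  have h1 := F_add hS ((onC_xq I).map i) ((onC_xq I).map j)
  obtain ⟨g, hg1, hg2⟩ := hT D (hq hx) (hq hy)
  have h2 := congrArg g h1
  rw [map_zero] at h2
  rw [← h2, comp_aeval_apply]
  congr 2
  funext i
  simp only [Pi.add_apply, map_add, hg1, hg2, hq_xq]

lemma F_tan {n : ℕ} {I : Ideal (MP n)} [I.IsPrime] (hI : HomI I) {F : MP n} (hS : SecF I F) {a b u : Fin n → ℂ}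
    (ha : OnC I a) (hb : OnC I b) (hu : u ∈ TanI I a) : ∑ i, eval (a + b) (pderiv i F) * u i = 0 := by
  have h1 := (mem_TanI_iff ha).mp hu
  have h2 := F_add' hS h1 (onC_cst (D := DualNumber ℂ) hb)
  have e : dpt a u + cst (DualNumber ℂ) b = dpt (a + b) u := by
    funext i; 
    apply TrivSqZeroExt.ext
    · simp [dpt, cst, TrivSqZeroExt.algebraMap_eq_inl]
    · simp [dpt, cst, TrivSqZeroExt.algebraMap_eq_inl]
  rw [e, aeval_dpt] at h2
  have h3 := congrArg TrivSqZeroExt.snd h2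
  simpa using h3

lemma self_tan {n : ℕ} {I : Ideal (MP n)} (hI : HomI I) {a : Fin n → ℂ} (ha : OnC I a) : a ∈ TanI I a := by
  rw [mem_TanI_iff ha]
  have h1 := (onC_cst (D := DualNumber ℂ) ha).smul hI (1 + DualNumber.eps)
  convert h1 using 1
  funext i
  apply TrivSqZeroExt.ext
  · simp [dpt, cst, TrivSqZeroExt.algebraMap_eq_inl]
  · simp [dpt, cst, TrivSqZeroExt.algebraMap_eq_inl]
end



lemma ae_ev {ι : Type} (x : ι → ℂ) (f : MvPolynomial ι ℂ) : aeval x f = eval x f := by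
  change (aeval x : MvPolynomial ι ℂ →ₐ[ℂ] ℂ).toRingHom f = _
  rfl

lemma min_F {n d : ℕ} {I : Ideal (MP n)} {G : MP n} (h0 : OnC I (0 : Fin n → ℂ)) (hG : G.IsHomogeneous d) (hG0 : G ≠ 0)
    (hS : SecF I G) : ∃ (F : MP n) (d : ℕ), F.IsHomogeneous d ∧ SecF I F ∧ ∃ i, ¬ SecF I (pderiv i F) := by
  classical
  have hex : ∃ d, ∃ F : MP n, F.IsHomogeneous d ∧ F ≠ 0 ∧ SecF I F := ⟨d, G, hG, hG0, hS⟩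
  obtain ⟨F, h1, h2, h3⟩ := Nat.find_spec hex
  refine ⟨F, _, h1, h3, ?_⟩
  by_contra! hc
  have hz : ∀ i, pderiv i F = 0 ∨ Nat.find hex = 0 := by
    intro i
    by_contra! hh
    exact Nat.find_min hex (m := Nat.find hex - 1) (by omega) ⟨pderiv i F, h1.pderiv, hh.1, hc i⟩
  by_cases hd : Nat.find hex = 0
  · rw [hd] at h1
    have h4 : F = C (coeff 0 F) := by
      rw [← totalDegree_eq_zero_iff_eq_C]
      have := h1.totalDegree_le
      omega
    have h5 := h3 0 0 h0 h0
    rw [h4] at h5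
    simp at h5
    apply h2
    rw [h4, h5, map_zero]
  · have := h1.sum_X_mul_pderiv
    have h6 : ∀ i, pderiv i F = 0 := fun i => (hz i).resolve_right hd
    simp only [h6, mul_zero, Finset.sum_const_zero] at this
    have := this.symm
    rw [nsmul_eq_mul, mul_eq_zero] at this
    rcases this with h | h
    · exact hd (by exact_mod_cast h)
    · exact h2 h

def NDI {n : ℕ} (I : Ideal (MP n)) : Prop := ∀ h : Fin n → ℂ, h ≠ 0 → ∃ x : Fin n → ℂ, OnC I x ∧ lam h x ≠ 0

lemma lam_ℂ {n : ℕ} (h x : Fin n → ℂ) : lam h x = ∑ i, h i * x i := by simp [lam]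

lemma form_of_lin {n : ℕ} (φ : (Fin n → ℂ) →ₗ[ℂ] ℂ) : ∃ h : Fin n → ℂ, ∀ x, lam h x = φ x := by
  refine ⟨fun i => φ (Pi.single i 1), fun x => ?_⟩
  conv_rhs => rw [pi_eq_sum_univ' x]
  simp only [map_sum, map_smul, smul_eq_mul, lam]
  exact Finset.sum_congr rfl fun j _ => mul_comm _ _

def lamLin {n : ℕ} (h : Fin n → ℂ) : (Fin n → ℂ) →ₗ[ℂ] ℂ where
  toFun x := lam h x
  map_add' := lam_add (l := h)
  map_smul' c x := by simp [lam_smul]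

lemma nd_form {n : ℕ} {Y : Set (PrV n)} (hnd : NondegenerateSet Y) : NDI (idealOf Y) := by
  intro h hh
  by_contra! hc
  apply hnd {x | lamLin h x.rep = 0} ⟨lamLin h, ?_, rfl⟩
  · intro x hx
    exact hc _ (onC_rep hx)
  · intro h0
    apply hh
    funext i
    have := LinearMap.congr_fun h0 (Pi.single i 1)
    simpa [lamLin, lam_ℂ, Pi.single_apply] using this

lemma cc_not {n : ℕ} {I : Ideal (MP n)} (hI : HomI I) (h0 : OnC I (0 : Fin n → ℂ)) (hnd : NDI I) {G : MP n} (hG0 : G ≠ 0) (hS : SecF I G) :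
    ∃ a b : Fin n → ℂ, OnC I a ∧ OnC I b ∧ ¬ OnC I (a + b) := by
  by_contra! hc
  let W : Submodule ℂ (Fin n → ℂ) := 
    { carrier := {v | OnC I v}
      add_mem' := fun {a b} ha hb => hc a b ha hb
      zero_mem' := h0
      smul_mem' := fun c x hx => OnC.smul hI hx c }
  have hW : ∀ v, v ∈ W := by
    by_contra! hv
    obtain ⟨v, hv⟩ := hv
    obtain ⟨f, h1, h2⟩ := Submodule.exists_le_ker_of_notMem hv
    obtain ⟨h, hh⟩ := form_of_lin f
    obtain ⟨x, hx, hx2⟩ := hnd h (by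
      rintro rfl
      apply h1
      rw [← hh]; simp [lam])
    apply hx2
    rw [hh]
    exact h2 hx
  obtain ⟨v, hv⟩ := exists_eval_ne hG0
  apply hv
  have := hS v 0 (hW v) h0
  simpa using this

lemma pick_ab {n : ℕ} {I : Ideal (MP n)} [I.IsPrime] {f : MP n} (h1 : ¬ SecF I f) 
    (h2 : ∃ a b : Fin n → ℂ, OnC I a ∧ OnC I b ∧ ¬ OnC I (a + b)) :
    ∃ a b : Fin n → ℂ, OnC I a ∧ OnC I b ∧ ¬ OnC I (a + b) ∧ eval (a + b) f ≠ 0 := by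
  obtain ⟨T, _, _, _, _, i, j, hT, -, -⟩ := prod_alg (MP n ⧸ I) (MP n ⧸ I)
  have key : ∀ g : MP n, (∃ a b : Fin n → ℂ, OnC I a ∧ OnC I b ∧ eval (a + b) g ≠ 0) →
      aeval (fun k => i (xq I k) + j (xq I k)) g ≠ 0 := by
    rintro g ⟨a, b, ha, hb, hg⟩ h
    obtain ⟨ξ, e1, e2⟩ := hT ℂ (hq ha) (hq hb)
    apply hg
    have := congrArg ξ h
    rw [comp_aeval_apply, map_zero] at this
    rw [← this, ← ae_ev]
    simp only [map_add, e1, e2, hq_xq]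
    rfl
  simp only [SecF] at h1
  push Not at h1
  obtain ⟨a, b, ha, hb, hab⟩ := h1
  obtain ⟨a', b', ha', hb', hab'⟩ := h2
  rw [onC_eval] at hab'
  push Not at hab'
  obtain ⟨g, hg, hgg⟩ := hab'
  have k1 := mul_ne_zero (key f ⟨a, b, ha, hb, hab⟩) (key g ⟨a', b', ha', hb', hgg⟩)
  have : ∃ ξ : T →ₐ[ℂ] ℂ, ξ (aeval (fun k => i (xq I k) + j (xq I k)) f * aeval (fun k => i (xq I k) + j (xq I k)) g) ≠ 0 := by
    by_contra! h
    exact k1 (eq_zero_of_pts h)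
  obtain ⟨ξ, hξ⟩ := this
  rw [map_mul, comp_aeval_apply, comp_aeval_apply] at hξ
  have e : (fun k => ξ (i (xq I k) + j (xq I k))) = (fun k => ξ (i (xq I k))) + (fun k => ξ (j (xq I k))) := by
    funext k; simp
  rw [e, ae_ev, ae_ev] at hξ
  refine ⟨_, _, (onC_xq I).map (ξ.comp i), (onC_xq I).map (ξ.comp j), ?_, left_ne_zero_of_mul hξ⟩
  intro h
  exact right_ne_zero_of_mul hξ (onC_eval.mp h g hg)

lemma triple_cone {N : ℕ} {I : Ideal (MP N)} [I.IsPrime] (hI : HomI I) {x1 a b : Fin N → ℂ} (hx1 : OnC I x1)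
    (ha : OnC I a) (hb : OnC I b) (P1 P2 : Submodule ℂ (Fin N → ℂ)) (h1 : a + b ∈ P1) (h2 : x1 - a ∈ P2) :
    ∃ (T : Type) (_ : CommRing T) (_ : IsDomain T) (_ : Algebra ℂ T) (_ : Algebra.FiniteType ℂ T)
      (X Y Y' : Fin N → T) (ξ0 ξ1 : T →ₐ[ℂ] ℂ), OnC I X ∧ OnC I Y ∧ OnC I Y' ∧
      (∀ i, ξ1 (X i) = x1 i) ∧ (∀ i, ξ1 (Y i) = a i) ∧ (∀ i, ξ1 (Y' i) = b i) ∧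
      (∀ i, ξ0 (X i) = 0) ∧ (∀ i, ξ0 (Y i) = 0) ∧ (∀ i, ξ0 (Y' i) = 0) ∧
      (∀ ξ : T →ₐ[ℂ] ℂ, (fun i => ξ (Y i) + ξ (Y' i)) ∈ P1) ∧
      (∀ ξ : T →ₐ[ℂ] ℂ, (fun i => ξ (X i) - ξ (Y i)) ∈ P2) ∧
      3 * td (MP N ⧸ I) ≤ td T + ((N - Module.finrank ℂ P1) + (N - Module.finrank ℂ P2)) ∧
      (∀ U : Subalgebra ℂ T, (∀ i, X i ∈ U) → (∀ i, Y i ∈ U) → (∀ i, Y' i ∈ U) → U = ⊤) := by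
  obtain ⟨E, _, _, _, _, i1, i2, hE, tE, gE⟩ := prod_alg (MP N ⧸ I) (MP N ⧸ I)
  obtain ⟨T0, _, _, _, _, j1, j2, hT, tT, gT⟩ := prod_alg (MP N ⧸ I) E
  obtain ⟨ψ1, hψ1⟩ := sub_forms P1
  obtain ⟨ψ2, hψ2⟩ := sub_forms P2
  obtain ⟨e, he1, he2⟩ := hE ℂ (hq ha) (hq hb)
  obtain ⟨ξ, hξ1, hξ2⟩ := hT ℂ (hq hx1) e
  let x : Fin N → T0 := fun i => j1 (xq I i)
  let y : Fin N → T0 := fun i => j2 (i1 (xq I i))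
  let y' : Fin N → T0 := fun i => j2 (i2 (xq I i))
  have ex : ∀ i, ξ (x i) = x1 i := by intro i; simp only [x, hξ1, hq_xq]
  have ey : ∀ i, ξ (y i) = a i := by intro i; simp only [y, hξ2, he1, hq_xq]
  have ey' : ∀ i, ξ (y' i) = b i := by intro i; simp only [y', hξ2, he2, hq_xq]
  obtain ⟨B, _, _, _, _, q, η, hq, hη, hz, ht⟩ := krull' ξ
    (Sum.elim (fun i => lam (ψ1 i) (y + y')) (fun i => lam (ψ2 i) (x - y))) (by
      rintro (i | i)
      · simp only [Sum.elim_inl, lam_map, Pi.add_apply, map_add, ey, ey']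
        exact (hψ1 _).mpr h1 i
      · simp only [Sum.elim_inr, lam_map, Pi.sub_apply, map_sub, ex, ey]
        exact (hψ2 _).mpr h2 i)
  obtain ⟨T, _, _, _, _, Z, ι, τ, ξ0, hι, Zι, Zτ, Z0, tdT, gen⟩ := coneify
    (Sum.elim (fun i => q (x i)) (Sum.elim (fun i => q (y i)) (fun i => q (y' i)))) (by
      intro U hU
      have hU' : U.comap q = ⊤ := by
        apply gT
        · intro a
          exact incl_xq j1 (U.comap q) (fun i => hU (Sum.inl i)) a
        · intro b
          have : (U.comap q).comap j2 = ⊤ := by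
            apply gE
            · intro a
              exact incl_xq (j2.comp i1) (U.comap q) (fun i => hU (Sum.inr (Sum.inl i))) a
            · intro a
              exact incl_xq (j2.comp i2) (U.comap q) (fun i => hU (Sum.inr (Sum.inr i))) a
          have h : b ∈ (U.comap q).comap j2 := by rw [this]; trivial
          exact h
      rw [eq_top_iff]
      rintro b -
      obtain ⟨c, rfl⟩ := hq b
      have h : c ∈ U.comap q := by rw [hU']; trivial
      exact h) η
  have hon : ∀ (g : MP N ⧸ I →ₐ[ℂ] B) (W : Fin N → T), (∀ i, ι (W i) = Polynomial.X * Polynomial.C (g (xq I i))) → OnC I W := by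
    intro g W hW f hf
    apply hι
    rw [comp_aeval_apply, map_zero]
    have := OnC.smul hI ((onC_xq I).map ((Polynomial.CAlgHom : B →ₐ[ℂ] Polynomial B).comp g)) Polynomial.X f hf
    rw [← this]
    congr 2
    funext i
    rw [hW]; rfl
  have hpt : ∀ (ξ : T →ₐ[ℂ] ℂ) (ψ : Fin N → ℂ) (v : Fin N → B) (W : Fin N → T), (∀ i, ι (W i) = Polynomial.X * Polynomial.C (v i)) →
      lam ψ v = 0 → lam ψ (fun i => ξ (W i)) = 0 := by
    intro ξ ψ v W hW hv
    rw [← lam_map]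
    have : lam ψ W = 0 := by
      apply hι
      rw [lam_map, map_zero]
      simp only [hW]
      have := lam_smul (l := ψ) (Polynomial.X) (fun i => (Polynomial.CAlgHom : B →ₐ[ℂ] Polynomial B) (v i))
      rw [← lam_map, hv, map_zero, mul_zero] at this
      exact this
    rw [this, map_zero]
  have htd : 3 * td (MP N ⧸ I) ≤ td T + ((N - Module.finrank ℂ P1) + (N - Module.finrank ℂ P2)) := by
    simp at ht
    omega
  refine ⟨T, inferInstance, inferInstance, inferInstance, inferInstance, fun i => Z (Sum.inl i), fun i => Z (Sum.inr (Sum.inl i)),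
    fun i => Z (Sum.inr (Sum.inr i)), ξ0, η.comp τ, hon (q.comp j1) _ fun i => Zι _, hon (q.comp (j2.comp i1)) _ fun i => Zι _, 
    hon (q.comp (j2.comp i2)) _ fun i => Zι _, ?_, ?_, ?_, fun i => Z0 _, fun i => Z0 _, fun i => Z0 _, ?_, ?_, htd, ?_⟩
  · intro i; rw [AlgHom.comp_apply, Zτ, Sum.elim_inl, hη, ex]
  · intro i; rw [AlgHom.comp_apply, Zτ, Sum.elim_inr, Sum.elim_inl, hη, ey]
  · intro i; rw [AlgHom.comp_apply, Zτ, Sum.elim_inr, Sum.elim_inr, hη, ey']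
  · intro ξ
    rw [← hψ1]
    intro i
    have h := hz (Sum.inl i)
    simp only [Sum.elim_inl, lam_map] at h
    have := hpt ξ (ψ1 i) _ (fun i => Z (Sum.inr (Sum.inl i)) + Z (Sum.inr (Sum.inr i))) (fun i => by
      rw [map_add, Zι, Zι]; simp only [Sum.elim_inr, Sum.elim_inl, Pi.add_apply, map_add]; ring) h
    simpa using this
  · intro ξ
    rw [← hψ2]
    intro i
    have h := hz (Sum.inr i)
    simp only [Sum.elim_inr, lam_map] at h
    have := hpt ξ (ψ2 i) _ (fun i => Z (Sum.inl i) - Z (Sum.inr (Sum.inl i))) (fun i => by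
      rw [map_sub, Zι, Zι]; simp only [Sum.elim_inr, Sum.elim_inl, Pi.sub_apply, map_sub]; ring) h
    simpa using this
  · intro U hX hY hY'
    apply gen
    rintro (i | i | i)
    · exact hX i
    · exact hY i
    · exact hY' i


lemma semicont {N : ℕ} {T J : Type} [CommRing T] [Algebra ℂ T] (G : J → Fin N → T) (K : (T →ₐ[ℂ] ℂ) → Submodule ℂ (Fin N → ℂ))
    (hK : ∀ ξ u, u ∈ K ξ ↔ ∀ j, ∑ i, ξ (G j i) * u i = 0) (ξ2 : T →ₐ[ℂ] ℂ) :
    ∃ D : T, ξ2 D ≠ 0 ∧ ∀ ξ : T →ₐ[ℂ] ℂ, ξ D ≠ 0 → Module.finrank ℂ (K ξ) ≤ Module.finrank ℂ (K ξ2) := by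
  obtain ⟨W, hW⟩ := Submodule.exists_isCompl (K ξ2)
  have hf := Submodule.finrank_add_eq_of_isCompl hW
  let c := Module.finrank ℂ W
  let e : Module.Basis (Fin c) ℂ W := Module.finBasis ℂ W
  let g : J → Module.Dual ℂ W := fun j => (lamLin fun i => ξ2 (G j i)) ∘ₗ W.subtype
  have hg : ∀ j u, g j u = ∑ i, ξ2 (G j i) * (u : Fin N → ℂ) i := fun j u => lam_ℂ _ _
  have hspan : ⊤ ≤ Submodule.span ℂ (Set.range g) := by
    rintro φ -
    by_contra hφ
    obtain ⟨ψ, h1, h2⟩ := Submodule.exists_le_ker_of_notMem hφ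
    obtain ⟨u, hu⟩ := (Module.evalEquiv ℂ W).surjective ψ
    have h3 : ∀ j, g j u = 0 := by
      intro j
      have := h2 (Submodule.subset_span (Set.mem_range_self j))
      rw [LinearMap.mem_ker, ← hu] at this
      simpa using this
    have h4 : (u : Fin N → ℂ) ∈ K ξ2 := by
      rw [hK]; intro j; rw [← hg]; exact h3 j
    have h5 : (u : Fin N → ℂ) = 0 := by
      have := hW.disjoint.le_bot ⟨h4, u.2⟩
      simpa using this
    apply h1
    have : u = 0 := Subtype.ext h5
    rw [← hu, this]; simp
  let b := Module.Basis.ofSpan hspan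
  have hcard : Module.finrank ℂ (Module.Dual ℂ W) = c := Subspace.dual_finrank_eq
  have : Finite _ := Module.Finite.finite_basis b
  have : Fintype ((linearIndepOn_empty ℂ (id : Module.Dual ℂ W → Module.Dual ℂ W)).extend (Set.empty_subset (Set.range g))) := Fintype.ofFinite _
  have hc2 : Fintype.card _ = c := (Module.finrank_eq_card_basis b).symm.trans hcard
  let b' : Module.Basis (Fin c) ℂ (Module.Dual ℂ W) := b.reindex (Fintype.equivFinOfCardEq hc2)
  have hb' : ∀ k, ∃ j, g j = b' k := by
    intro k
    have : b' k ∈ Set.range g := by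
      apply Module.Basis.ofSpan_subset hspan
      rw [Module.Basis.reindex_apply]
      exact ⟨_, rfl⟩
    exact this
  choose j hj using hb'
  let M : Matrix (Fin c) (Fin c) T := fun k l => ∑ i, algebraMap ℂ T ((e l : Fin N → ℂ) i) * G (j k) i
  have hM : ∀ (ξ : T →ₐ[ℂ] ℂ) (v : Fin c → ℂ) k, (M.map ξ).mulVec v k = ∑ i, ξ (G (j k) i) * ((∑ l, v l • e l : W) : Fin N → ℂ) i := by
    intro ξ v k
    have e1 : ∀ l, M.map ξ k l = ∑ i, (e l : Fin N → ℂ) i * ξ (G (j k) i) := by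
      intro l
      rw [Matrix.map_apply]
      simp [M]
    simp only [Matrix.mulVec, dotProduct, e1, Finset.sum_mul, Finset.mul_sum,
      Submodule.coe_sum, Submodule.coe_smul, Finset.sum_apply, Pi.smul_apply, smul_eq_mul]
    rw [Finset.sum_comm]
    exact Finset.sum_congr rfl fun i _ => Finset.sum_congr rfl fun l _ => by ring
  have hdet : ∀ ξ : T →ₐ[ℂ] ℂ, ξ M.det = (M.map ξ).det := fun ξ => AlgHom.map_det ξ M
  refine ⟨M.det, ?_, ?_⟩
  · rw [hdet]
    intro h
    obtain ⟨v, hv, hv2⟩ := Matrix.exists_mulVec_eq_zero_iff.mpr h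
    have h6 : ∀ k, b' k (∑ l, v l • e l) = 0 := by
      intro k
      rw [← hj, hg, ← hM, hv2]; rfl
    have h7 : (∑ l, v l • e l : W) = 0 := by
      rw [← Module.forall_dual_apply_eq_zero_iff ℂ]
      intro φ
      have : φ ∈ Submodule.span ℂ (Set.range b') := by rw [b'.span_eq]; trivial
      induction this using Submodule.span_induction with
      | mem x h => obtain ⟨k, rfl⟩ := h; exact h6 k
      | zero => rfl
      | add x y _ _ hx hy => rw [LinearMap.add_apply, hx, hy, add_zero]
      | smul a x _ hx => rw [LinearMap.smul_apply, hx, smul_zero]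
    apply hv
    funext l
    exact Fintype.linearIndependent_iff.mp e.linearIndependent v h7 l
  · intro ξ hξ
    rw [hdet] at hξ
    have hdis : Disjoint (K ξ) W := by
      rw [Submodule.disjoint_def]
      intro u hu huW
      by_contra h0
      apply hξ
      rw [← Matrix.exists_mulVec_eq_zero_iff]
      have hs := e.sum_repr ⟨u, huW⟩
      refine ⟨e.repr ⟨u, huW⟩, ?_, ?_⟩
      · intro h
        apply h0
        have h2 : e.repr ⟨u, huW⟩ = 0 := by ext l; exact congrFun h l
        rw [LinearEquiv.map_eq_zero_iff] at h2
        exact congrArg Subtype.val h2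
      · funext k
        rw [hM, hs]
        exact (hK ξ u).mp hu _
    have := Submodule.finrank_add_finrank_le_of_disjoint hdis
    omega

lemma dual_form {N : ℕ} {I : Ideal (MP N)} {y h : Fin N → ℂ} (hh : ∀ u ∈ TanI I y, lam h u = 0) :
    ∃ f ∈ I, ∀ i, eval y (pderiv i f) = h i := by
  let A : MP N →ₗ[ℂ] (Fin N → ℂ) := LinearMap.pi fun i => (aeval y : MP N →ₐ[ℂ] ℂ).toLinearMap ∘ₗ (pderiv i : Derivation ℂ (MP N) (MP N)).toLinearMap
  have hA : ∀ f i, A f i = eval y (pderiv i f) := fun f i => ae_ev _ _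
  by_cases hc : h ∈ (I.restrictScalars ℂ).map A
  · obtain ⟨f, hf, e⟩ := hc
    exact ⟨f, hf, fun i => by rw [← hA, e]⟩
  · exfalso
    obtain ⟨φ, h1, h2⟩ := Submodule.exists_le_ker_of_notMem hc
    obtain ⟨u, hu⟩ := form_of_lin φ
    apply h1
    rw [← hu, lam_ℂ]
    have : u ∈ TanI I y := by
      rw [mem_TanI]
      intro f hf
      have : φ (A f) = 0 := h2 ⟨f, hf, rfl⟩
      rw [← hu, lam_ℂ] at this
      rw [← this]
      refine Finset.sum_congr rfl fun i _ => by rw [hA, mul_comm]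
    have := hh u this
    rw [lam_ℂ] at this
    rw [← this]
    exact Finset.sum_congr rfl fun i _ => mul_comm _ _


lemma zak_aux {N m d : ℕ} {I : Ideal (MP N)} [I.IsPrime] (hI : HomI I) (hnd : NDI I) (htd : m + 1 ≤ td (MP N ⧸ I))
    (hsm : ∀ v : Fin N → ℂ, v ≠ 0 → OnC I v → Module.finrank ℂ (TanI I v) = m + 1) (hN : 2 * N = 3 * m + 4)
    {F : MP N} (hF : F.IsHomogeneous d) (hS : SecF I F) {a b : Fin N → ℂ} (ha : OnC I a) (hb : OnC I b)
    (hab : ¬ OnC I (a + b)) {h : Fin N → ℂ} (hh : h = fun i => eval (a + b) (pderiv i F)) (h0 : h ≠ 0) : False := by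
  obtain ⟨p, hp⟩ : ∃ p, p = a + b := ⟨_, rfl⟩
  rw [← hp] at hab hh
  have hp0 : p ≠ 0 := fun h => hab (h ▸ onC_zero hI ha)
  have hFp : eval p F = 0 := hp ▸ hS a b ha hb
  have hhp : lam h p = 0 := by
    have := congrArg (eval p) hF.sum_X_mul_pderiv
    simp only [map_sum, map_mul, eval_X, map_nsmul, hFp, smul_zero] at this
    rw [lam_ℂ, ← this, hh]
    exact Finset.sum_congr rfl fun i _ => mul_comm _ _
  have hha : lam h a = 0 := by
    have := F_tan hI hS ha hb (self_tan hI ha)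
    rw [lam_ℂ, hh, hp]; exact this
  obtain ⟨x1, hx1, hhx1⟩ := hnd h h0
  obtain ⟨v, hv⟩ : ∃ v, v = x1 - a := ⟨_, rfl⟩
  have hhv : lam h v ≠ 0 := by rw [hv, lam_sub, hha, sub_zero]; exact hhx1
  have hv0 : v ≠ 0 := by rintro rfl; exact hhv (by simp [lam])
  obtain ⟨T, _, _, _, _, X, Y, Y', ξ0, ξ1, hX, hY, hY', e1X, e1Y, e1Y', e0X, e0Y, e0Y', hP1, hP2, ht, gen⟩ :=
    triple_cone hI hx1 ha hb (Submodule.span ℂ {p, x1}) (Submodule.span ℂ {v})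
      (Submodule.subset_span (by simp [hp])) (Submodule.subset_span (by simp [hv]))
  have hr1 : Module.finrank ℂ (Submodule.span ℂ {p, x1}) = 2 := by
    have hli : LinearIndependent ℂ ![p, x1] := by
      rw [LinearIndependent.pair_iff]
      intro s t hst
      have h1 := congrArg (lam h) hst
      rw [lam_add, lam_smul, lam_smul, hhp] at h1
      have ht : t = 0 := by
        have : lam h (0 : Fin N → ℂ) = 0 := by simp [lam]
        rw [this] at h1
        simpa [hhx1] using h1
      rw [ht] at hst
      refine ⟨?_, ht⟩
      simpa [hp0] using hst
    have := finrank_span_eq_card hli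
    rw [Matrix.range_cons, Matrix.range_cons, Matrix.range_empty, Set.union_empty] at this
    rw [Fintype.card_fin] at this
    exact this
  have hr2 : Module.finrank ℂ (Submodule.span ℂ {v}) = 1 := finrank_span_singleton hv0
  rw [hr1, hr2] at ht
  have htT : 2 ≤ td T := by omega
  -- forms
  let φ2 : Fin N → ℂ := (lam h x1)⁻¹ • h
  have lamsm : ∀ (c : ℂ) (g x : Fin N → ℂ), lam (c • g) x = c * lam g x := by
    intro c g x; simp only [lam_ℂ, Finset.mul_sum, Pi.smul_apply, smul_eq_mul, mul_assoc]
  obtain ⟨i0, hi0⟩ := Function.ne_iff.mp hp0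
  obtain ⟨φ0, hφ0⟩ : ∃ φ0 : Fin N → ℂ, lam φ0 p = 1 :=
    ⟨Pi.single i0 (p i0)⁻¹, by rw [lam_ℂ, Finset.sum_eq_single i0]; · simp; exact inv_mul_cancel₀ hi0
                               · intro b _ hb; simp [hb]
                               · simp⟩
  have a21 : lam φ2 p = 0 := by rw [lamsm, hhp, mul_zero]
  have a22 : lam φ2 x1 = 1 := by rw [lamsm]; exact inv_mul_cancel₀ hhx1
  obtain ⟨φ1, a11, a12⟩ : ∃ φ1 : Fin N → ℂ, lam φ1 p = 1 ∧ lam φ1 x1 = 0 := by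
    refine ⟨φ0 - (lam φ0 x1) • φ2, ?_, ?_⟩
    · have : lam (φ0 - (lam φ0 x1) • φ2) p = lam φ0 p - lam ((lam φ0 x1) • φ2) p := by
        simp only [lam_ℂ, Pi.sub_apply, sub_mul, Finset.sum_sub_distrib]
      rw [this, lamsm, a21, hφ0]; ring
    · have : lam (φ0 - (lam φ0 x1) • φ2) x1 = lam φ0 x1 - lam ((lam φ0 x1) • φ2) x1 := by
        simp only [lam_ℂ, Pi.sub_apply, sub_mul, Finset.sum_sub_distrib]
      rw [this, lamsm, a22]; ring
  let φ3 : Fin N → ℂ := (lam h v)⁻¹ • h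
  have a33 : lam φ3 v = 1 := by rw [lamsm]; exact inv_mul_cancel₀ hhv
  obtain ⟨t, htd'⟩ : ∃ t, t = lam φ1 (Y + Y') := ⟨_, rfl⟩
  obtain ⟨s, hsd⟩ : ∃ s, s = lam φ2 (Y + Y') := ⟨_, rfl⟩
  obtain ⟨u, hud⟩ : ∃ u, u = lam φ3 (X - Y) := ⟨_, rfl⟩
  have ext : ∀ x y : Fin N → T, (∀ ξ : T →ₐ[ℂ] ℂ, (fun i => ξ (x i)) = fun i => ξ (y i)) → x = y := by
    intro x y hxy
    funext i
    rw [← sub_eq_zero]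
    apply eq_zero_of_pts
    intro ξ
    rw [map_sub, congrFun (hxy ξ) i, sub_self]
  have id1 : Y + Y' = t • cst T p + s • cst T x1 := by
    apply ext
    intro ξ
    obtain ⟨c1, c2, hc⟩ := Submodule.mem_span_pair.mp (hP1 ξ)
    have hc' : (fun i => ξ ((Y + Y') i)) = c1 • p + c2 • x1 := by rw [hc]; funext i; simp
    have ht1 : ξ t = c1 := by
      rw [htd', lam_map, hc', lam_add, lam_smul, lam_smul, a11, a12]; ring
    have hs1 : ξ s = c2 := by
      rw [hsd, lam_map, hc', lam_add, lam_smul, lam_smul, a21, a22]; ring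
    rw [hc']
    funext i
    simp [ht1, hs1, cst]
  have id2 : X - Y = u • cst T v := by
    apply ext
    intro ξ
    obtain ⟨c1, hc⟩ := Submodule.mem_span_singleton.mp (hP2 ξ)
    have hc' : (fun i => ξ ((X - Y) i)) = c1 • v := by rw [hc]; funext i; simp
    have ht1 : ξ u = c1 := by
      rw [hud, lam_map, hc', lam_smul, a33]; ring
    rw [hc']
    funext i
    simp [ht1, cst]
  have ht1 : ξ1 t = 1 := by
    rw [htd', lam_map]
    have : (fun i => ξ1 ((Y + Y') i)) = p := by funext i; simp [e1Y, e1Y', hp]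
    rw [this, a11]
  have hs1 : ξ1 s = 0 := by
    rw [hsd, lam_map]
    have : (fun i => ξ1 ((Y + Y') i)) = p := by funext i; simp [e1Y, e1Y', hp]
    rw [this, a21]
  have hu1 : ξ1 u = 1 := by
    rw [hud, lam_map]
    have : (fun i => ξ1 ((X - Y) i)) = v := by funext i; simp [e1Y, e1X, hv]
    rw [this, a33]
  have dtp : ∀ i, aeval (t • cst T p) (pderiv i F) = t ^ (d - 1) * algebraMap ℂ T (h i) := by
    intro i
    have := aeval_mul_hom (hF.pderiv (i := i)) t (cst T p)
    rw [aeval_cst] at this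
    rw [hh]; exact this
  have hs0 : s = 0 := by
    obtain ⟨w, hw⟩ := taylor F (t • cst T p) (cst T x1) s
    have e1 : (fun i => (t • cst T p) i + s * cst T x1 i) = Y + Y' := by rw [id1]; rfl
    have e2 : aeval (t • cst T p) F = 0 := by
      have := aeval_mul_hom hF t (cst T p)
      rw [aeval_cst, hFp, map_zero, mul_zero] at this
      exact this
    have e3 : ∑ i, aeval (t • cst T p) (pderiv i F) * cst T x1 i = t ^ (d - 1) * algebraMap ℂ T (lam h x1) := by
      rw [lam_ℂ, map_sum, Finset.mul_sum]
      exact Finset.sum_congr rfl fun i _ => by rw [dtp, map_mul, cst]; ring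
    rw [e1, F_add hS hY hY', e2, e3] at hw
    have e4 : s * (t ^ (d - 1) * algebraMap ℂ T (lam h x1) + s * w) = 0 := by rw [hw]; ring
    refine (mul_eq_zero.mp e4).resolve_right fun h5 => ?_
    have := congrArg ξ1 h5
    simp [ht1, hs1] at this
    exact hhx1 this
  rw [hs0, zero_smul, add_zero] at id1
  have tan : ∀ ξ : T →ₐ[ℂ] ℂ, ξ t ≠ 0 → ∀ u ∈ TanI I (fun i => ξ (Y i)), lam h u = 0 := by
    intro ξ hξ u hu
    have := F_tan hI hS (hY.map ξ) (hY'.map ξ) hu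
    have e : (fun i => ξ (Y i)) + (fun i => ξ (Y' i)) = ξ t • p := by
      funext i
      have := congrArg ξ (congrFun id1 i)
      simpa [cst] using this
    rw [e] at this
    simp only [eval_smul_hom hF.pderiv, mul_assoc] at this
    rw [← Finset.mul_sum] at this
    have := (mul_eq_zero.mp this).resolve_left (pow_ne_zero _ hξ)
    rw [lam_ℂ, hh]; exact this
  have t0 : t ≠ 0 := by rintro rfl; simp at ht1
  have hhY : lam h Y = 0 := by
    have : t * lam h Y = 0 := by
      apply eq_zero_of_pts
      intro ξ
      rw [map_mul]
      by_cases hξ : ξ t = 0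
      · rw [hξ, zero_mul]
      · rw [lam_map, tan ξ hξ _ (self_tan hI (hY.map ξ)), mul_zero]
    exact (mul_eq_zero.mp this).resolve_left t0
  obtain ⟨ξ2, hξ2x, hξ2n⟩ : ∃ ξ2 : T →ₐ[ℂ] ℂ, ξ2 (lam h X) = 0 ∧ ((∃ i, ξ2 (X i) ≠ 0) ∨ (∃ i, ξ2 (Y i) ≠ 0) ∨ (∃ i, ξ2 (Y' i) ≠ 0)) := by
    obtain ⟨T2, _, _, _, _, q, η, hq, hη, hz, htt⟩ := krull' ξ0 (fun _ : Unit => lam h X) (by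
      intro _; rw [lam_map]; simp [e0X, lam])
    by_contra! hc
    have hcz : ∀ ζ : T2 →ₐ[ℂ] ℂ, (∀ i, ζ (q (X i)) = 0) ∧ (∀ i, ζ (q (Y i)) = 0) ∧ (∀ i, ζ (q (Y' i)) = 0) := fun ζ =>
      hc (ζ.comp q) (by rw [AlgHom.comp_apply, hz (), map_zero])
    have hU : (⊥ : Subalgebra ℂ T2).comap q = ⊤ := by
      apply gen
      · intro i
        have : q (X i) = 0 := eq_zero_of_pts fun ζ => (hcz ζ).1 i
        exact (Subalgebra.mem_comap _ _ _).mpr (by rw [this]; exact zero_mem _)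
      · intro i
        have : q (Y i) = 0 := eq_zero_of_pts fun ζ => (hcz ζ).2.1 i
        exact (Subalgebra.mem_comap _ _ _).mpr (by rw [this]; exact zero_mem _)
      · intro i
        have : q (Y' i) = 0 := eq_zero_of_pts fun ζ => (hcz ζ).2.2 i
        exact (Subalgebra.mem_comap _ _ _).mpr (by rw [this]; exact zero_mem _)
    have : td T2 = 0 := by
      apply td_zero_of_const η
      intro b
      obtain ⟨c, rfl⟩ := hq b
      have h : c ∈ (⊥ : Subalgebra ℂ T2).comap q := by rw [hU]; trivial
      obtain ⟨k, hk⟩ := Algebra.mem_bot.mp h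
      have hk' : algebraMap ℂ T2 k = q c := hk
      rw [← hk', AlgHom.commutes]; rfl
    simp at htt
    omega
  have hu2 : ξ2 u = 0 := by
    have e : lam h X = u * algebraMap ℂ T (lam h v) := by
      have := congrArg (lam h) id2
      rw [lam_sub, hhY, sub_zero, lam_smul, lam_cst] at this
      exact this
    rw [e, map_mul, AlgHom.commutes] at hξ2x
    exact (mul_eq_zero.mp hξ2x).resolve_right hhv
  have hxy : ∀ i, ξ2 (X i) = ξ2 (Y i) := by
    intro i
    have := congrArg ξ2 (congrFun id2 i)
    rw [← sub_eq_zero]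
    simpa [hu2] using this
  have hy2 : (fun i => ξ2 (Y i)) ≠ 0 := by
    intro hy
    have hyi : ∀ i, ξ2 (Y i) = 0 := fun i => congrFun hy i
    have e : ∀ i, ξ2 (Y' i) = ξ2 t * p i := by
      intro i
      have := congrArg ξ2 (congrFun id1 i)
      simpa [cst, hyi] using this
    rcases hξ2n with ⟨i, hi⟩ | ⟨i, hi⟩ | ⟨i, hi⟩
    · exact hi (by rw [hxy, hyi])
    · exact hi (hyi i)
    · have ht2 : ξ2 t ≠ 0 := by intro h; rw [e, h, zero_mul] at hi; exact hi rfl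
      apply hab
      have := (hY'.map ξ2).smul hI (ξ2 t)⁻¹
      convert this using 1
      funext i
      simp only [Pi.smul_apply, e, smul_eq_mul]
      rw [inv_mul_cancel_left₀ ht2]
  have key : ∀ u ∈ TanI I (fun i => ξ2 (Y i)), lam h u = 0 := by
    let G : Option I → Fin N → T := fun j i => match j with
      | none => algebraMap ℂ T (h i)
      | some f => aeval Y (pderiv i f.1)
    obtain ⟨D, hD, hDD⟩ := semicont G (fun ξ => TanI I (fun i => ξ (Y i)) ⊓ LinearMap.ker (lamLin h)) (by
      intro ξ u
      rw [Submodule.mem_inf, mem_TanI, LinearMap.mem_ker]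
      constructor
      · rintro ⟨h1, h2⟩ (_ | f)
        · simp only [G, AlgHom.commutes]
          rw [← h2]; exact (lam_ℂ _ _).symm
        · simp only [G, comp_aeval_apply, ae_ev]
          exact h1 f.1 f.2
      · intro hj
        constructor
        · intro f hf
          have := hj (some ⟨f, hf⟩)
          simpa only [G, comp_aeval_apply, ae_ev] using this
        · have := hj none
          simp only [G, AlgHom.commutes] at this
          exact (lam_ℂ _ _).trans this) ξ2
    obtain ⟨i, hi⟩ := Function.ne_iff.mp hy2
    have hYi : Y i ≠ 0 := by intro h; apply hi; simp [h]
    have hD0 : D ≠ 0 := by rintro rfl; simp at hD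
    have : ∃ ξ3 : T →ₐ[ℂ] ℂ, ξ3 (D * t * Y i) ≠ 0 := by
      by_contra! hc
      exact mul_ne_zero (mul_ne_zero hD0 t0) hYi (eq_zero_of_pts hc)
    obtain ⟨ξ3, h3⟩ := this
    rw [map_mul, map_mul] at h3
    have g1 := hDD ξ3 (left_ne_zero_of_mul (left_ne_zero_of_mul h3))
    have g2 : TanI I (fun i => ξ3 (Y i)) ⊓ LinearMap.ker (lamLin h) = TanI I (fun i => ξ3 (Y i)) :=
      inf_eq_left.mpr fun u hu => tan ξ3 (right_ne_zero_of_mul (left_ne_zero_of_mul h3)) u hu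
    rw [g2, hsm _ (Function.ne_iff.mpr ⟨i, right_ne_zero_of_mul h3⟩) (hY.map ξ3)] at g1
    have g3 : TanI I (fun i => ξ2 (Y i)) ⊓ LinearMap.ker (lamLin h) = TanI I (fun i => ξ2 (Y i)) := by
      apply Submodule.eq_of_le_of_finrank_le inf_le_left
      rw [hsm _ hy2 (hY.map ξ2)]; exact g1
    intro u hu
    rw [← g3] at hu
    exact hu.2
  obtain ⟨f, hf, hfh⟩ := dual_form key
  obtain ⟨w, hw⟩ := taylor f Y (cst T v) u
  have e1 : (fun i => Y i + u * cst T v i) = X := by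
    funext i
    have := congrFun id2 i
    simp only [Pi.sub_apply, Pi.smul_apply, smul_eq_mul] at this
    rw [← this]; ring
  rw [e1, hX f hf, hY f hf] at hw
  have e4 : u * (∑ i, aeval Y (pderiv i f) * cst T v i + u * w) = 0 := by linear_combination -hw
  have hu0 : u ≠ 0 := by rintro rfl; simp at hu1
  have e5 := congrArg ξ2 ((mul_eq_zero.mp e4).resolve_left hu0)
  simp only [map_add, map_sum, map_mul, comp_aeval_apply, ae_ev, hfh, hu2, cst, AlgHom.commutes, zero_mul, add_zero, map_zero] at e5
  apply hhv
  rw [lam_ℂ]; exact e5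

lemma zak {r m : ℕ} {Y : Set (Pr r)} (hcl : IsClosed Y) (hne : Y.Nonempty) [(idealOf Y).IsPrime] (hsm : IsSmoothSet Y) (hnd : NondegenerateSet Y)
    (hdim : pdim Y = ((m : ℕ∞) : WithBot ℕ∞)) (hN : 2 * r = 3 * m + 2) : secantVariety Y = univ := by
  by_contra hproj
  obtain ⟨G, d, hG, hG0, -, hS⟩ := secant_poly (by omega) hcl hnd hproj
  have hI := homI_idealOf Y
  have h0 : OnC (idealOf Y) (0 : Fin (r+1) → ℂ) := by
    obtain ⟨x, hx⟩ := hne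
    exact onC_zero hI (onC_rep hx)
  obtain ⟨F, d, hF, hFS, i, hi⟩ := min_F h0 hG hG0 hS
  obtain ⟨a, b, ha, hb, hab, hf⟩ := pick_ab hi (cc_not hI h0 (nd_form hnd) hG0 hS)
  exact zak_aux hI (nd_form hnd) (td_ge hcl hdim) (fun v hv0 hv => (smooth_data hcl hsm hdim hv0 hv).1) (by omega) hF hFS ha hb hab rfl
    (Function.ne_iff.mpr ⟨i, hf⟩)

section
open TensorProduct

lemma amalgam_field (K L0 L1 : Type) [Field K] [Field L0] [Field L1] (i0 : K →+* L0) (i1 : K →+* L1) :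
    ∃ (Ω : Type) (_ : Field Ω) (j0 : L0 →+* Ω) (j1 : L1 →+* Ω), ∀ x, j0 (i0 x) = j1 (i1 x) := by
  let := i0.toAlgebra
  let := i1.toAlgebra
  obtain ⟨M, hM⟩ := Ideal.exists_maximal (L0 ⊗[K] L1)
  refine ⟨(L0 ⊗[K] L1) ⧸ M, Ideal.Quotient.field M,
    (Ideal.Quotient.mk M).comp (Algebra.TensorProduct.includeLeft : L0 →ₐ[K] L0 ⊗[K] L1).toRingHom,
    (Ideal.Quotient.mk M).comp (Algebra.TensorProduct.includeRight : L1 →ₐ[K] L0 ⊗[K] L1).toRingHom, fun x => ?_⟩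
  change Ideal.Quotient.mk M ((Algebra.TensorProduct.includeLeft : L0 →ₐ[K] L0 ⊗[K] L1) (algebraMap K L0 x)) =
    Ideal.Quotient.mk M ((Algebra.TensorProduct.includeRight : L1 →ₐ[K] L0 ⊗[K] L1) (algebraMap K L1 x))
  rw [AlgHom.commutes, AlgHom.commutes]

/-- a finitely generated domain from homs into a field -/
lemma ft_field {E A0 A1 Ω : Type} [CommRing E] [Algebra ℂ E]
    [CommRing A0] [Algebra ℂ A0] [Algebra.FiniteType ℂ A0]
    [CommRing A1] [Algebra ℂ A1] [Algebra.FiniteType ℂ A1] [Field Ω]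
    (f0 : E →ₐ[ℂ] A0) (f1 : E →ₐ[ℂ] A1) (j0 : A0 →+* Ω) (j1 : A1 →+* Ω) (hj : ∀ x, j0 (f0 x) = j1 (f1 x)) :
    ∃ (D : Type) (_ : CommRing D) (_ : IsDomain D) (_ : Algebra ℂ D) (_ : Algebra.FiniteType ℂ D)
      (g0 : A0 →ₐ[ℂ] D) (g1 : A1 →ₐ[ℂ] D) (v : D →+* Ω), Function.Injective v ∧ (∀ x, g0 (f0 x) = g1 (f1 x)) ∧
      (∀ x, v (g0 x) = j0 x) ∧ (∀ x, v (g1 x) = j1 x) := by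
  let : Algebra ℂ Ω := (j0.comp (algebraMap ℂ A0)).toAlgebra
  let J0 : A0 →ₐ[ℂ] Ω := { j0 with commutes' := fun c => rfl }
  have hJ1 : ∀ c, j1 (algebraMap ℂ A1 c) = j0 (algebraMap ℂ A0 c) := fun c => by
    rw [← f1.commutes, ← f0.commutes, hj]
  let J1 : A1 →ₐ[ℂ] Ω := { j1 with commutes' := hJ1 }
  let D : Subalgebra ℂ Ω := J0.range ⊔ J1.range
  have hft : Algebra.FiniteType ℂ D := by
    apply D.fg_iff_finiteType.mp
    apply Subalgebra.FG.sup
    · rw [Subalgebra.fg_iff_finiteType]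
      exact Algebra.FiniteType.of_surjective J0.rangeRestrict J0.rangeRestrict_surjective
    · rw [Subalgebra.fg_iff_finiteType]
      exact Algebra.FiniteType.of_surjective J1.rangeRestrict J1.rangeRestrict_surjective
  refine ⟨D, inferInstance, inferInstance, inferInstance, hft,
    J0.codRestrict D (fun x => (le_sup_left : J0.range ≤ D) ⟨x, rfl⟩),
    J1.codRestrict D (fun x => (le_sup_right : J1.range ≤ D) ⟨x, rfl⟩), D.val.toRingHom, Subtype.val_injective, ?_, fun x => rfl, fun x => rfl⟩
  intro x
  exact Subtype.ext (hj x)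

lemma frac_map {E A : Type} [CommRing E] [IsDomain E] [CommRing A] [IsDomain A] (f : E →+* A) (hf : Function.Injective f) :
    ∃ i : FractionRing E →+* FractionRing A, ∀ x, i (algebraMap E _ x) = algebraMap A _ (f x) := by
  have h : Function.Injective ((algebraMap A (FractionRing A)).comp f) :=
    (IsFractionRing.injective A (FractionRing A)).comp hf
  exact ⟨IsFractionRing.lift h, fun x => IsFractionRing.lift_algebraMap h x⟩

lemma amalgam {E A0 A1 : Type} [CommRing E] [IsDomain E] [Algebra ℂ E]
    [CommRing A0] [IsDomain A0] [Algebra ℂ A0] [Algebra.FiniteType ℂ A0]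
    [CommRing A1] [IsDomain A1] [Algebra ℂ A1] [Algebra.FiniteType ℂ A1]
    (f0 : E →ₐ[ℂ] A0) (f1 : E →ₐ[ℂ] A1) (h0 : Function.Injective f0) (h1 : Function.Injective f1) :
    ∃ (D : Type) (_ : CommRing D) (_ : IsDomain D) (_ : Algebra ℂ D) (_ : Algebra.FiniteType ℂ D)
      (g0 : A0 →ₐ[ℂ] D) (g1 : A1 →ₐ[ℂ] D), (∀ x, g0 (f0 x) = g1 (f1 x)) ∧ Function.Injective g0 ∧ Function.Injective g1 := by
  obtain ⟨i0, hi0⟩ := frac_map f0.toRingHom h0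
  obtain ⟨i1, hi1⟩ := frac_map f1.toRingHom h1
  obtain ⟨Ω, _, j0, j1, hj⟩ := amalgam_field _ _ _ i0 i1
  obtain ⟨D, a, b, c, d, g0, g1, v, hv, h2, h3, h4⟩ := ft_field f0 f1 (j0.comp (algebraMap A0 _)) (j1.comp (algebraMap A1 _))
    (fun x => by
      have := hj (algebraMap E _ x)
      rw [hi0, hi1] at this
      exact this)
  refine ⟨D, a, b, c, d, g0, g1, h2, ?_, ?_⟩
  · apply Function.Injective.of_comp (f := v)
    have : v ∘ g0 = (j0.comp (algebraMap A0 _)) := funext h3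
    rw [this]
    exact j0.injective.comp (IsFractionRing.injective A0 (FractionRing A0))
  · apply Function.Injective.of_comp (f := v)
    have : v ∘ g1 = (j1.comp (algebraMap A1 _)) := funext h4
    rw [this]
    exact j1.injective.comp (IsFractionRing.injective A1 (FractionRing A1))

lemma loc_away {D : Type} [CommRing D] [IsDomain D] [Algebra ℂ D] [Algebra.FiniteType ℂ D] {d : D} (hd : d ≠ 0) :
    ∃ (W : Type) (_ : CommRing W) (_ : IsDomain W) (_ : Algebra ℂ W) (_ : Algebra.FiniteType ℂ W)
      (ι : D →ₐ[ℂ] W) (x : W), Function.Injective ι ∧ ι d * x = 1 := by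
  let W := Localization.Away d
  have : IsDomain W := IsLocalization.isDomain_localization (powers_le_nonZeroDivisors_of_noZeroDivisors hd)
  have : Algebra.FiniteType ℂ W := Algebra.FiniteType.trans (S := D) inferInstance inferInstance
  let ι : D →ₐ[ℂ] W := IsScalarTower.toAlgHom ℂ D W
  have hι : Function.Injective ι := IsLocalization.injective W (powers_le_nonZeroDivisors_of_noZeroDivisors hd)
  obtain ⟨x, hx⟩ := (IsLocalization.Away.algebraMap_isUnit (S := W) d).exists_right_inv
  exact ⟨W, inferInstance, inferInstance, inferInstance, inferInstance, ι, x, hι, hx⟩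

lemma conj_field0 (K L Ω : Type) [Field K] [CharZero K] [Field L] [Field Ω] [IsAlgClosed Ω] [Algebra K L] [Algebra K Ω] (t : L)
    (hintK : IsIntegral K t) (hdeg : ¬ (minpoly K t).natDegree = 1) (u : Ω) :
    ∃ u' : Ω, Polynomial.eval₂ (algebraMap K Ω) u' (minpoly K t) = 0 ∧ u' ≠ u := by
  have hirr := minpoly.irreducible hintK
  have hsep : (minpoly K t).Separable := hirr.separable
  have hsp : ((minpoly K t).map (algebraMap K Ω)).Splits := IsAlgClosed.splits _
  have hc := Polynomial.card_rootSet_eq_natDegree hsep hsp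
  have hpos := minpoly.natDegree_pos hintK
  have h2 : 1 < Fintype.card ((minpoly K t).rootSet Ω) := by omega
  rw [Fintype.one_lt_card_iff_nontrivial] at h2
  by_contra! hcon
  obtain ⟨a, b, hab⟩ := h2
  have e : ∀ a : (minpoly K t).rootSet Ω, a.1 = u := fun a =>
    hcon a.1 ((Polynomial.mem_rootSet.mp a.2).2)
  exact hab (Subtype.ext ((e a).trans (e b).symm))

lemma conj_field (K L : Type) [Field K] [CharZero K] [Field L] [Algebra K L] (t : L)
    (hintK : IsIntegral K t) (hdeg : ¬ (minpoly K t).natDegree = 1) :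
    ∃ (Ω : Type) (_ : Field Ω) (j0 j1 : L →+* Ω), (∀ x, j0 (algebraMap K L x) = j1 (algebraMap K L x)) ∧ j0 t ≠ j1 t := by
  have hirr := minpoly.irreducible hintK
  obtain ⟨Ω, _, _, i, -⟩ : ∃ (Ω : Type) (_ : Field Ω) (_ : IsAlgClosed Ω) (i : L →+* Ω), True :=
    ⟨AlgebraicClosure L, inferInstance, inferInstance, algebraMap _ _, trivial⟩
  let : Algebra K Ω := (i.comp (algebraMap K L)).toAlgebra
  obtain ⟨u', hu', hne⟩ := conj_field0 K L Ω t hintK hdeg (i t)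
  have : Fact (Irreducible (minpoly K t)) := ⟨hirr⟩
  let m0 : AdjoinRoot (minpoly K t) →+* Ω := AdjoinRoot.lift (algebraMap K Ω) u' hu'
  let m1 : AdjoinRoot (minpoly K t) →+* L := AdjoinRoot.lift (algebraMap K L) t (minpoly.aeval K t)
  obtain ⟨Ω', _, j0, j1, hj⟩ := amalgam_field _ _ _ m0 m1
  refine ⟨Ω', inferInstance, j0.comp i, j1, fun x => ?_, ?_⟩
  · have := hj (AdjoinRoot.of _ x)
    have e0 : m0 (AdjoinRoot.of _ x) = i (algebraMap K L x) := AdjoinRoot.lift_of _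
    have e1 : m1 (AdjoinRoot.of _ x) = algebraMap K L x := AdjoinRoot.lift_of _
    rw [e0, e1] at this
    exact this
  · have := hj (AdjoinRoot.root _)
    have e0 : m0 (AdjoinRoot.root _) = u' := AdjoinRoot.lift_root _
    have e1 : m1 (AdjoinRoot.root _) = t := AdjoinRoot.lift_root _
    rw [e0, e1] at this
    rw [← this]
    intro h
    exact hne (j0.injective h).symm

lemma conj_lemma {N : ℕ} {A : Type} [CommRing A] [IsDomain A] [Algebra ℂ A] [Algebra.FiniteType ℂ A]
    (φ : MP N →ₐ[ℂ] A) (hφ : Function.Injective φ) (θ : A) (hθ : φ.toRingHom.IsIntegralElem θ) :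
    (∃ p, θ = φ p) ∨ ∃ g : MP N, g ≠ 0 ∧ ∀ z : Fin N → ℂ, eval z g ≠ 0 → ∃ ξ0 ξ1 : A →ₐ[ℂ] ℂ,
      (∀ p, ξ0 (φ p) = eval z p) ∧ (∀ p, ξ1 (φ p) = eval z p) ∧ ξ0 θ ≠ ξ1 θ := by
  obtain ⟨i, hi⟩ := frac_map φ.toRingHom hφ
  let : Algebra (FractionRing (MP N)) (FractionRing A) := i.toAlgebra
  set K := FractionRing (MP N)
  set L := FractionRing A
  let t : L := algebraMap A L θ
  have hint : ((algebraMap K L).comp (algebraMap (MP N) K)).IsIntegralElem t := by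
    obtain ⟨p, hp, hp2⟩ := hθ
    refine ⟨p, hp, ?_⟩
    have : (algebraMap K L).comp (algebraMap (MP N) K) = (algebraMap A L).comp φ.toRingHom := RingHom.ext hi
    rw [this, ← Polynomial.hom_eval₂, hp2, map_zero]
  have hintK : IsIntegral K t := by
    obtain ⟨p, hp, hp2⟩ := hint
    exact ⟨p.map (algebraMap (MP N) K), hp.map _, by rwa [Polynomial.eval₂_map]⟩
  by_cases hdeg : (minpoly K t).natDegree = 1
  · left
    rw [minpoly.natDegree_eq_one_iff] at hdeg
    obtain ⟨k, hk⟩ := hdeg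
    have hk2 : IsIntegral (MP N) k := by
      obtain ⟨p, hp, hp2⟩ := hint
      refine ⟨p, hp, ?_⟩
      rw [← hk, ← Polynomial.hom_eval₂] at hp2
      exact (map_eq_zero _).mp hp2
    obtain ⟨p, rfl⟩ := IsIntegrallyClosed.isIntegral_iff.mp hk2
    refine ⟨p, ?_⟩
    apply IsFractionRing.injective A L
    exact hk.symm.trans (hi p)
  · right
    obtain ⟨Ω', _, j0, j1, hK, hne⟩ := conj_field K L t hintK hdeg
    obtain ⟨D, _, _, _, _, g0, g1, v, hv, h2, h3, h4⟩ := ft_field φ φ (j0.comp (algebraMap A L)) (j1.comp (algebraMap A L))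
      (fun x => by
        have := hK (algebraMap _ _ x)
        have e : algebraMap K L (algebraMap (MP N) K x) = algebraMap A L (φ x) := hi x
        rw [e] at this
        exact this)
    have hd : g0 θ - g1 θ ≠ 0 := by
      intro h
      rw [sub_eq_zero] at h
      have e := congrArg v h
      rw [h3, h4] at e
      exact hne e
    obtain ⟨W, _, _, _, _, ι, x, hι, hx⟩ := loc_away hd
    have hg0 : Function.Injective g0 := by
      apply Function.Injective.of_comp (f := v)
      have : v ∘ g0 = (j0.comp (algebraMap A L)) := funext h3
      rw [this]
      exact j0.injective.comp (IsFractionRing.injective A L)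
    obtain ⟨g, hgn, hg⟩ := chevalley (ι.comp (g0.comp φ)) (hι.comp (hg0.comp hφ))
    refine ⟨g, hgn, fun z hz => ?_⟩
    obtain ⟨η, hη⟩ := hg (aeval z) (by simpa [aeval_eq_eval] using hz)
    refine ⟨η.comp (ι.comp g0), η.comp (ι.comp g1), fun p => ?_, fun p => ?_, ?_⟩
    · simpa [aeval_eq_eval] using hη p
    · change η (ι (g1 (φ p))) = _
      rw [← h2]
      simpa [aeval_eq_eval] using hη p
    · change η (ι (g0 θ)) ≠ η (ι (g1 θ))
      rw [← sub_ne_zero, ← map_sub, ← map_sub]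
      intro h
      have := congrArg η hx
      rw [map_mul, h, zero_mul, map_one] at this
      exact zero_ne_one this
end



def SurjAt {n N : ℕ} (I : Ideal (MP n)) (w : Fin N × Fin n → ℂ) (z : Fin N → ℂ) : Prop :=
  ∀ x y : Fin n → ℂ, OnC I x → OnC I y → LD w x + LD w y = z → ∀ u, ∃ a ∈ TanI I x, ∃ b ∈ TanI I y, LD w a + LD w b = u

def TriAt {n N : ℕ} (I : Ideal (MP n)) (w : Fin N × Fin n → ℂ) (z : Fin N → ℂ) : Prop :=
  ∀ (x y v : Fin n → ℂ) (β : ℂ), OnC I x → OnC I y → OnC I v → LD w x + LD w y = z → LD w x + β • LD w y = LD w v →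
    ∀ u, ∃ a ∈ TanI I x, ∃ b ∈ TanI I y, ∃ c ∈ TanI I v, ∃ e : ℂ,
      LD w a + β • LD w b + e • LD w y = LD w c ∧ LD w a + LD w b = u

lemma gen_surj {n N : ℕ} (I : Ideal (MP n)) [I.IsPrime] (w : Fin N × Fin n → ℂ) :
    ∃ G : MP N, G ≠ 0 ∧ ∀ z, eval z G ≠ 0 → SurjAt I w z := by
  obtain ⟨A, _, _, _, _, i, j, hA, -, -⟩ := prod_alg (MP n ⧸ I) (MP n ⧸ I)
  have hX := (onC_xq I).map i
  have hY := (onC_xq I).map j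
  set X : Fin n → A := fun k => i (xq I k)
  set Y : Fin n → A := fun k => j (xq I k)
  obtain ⟨G, hG0, hG⟩ := generic_smooth (LD w (X + Y))
  refine ⟨G, hG0, fun z hz x y hx hy hxy u => ?_⟩
  obtain ⟨ξ, h1, h2⟩ := hA ℂ (hq hx) (hq hy)
  have eX : (fun k => ξ (X k)) = x := by funext k; simp only [X, h1, hq_xq]
  have eY : (fun k => ξ (Y k)) = y := by funext k; simp only [Y, h2, hq_xq]
  have ez : (fun k => ξ (LD w (X + Y) k)) = z := by
    funext k
    rw [LD_add, Pi.add_apply, map_add, LD_map, LD_map, eX, eY, ← hxy, Pi.add_apply]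
  obtain ⟨D, hD, hDu⟩ := hG ξ (by rw [ez]; exact hz) u
  have t1 := pder_TanI hX hD
  have t2 := pder_TanI hY hD
  rw [eX] at t1
  rw [eY] at t2
  refine ⟨_, t1, _, t2, ?_⟩
  funext k
  rw [← hDu k, LD_add, Pi.add_apply, Pi.add_apply, map_add, LD_map', LD_map']

lemma gen_tri {n N : ℕ} (I : Ideal (MP n)) [I.IsPrime] (w : Fin N × Fin n → ℂ) :
    ∃ G : MP N, G ≠ 0 ∧ ∀ z, eval z G ≠ 0 → TriAt I w z := by
  obtain ⟨A, _, _, _, _, i, j, hA, -, -⟩ := prod_alg (MP n ⧸ I) (MP n ⧸ I)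
  obtain ⟨A2, _, _, _, _, i2, j2, hA2, -, -⟩ := prod_alg A (MP n ⧸ I)
  obtain ⟨A3, _, _, _, _, i3, j3, hA3, -, -⟩ := prod_alg A2 (Polynomial ℂ)
  let J : Ideal A3 := Ideal.span (Set.range fun k => LD w (fun k => i3 (i2 (i (xq I k)))) k +
    j3 Polynomial.X * LD w (fun k => i3 (i2 (j (xq I k)))) k - LD w (fun k => i3 (j2 (xq I k))) k)
  let q : A3 →ₐ[ℂ] A3 ⧸ J := Ideal.Quotient.mkₐ ℂ J
  have hX := (onC_xq I).map (q.comp (i3.comp (i2.comp i)))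
  have hY := (onC_xq I).map (q.comp (i3.comp (i2.comp j)))
  have hV := (onC_xq I).map (q.comp (i3.comp j2))
  set X : Fin n → A3 ⧸ J := fun k => (q.comp (i3.comp (i2.comp i))) (xq I k)
  set Y : Fin n → A3 ⧸ J := fun k => (q.comp (i3.comp (i2.comp j))) (xq I k)
  set V : Fin n → A3 ⧸ J := fun k => (q.comp (i3.comp j2)) (xq I k)
  let bb : A3 ⧸ J := q (j3 Polynomial.X)
  have rel : ∀ k, LD w X k + bb * LD w Y k = LD w V k := by
    intro k
    have h : q (LD w (fun k => i3 (i2 (i (xq I k)))) k +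
      j3 Polynomial.X * LD w (fun k => i3 (i2 (j (xq I k)))) k - LD w (fun k => i3 (j2 (xq I k))) k) = 0 :=
      Ideal.Quotient.eq_zero_iff_mem.mpr (Ideal.subset_span ⟨k, rfl⟩)
    rw [map_sub, map_add, map_mul, LD_map, LD_map, LD_map, sub_eq_zero] at h
    exact h
  have : Algebra.FiniteType ℂ (A3 ⧸ J) := Algebra.FiniteType.of_surjective q Ideal.Quotient.mk_surjective
  obtain ⟨G, hG0, hG⟩ := generic_smooth (LD w (X + Y))
  refine ⟨G, hG0, fun z hz x y v β hx hy hv hxy hxv u => ?_⟩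
  obtain ⟨ξ1, h1, h2⟩ := hA ℂ (hq hx) (hq hy)
  obtain ⟨ξ2, h3, h4⟩ := hA2 ℂ ξ1 (hq hv)
  obtain ⟨ξ3, h5, h6⟩ := hA3 ℂ ξ2 (Polynomial.aeval β)
  have hJ : ∀ a ∈ J, ξ3 a = 0 := by
    intro a ha
    have : J ≤ RingHom.ker ξ3 := by
      refine Ideal.span_le.mpr ?_
      rintro _ ⟨k, rfl⟩
      change ξ3 _ = 0
      rw [map_sub, map_add, map_mul, LD_map, LD_map, LD_map]
      simp only [h6, h5, h4, h3, h1, h2, hq_xq, Polynomial.aeval_X]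
      have := congrFun hxv k
      simp only [Pi.add_apply, Pi.smul_apply, smul_eq_mul] at this
      rw [← this]; ring
    exact this ha
  let ξ : A3 ⧸ J →ₐ[ℂ] ℂ := Ideal.Quotient.liftₐ J ξ3 hJ
  have hξ : ∀ a, ξ (q a) = ξ3 a := fun a => rfl
  have eX : (fun k => ξ (X k)) = x := by
    funext k; simp only [X, AlgHom.comp_apply, hξ, h5, h3, h1, hq_xq]
  have eY : (fun k => ξ (Y k)) = y := by
    funext k; simp only [Y, AlgHom.comp_apply, hξ, h5, h3, h2, hq_xq]
  have eV : (fun k => ξ (V k)) = v := by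
    funext k; simp only [V, AlgHom.comp_apply, hξ, h5, h4, hq_xq]
  have eb : ξ bb = β := by simp only [bb, hξ, h6, Polynomial.aeval_X]
  have ez : (fun k => ξ (LD w (X + Y) k)) = z := by
    funext k
    rw [LD_add, Pi.add_apply, map_add, LD_map, LD_map, eX, eY, ← hxy, Pi.add_apply]
  obtain ⟨D, hD, hDu⟩ := hG ξ (by rw [ez]; exact hz) u
  have t1 := pder_TanI hX hD
  have t2 := pder_TanI hY hD
  have t3 := pder_TanI hV hD
  rw [eX] at t1
  rw [eY] at t2
  rw [eV] at t3
  refine ⟨_, t1, _, t2, _, t3, D bb, ?_, ?_⟩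
  · funext k
    have := congrArg D (rel k)
    rw [map_add, PDer.mul hD, LD_map', LD_map', LD_map', LD_map, eY, eb] at this
    rw [← this]
    simp only [Pi.add_apply, Pi.smul_apply, smul_eq_mul]; ring
  · funext k
    rw [← hDu k, LD_add, Pi.add_apply, Pi.add_apply, map_add, LD_map', LD_map']

lemma pder_ext_gen {B σ : Type} [CommRing B] [Algebra ℂ B] {ξ : B →ₐ[ℂ] ℂ} {D : B →ₗ[ℂ] ℂ} (hD : D ∈ PDer ξ) {x : σ → B}
    (hgen : ∀ U : Subalgebra ℂ B, (∀ i, x i ∈ U) → U = ⊤) (h : ∀ i, D (x i) = 0) : D = 0 := by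
  let U : Subalgebra ℂ B :=
    { carrier := {b | D b = 0}
      add_mem' := fun {a b} ha hb => by
        have h1 : D a = 0 := ha
        have h2 : D b = 0 := hb
        change D (a + b) = 0
        rw [map_add, h1, h2, add_zero]
      mul_mem' := fun {a b} ha hb => by
        have h1 : D a = 0 := ha
        have h2 : D b = 0 := hb
        change D (a * b) = 0
        rw [PDer.mul hD, h1, h2]; simp
      algebraMap_mem' := fun c => PDer.const hD c }
  have := hgen U h
  ext b
  have hb : b ∈ U := by rw [this]; trivial
  exact hb

def LDl {n N : ℕ} (w : Fin N × Fin n → ℂ) : (Fin n → ℂ) →ₗ[ℂ] (Fin N → ℂ) where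
  toFun := LD w
  map_add' := LD_add w
  map_smul' := fun c x => LD_smul w c x

lemma fib_td {n N m : ℕ} {I : Ideal (MP n)} {w : Fin N × Fin n → ℂ} {z : Fin N → ℂ}
    (hT : ∀ v : Fin n → ℂ, v ≠ 0 → OnC I v → Module.finrank ℂ (TanI I v) = m + 1)
    (hs : SurjAt I w z) (hz : ∀ x : Fin n → ℂ, OnC I x → LD w x ≠ z)
    {B : Type} [CommRing B] [IsDomain B] [Algebra ℂ B] [Algebra.FiniteType ℂ B] {X Y : Fin n → B}
    (hX : OnC I X) (hY : OnC I Y) (hXY : LD w X + LD w Y = cst B z)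
    (hgen : ∀ U : Subalgebra ℂ B, (∀ k, X k ∈ U) → (∀ k, Y k ∈ U) → U = ⊤) : td B + N ≤ 2 * (m + 1) := by
  obtain ⟨ξ, -⟩ := exists_pt (⊥ : Ideal B) bot_ne_top
  have hx := hX.map ξ
  have hy := hY.map ξ
  set x := fun k => ξ (X k) with ex
  set y := fun k => ξ (Y k) with ey
  have hxy : LD w x + LD w y = z := by
    funext k
    have := congrArg ξ (congrFun hXY k)
    rw [Pi.add_apply, map_add, LD_map, LD_map] at this
    rw [Pi.add_apply, this]; simp [cst]
  have hx0 : x ≠ 0 := by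
    intro h
    apply hz y hy
    rw [← hxy, h]; funext k; simp [LD]
  have hy0 : y ≠ 0 := by
    intro h
    apply hz x hx
    rw [← hxy, h]; funext k; simp [LD]
  let M : (TanI I x × TanI I y) →ₗ[ℂ] (Fin N → ℂ) :=
    LinearMap.coprod ((LDl w).comp (TanI I x).subtype) ((LDl w).comp (TanI I y).subtype)
  have hM : LinearMap.range M = ⊤ := by
    rw [LinearMap.range_eq_top]
    intro u
    obtain ⟨a, ha, b, hb, e⟩ := hs x y hx hy hxy u
    exact ⟨(⟨a, ha⟩, ⟨b, hb⟩), e⟩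
  have hrk := LinearMap.finrank_range_add_finrank_ker M
  rw [hM, finrank_top, Module.finrank_prod, hT x hx0 hx, hT y hy0 hy, Module.finrank_fin_fun] at hrk
  let ε : (TanI I x × TanI I y) →ₗ[ℂ] (Fin n ⊕ Fin n → ℂ) :=
    { toFun := fun p => Sum.elim p.1.1 p.2.1
      map_add' := fun p q => by funext k; rcases k with k | k <;> rfl
      map_smul' := fun p q => by funext k; rcases k with k | k <;> rfl }
  have h1 := td_le_finrank (ξ := ξ) (Sum.elim X Y) ((LinearMap.ker M).map ε) (fun D hD => by
      refine ⟨(⟨_, pder_TanI hX hD⟩, ⟨_, pder_TanI hY hD⟩), ?_, ?_⟩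
      · change LD w (fun k => D (X k)) + LD w (fun k => D (Y k)) = 0
        funext k
        have := congrArg D (congrFun hXY k)
        rw [Pi.add_apply, map_add, LD_map', LD_map'] at this
        rw [Pi.add_apply, this]
        exact PDer.const hD _
      · funext k; rcases k with k | k <;> rfl) (fun D hD h => by
      refine pder_ext_gen hD (fun U hU => hgen U (fun k => hU (Sum.inl k)) (fun k => hU (Sum.inr k))) h)
  have h2 := Submodule.finrank_map_le ε (LinearMap.ker M)
  omega


lemma lin_inj {V U : Type} [AddCommGroup V] [Module ℂ V] [FiniteDimensional ℂ V] [AddCommGroup U] [Module ℂ U] [FiniteDimensional ℂ U]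
    (M Q : V →ₗ[ℂ] U) (hM : Function.Surjective M) (hQ : ∀ u, ∃ p, M p = 0 ∧ Q p = u)
    (hd : Module.finrank ℂ V = 2 * Module.finrank ℂ U) (p : V) (h1 : M p = 0) (h2 : Q p = 0) : p = 0 := by
  have hs : Function.Surjective (M.prod Q) := by
    rintro ⟨u1, u2⟩
    obtain ⟨p1, e1⟩ := hM u1
    obtain ⟨p2, e2, e3⟩ := hQ (u2 - Q p1)
    refine ⟨p1 + p2, ?_⟩
    refine Prod.ext ?_ ?_
    · change M (p1 + p2) = u1
      rw [map_add, e1, e2, add_zero]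
    · change Q (p1 + p2) = u2
      rw [map_add, e3]; abel
  have hf : Module.finrank ℂ V = Module.finrank ℂ (U × U) := by rw [Module.finrank_prod]; omega
  have hi := (LinearMap.injective_iff_surjective_of_finrank_eq_finrank hf).mpr hs
  apply hi
  rw [map_zero]
  exact Prod.ext h1 h2

lemma tri_zero {n N m : ℕ} {I : Ideal (MP n)} {w : Fin N × Fin n → ℂ} {z : Fin N → ℂ}
    (hT : ∀ v : Fin n → ℂ, v ≠ 0 → OnC I v → Module.finrank ℂ (TanI I v) = m + 1) (hI : HomI I)
    (hs : SurjAt I w z) (ht : TriAt I w z) (hz : ∀ x : Fin n → ℂ, OnC I x → LD w x ≠ z) (hN : 2 * N = 3 * m + 4)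
    {x y v : Fin n → ℂ} {β : ℂ} (hβ : β ≠ 0) (hx : OnC I x) (hy : OnC I y) (hv : OnC I v) (hxy : LD w x + LD w y = z)
    (hxv : LD w x + β • LD w y = LD w v) {a b c : Fin n → ℂ} {e : ℂ} (ha : a ∈ TanI I x) (hb : b ∈ TanI I y) (hc : c ∈ TanI I v)
    (h1 : LD w a + β • LD w b + e • LD w y = LD w c) (h2 : LD w a + LD w b = 0) : a = 0 ∧ b = 0 ∧ c = 0 ∧ e = 0 := by
  have hx0 : x ≠ 0 := by
    intro h
    apply hz y hy
    rw [← hxy, h]; funext k; simp [LD]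
  have hy0 : y ≠ 0 := by
    intro h
    apply hz x hx
    rw [← hxy, h]; funext k; simp [LD]
  have hv0 : v ≠ 0 := by
    intro h
    apply hz _ (hy.smul hI (1 - β))
    rw [LD_smul, ← hxy]
    have e1 : LD w v = 0 := by rw [h]; funext k; simp [LD]
    rw [e1] at hxv
    rw [eq_neg_of_add_eq_zero_left hxv]
    module
  let M : ((TanI I x × TanI I y) × (TanI I v × ℂ)) →ₗ[ℂ] (Fin N → ℂ) :=
    LinearMap.coprod (LinearMap.coprod ((LDl w).comp (TanI I x).subtype) (β • (LDl w).comp (TanI I y).subtype))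
      (LinearMap.coprod (-(LDl w).comp (TanI I v).subtype) (LinearMap.toSpanSingleton ℂ _ (LD w y)))
  have hMv : ∀ a b c e, M ((a, b), (c, e)) = LD w a.1 + β • LD w b.1 + (- LD w c.1 + e • LD w y) := fun a b c e => rfl
  have hM : LinearMap.range M = ⊤ := by
    rw [LinearMap.range_eq_top]
    intro u
    obtain ⟨a, ha, b, hb, e⟩ := hs x y hx hy hxy u
    refine ⟨((⟨a, ha⟩, β⁻¹ • ⟨b, hb⟩), (0, 0)), ?_⟩
    rw [hMv, ← e]
    have e0 : LD w ((0 : TanI I v) : Fin n → ℂ) = 0 := by funext k; simp [LD]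
    have e2 : LD w ((β⁻¹ • (⟨b, hb⟩ : TanI I y) : TanI I y) : Fin n → ℂ) = β⁻¹ • LD w b := LD_smul w β⁻¹ b
    rw [e0, e2, smul_smul, mul_inv_cancel₀ hβ]
    module
  let Q : ((TanI I x × TanI I y) × (TanI I v × ℂ)) →ₗ[ℂ] (Fin N → ℂ) :=
    LinearMap.coprod (LinearMap.coprod ((LDl w).comp (TanI I x).subtype) ((LDl w).comp (TanI I y).subtype)) 0
  have hQv : ∀ a b c e, Q ((a, b), (c, e)) = LD w a.1 + LD w b.1 := fun a b c e => by
    change LD w a.1 + LD w b.1 + 0 = _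
    rw [add_zero]
  have hker : ∀ a b c e, M ((a, b), (c, e)) = 0 ↔ LD w a.1 + β • LD w b.1 + e • LD w y = LD w c.1 := by
    intro a b c e
    rw [hMv, ← sub_eq_zero (b := LD w c.1)]
    constructor
    · intro h; rw [← h]; module
    · intro h; rw [← h]; module
  have h3 := lin_inj M Q (LinearMap.range_eq_top.mp hM) (by
    intro u
    obtain ⟨a, ha, b, hb, c, hc, e, e1, e2⟩ := ht x y v β hx hy hv hxy hxv u
    exact ⟨((⟨a, ha⟩, ⟨b, hb⟩), (⟨c, hc⟩, e)), (hker _ _ _ _).mpr e1, e2 ▸ hQv _ _ _ _⟩)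
    (by rw [Module.finrank_prod, Module.finrank_prod, Module.finrank_prod, hT x hx0 hx, hT y hy0 hy, hT v hv0 hv, Module.finrank_fin_fun, Module.finrank_self]; omega)
    ((⟨a, ha⟩, ⟨b, hb⟩), (⟨c, hc⟩, e)) ((hker _ _ _ _).mpr h1) ((hQv _ _ _ _).trans h2)
  simp only [Prod.mk_eq_zero, Submodule.mk_eq_zero] at h3
  tauto

lemma td_zero_alg {B : Type} [CommRing B] [IsDomain B] [Algebra ℂ B] [Algebra.FiniteType ℂ B] (h : td B = 0) (b : B) : IsAlgebraic ℂ b := by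
  have h1 : Algebra.trdeg ℂ B = 0 := by rw [← td_cast, h]; simp
  have := (_root_.trdeg_eq_zero_iff (R := ℂ) (A := B)).mp h1
  exact this.isAlgebraic b

lemma tri_const1 {n N m : ℕ} {I : Ideal (MP n)} {w : Fin N × Fin n → ℂ} {z : Fin N → ℂ}
    (hT : ∀ v : Fin n → ℂ, v ≠ 0 → OnC I v → Module.finrank ℂ (TanI I v) = m + 1) (hI : HomI I)
    (hs : SurjAt I w z) (ht : TriAt I w z) (hz : ∀ x : Fin n → ℂ, OnC I x → LD w x ≠ z) (hN : 2 * N = 3 * m + 4)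
    {D : Type} [CommRing D] [IsDomain D] [Algebra ℂ D] [Algebra.FiniteType ℂ D] {X Y V : Fin n → D} {β : D}
    (hβ : β ≠ 0) (hX : OnC I X) (hY : OnC I Y) (hV : OnC I V) (hXY : LD w X + LD w Y = cst D z)
    (hXV : LD w X + β • LD w Y = LD w V) : ∃ x, X = cst D x := by
  let g : (Fin n ⊕ Fin n) ⊕ (Fin n ⊕ Unit) → D := Sum.elim (Sum.elim X Y) (Sum.elim V (fun _ => β))
  let B := Algebra.adjoin ℂ (Set.range g)
  have hft : Algebra.FiniteType ℂ B := B.fg_iff_finiteType.mp (by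
    have := Subalgebra.fg_adjoin_finset (R := ℂ) (Set.finite_range g).toFinset
    simpa [B] using this)
  let Z : (Fin n ⊕ Fin n) ⊕ (Fin n ⊕ Unit) → B := fun k => ⟨g k, Algebra.subset_adjoin ⟨k, rfl⟩⟩
  have hgen : ∀ U : Subalgebra ℂ B, (∀ k, Z k ∈ U) → U = ⊤ := by
    intro U hU
    have h1 : B ≤ U.map B.val := by
      apply Algebra.adjoin_le
      rintro _ ⟨k, rfl⟩
      exact ⟨Z k, hU k, rfl⟩
    rw [eq_top_iff]
    rintro a -
    obtain ⟨b, hb, e⟩ := h1 a.2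
    have : b = a := Subtype.ext e
    rwa [← this]
  let X' : Fin n → B := fun k => Z (.inl (.inl k))
  let Y' : Fin n → B := fun k => Z (.inl (.inr k))
  let V' : Fin n → B := fun k => Z (.inr (.inl k))
  let b' : B := Z (.inr (.inr ()))
  have hinj : ∀ {a b : B}, B.val a = B.val b → a = b := fun h => Subtype.ext h
  have back : ∀ x : Fin n → B, OnC I (fun k => B.val (x k)) → OnC I x := by
    intro x hx f hf
    apply hinj
    rw [comp_aeval_apply, map_zero]; exact hx f hf
  have hX' : OnC I X' := back _ hX
  have hY' : OnC I Y' := back _ hY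
  have hV' : OnC I V' := back _ hV
  have hXY' : LD w X' + LD w Y' = cst B z := by
    funext k; apply hinj
    rw [Pi.add_apply, map_add, LD_map, LD_map]
    exact congrFun hXY k
  have hXV' : ∀ k, LD w X' k + b' * LD w Y' k = LD w V' k := by
    intro k; apply hinj
    rw [map_add, map_mul, LD_map, LD_map, LD_map]
    exact congrFun hXV k
  have hb' : b' ≠ 0 := fun h => hβ (congrArg B.val h)
  obtain ⟨ξ, hξ⟩ : ∃ ξ : B →ₐ[ℂ] ℂ, ξ b' ≠ 0 := by
    by_contra! hc
    exact hb' (eq_zero_of_pts hc)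
  have t0 : td B = 0 := by
    apply td_zero_of_pder (ξ := ξ)
    intro E hE
    have e1 : LD w (fun k => ξ (X' k)) + LD w (fun k => ξ (Y' k)) = z := by
      funext k
      have := congrArg ξ (congrFun hXY' k)
      rw [Pi.add_apply, map_add, LD_map, LD_map] at this
      rw [Pi.add_apply, this]; simp [cst]
    have e2 : LD w (fun k => ξ (X' k)) + ξ b' • LD w (fun k => ξ (Y' k)) = LD w (fun k => ξ (V' k)) := by
      funext k
      have := congrArg ξ (hXV' k)
      rw [map_add, map_mul, LD_map, LD_map, LD_map] at this
      exact this
    have e3 : LD w (fun k => E (X' k)) + LD w (fun k => E (Y' k)) = 0 := by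
      funext k
      have := congrArg E (congrFun hXY' k)
      rw [Pi.add_apply, map_add, LD_map', LD_map'] at this
      rw [Pi.add_apply, this]
      exact PDer.const hE _
    have e4 : LD w (fun k => E (X' k)) + ξ b' • LD w (fun k => E (Y' k)) + E b' • LD w (fun k => ξ (Y' k)) = LD w (fun k => E (V' k)) := by
      funext k
      have := congrArg E (hXV' k)
      rw [map_add, PDer.mul hE, LD_map', LD_map', LD_map', LD_map] at this
      rw [← this]
      simp only [Pi.add_apply, Pi.smul_apply, smul_eq_mul]; ring
    obtain ⟨z1, z2, z3, z4⟩ := tri_zero hT hI hs ht hz hN hξ (hX'.map ξ) (hY'.map ξ) (hV'.map ξ) e1 e2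
      (pder_TanI hX' hE) (pder_TanI hY' hE) (pder_TanI hV' hE) e4 e3
    apply pder_ext_gen hE hgen
    rintro ((k | k) | (k | k))
    · exact congrFun z1 k
    · exact congrFun z2 k
    · exact congrFun z3 k
    · exact z4
  refine ⟨fun k => ξ (X' k), ?_⟩
  funext k
  have := alg_const ξ (td_zero_alg t0 (X' k))
  exact congrArg B.val this

lemma tri_const {n N m : ℕ} {I : Ideal (MP n)} {w : Fin N × Fin n → ℂ} {z : Fin N → ℂ}
    (hT : ∀ v : Fin n → ℂ, v ≠ 0 → OnC I v → Module.finrank ℂ (TanI I v) = m + 1) (hI : HomI I)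
    (hs : SurjAt I w z) (ht : TriAt I w z) (hz : ∀ x : Fin n → ℂ, OnC I x → LD w x ≠ z) (hN : 2 * N = 3 * m + 4)
    {D : Type} [CommRing D] [IsDomain D] [Algebra ℂ D] [Algebra.FiniteType ℂ D] {X Y V : Fin n → D} {α β : D}
    (hα : α ≠ 0) (hβ : β ≠ 0) (hX : OnC I X) (hY : OnC I Y) (hV : OnC I V) (hXY : LD w X + LD w Y = cst D z)
    (hXV : α • LD w X + β • LD w Y = LD w V) : ∃ x, X = cst D x := by
  obtain ⟨W, _, _, _, _, ι, a, hι, ha⟩ := loc_away hα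
  have ha0 : a ≠ 0 := by rintro rfl; simp at ha
  have hb0 : ι β ≠ 0 := by rw [← map_zero ι]; exact fun h => hβ (hι h)
  obtain ⟨x, hx⟩ := tri_const1 hT hI hs ht hz hN (mul_ne_zero ha0 hb0) (hX.map ι) (hY.map ι) ((hV.map ι).smul hI a)
    (by
      funext k
      have := congrArg ι (congrFun hXY k)
      rw [Pi.add_apply, map_add, LD_map, LD_map] at this
      rw [Pi.add_apply, this]; simp [cst])
    (by
      funext k
      have := congrArg ι (congrFun hXV k)
      simp only [Pi.add_apply, Pi.smul_apply, smul_eq_mul, map_add, map_mul, LD_map] at this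
      rw [LD_smul]
      simp only [Pi.add_apply, Pi.smul_apply, smul_eq_mul, ← this]
      linear_combination (- LD w (fun j => ι (X j)) k) * ha)
  refine ⟨x, ?_⟩
  funext k
  apply hι
  have := congrFun hx k
  rw [this]; simp [cst]


lemma phi_inj {r : ℕ} {w : Fin (r+1) × Fin (r+2) → ℂ} {Z : Set (Pr (r+1))} (hne : Z.Nonempty)
    (hsec : secantVariety (projImage w Z) = univ) {f : MP (r+1)}
    (hf : ∀ x y : Fin (r+2) → ℂ, OnC (idealOf Z) x → OnC (idealOf Z) y → eval (LD w x + LD w y) f = 0) : f = 0 := by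
  have hI := homI_idealOf Z
  have h0 : OnC (idealOf Z) (0 : Fin (r+2) → ℂ) := by
    obtain ⟨x, hx⟩ := hne
    exact onC_zero hI (onC_rep hx)
  have h1 : f ∈ idealOf (secantVariety (projImage w Z)) := by
    rw [secantVariety, idealOf_closure, mem_idealOf]
    intro z hz
    simp only [Set.mem_iUnion] at hz
    obtain ⟨x, ⟨x1, hx1, c1, hc1, e1⟩, y, ⟨y1, hy1, c2, hc2, e2⟩, -, hz⟩ := hz
    intro v hv hvz
    obtain ⟨c, hc, rfl⟩ := (mk_eq_iff hv z).mp hvz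
    obtain ⟨a, b, hab⟩ := Submodule.mem_span_pair.mp hz
    have := hf _ _ ((onC_rep hx1).smul hI (c * a * c1)) ((onC_rep hy1).smul hI (c * b * c2))
    rw [LD_smul, LD_smul, LD_eq, LD_eq] at this
    rw [← hab, e1, e2, ← this]
    congr 2
    module
  rw [hsec, mem_idealOf] at h1
  apply MvPolynomial.funext
  intro v
  rw [map_zero]
  by_cases hv : v = 0
  · have := hf 0 0 h0 h0
    have e : LD w (0 : Fin (r+2) → ℂ) = 0 := by funext k; simp [LD]
    rw [e, add_zero] at this
    rw [hv]; exact this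
  · exact h1 _ (mem_univ _) v hv rfl

lemma no_section {n N : ℕ} {I : Ideal (MP n)} (hI : HomI I) (hnd : NDI I)
    {w : Fin N × Fin n → ℂ} {o : Fin n → ℂ} {S : Fin n × Fin N → ℂ} {l : Fin n → ℂ} (L : LinData w o S l) (p : MP N)
    (h : ∀ (D : Type) [CommRing D] [Algebra ℂ D] (x : Fin n → D), OnC I x → lam l x = aeval (LD w x) p) : False := by
  let a : Fin N → ℂ := fun k => eval 0 (pderiv k p)
  let φ : (Fin n → ℂ) →ₗ[ℂ] ℂ := lamLin l - (lamLin a).comp (LDl w)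
  have hφ : ∀ x, φ x = lam l x - lam a (LD w x) := fun x => rfl
  obtain ⟨g, hg⟩ := form_of_lin φ
  have hgo : lam g o = 1 := by
    rw [hg, hφ, L.lo, L.wo]; simp [lam]
  have hg0 : g ≠ 0 := by
    rintro rfl
    simp [lam] at hgo
  obtain ⟨x, hx, hgx⟩ := hnd g hg0
  apply hgx
  have h1 := h (DualNumber ℂ) _ ((onC_cst (D := DualNumber ℂ) hx).smul hI DualNumber.eps)
  rw [LD_smul, LD_cst, lam_smul, lam_cst] at h1
  have e : ((DualNumber.eps : DualNumber ℂ) • cst (DualNumber ℂ) (LD w x)) = dpt 0 (LD w x) := by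
    funext i
    apply TrivSqZeroExt.ext
    · simp [dpt, cst, TrivSqZeroExt.algebraMap_eq_inl]
    · simp [dpt, cst, TrivSqZeroExt.algebraMap_eq_inl]
  rw [e, aeval_dpt] at h1
  have h2 := congrArg TrivSqZeroExt.snd h1
  rw [hg, hφ, sub_eq_zero, lam_ℂ a]
  simpa [a, TrivSqZeroExt.algebraMap_eq_inl] using h2

lemma gen_conj {r d : ℕ} {w : Fin (r+1) × Fin (r+2) → ℂ} {Z : Set (Pr (r+1))} (hne : Z.Nonempty) [(idealOf Z).IsPrime]
    (hsec : secantVariety (projImage w Z) = univ) (hnd : NDI (idealOf Z))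
    {o : Fin (r+2) → ℂ} {S : Fin (r+2) × Fin (r+1) → ℂ} {l : Fin (r+2) → ℂ} (L : LinData w o S l)
    {F : MP (r+2)} (hF : F.IsHomogeneous d) (hFo : eval o F ≠ 0) (hS : SecF (idealOf Z) F) :
    ∃ g : MP (r+1), g ≠ 0 ∧ ∀ z, eval z g ≠ 0 → ∃ x0 y0 x1 y1 : Fin (r+2) → ℂ, OnC (idealOf Z) x0 ∧ OnC (idealOf Z) y0 ∧
      OnC (idealOf Z) x1 ∧ OnC (idealOf Z) y1 ∧ LD w x0 + LD w y0 = z ∧ LD w x1 + LD w y1 = z ∧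
      lam l (x0 + y0) ≠ lam l (x1 + y1) := by
  have hI := homI_idealOf Z
  set I := idealOf Z
  obtain ⟨A, _, _, _, _, i, j, hA, -, -⟩ := prod_alg (MP (r+2) ⧸ I) (MP (r+2) ⧸ I)
  have hX := (onC_xq I).map i
  have hY := (onC_xq I).map j
  set X : Fin (r+2) → A := fun k => i (xq I k)
  set Y : Fin (r+2) → A := fun k => j (xq I k)
  have h0 : OnC I (0 : Fin (r+2) → ℂ) := by
    obtain ⟨x, hx⟩ := hne
    exact onC_zero hI (onC_rep hx)
  have hint := lam_integral L hF hFo (F_add hS hX hY)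
  have hhom : ∀ (D : Type) [CommRing D] [Algebra ℂ D] (x y : Fin (r+2) → D), OnC I x → OnC I y →
      ∃ ξ : A →ₐ[ℂ] D, (fun k => ξ (X k)) = x ∧ (fun k => ξ (Y k)) = y := by
    intro D _ _ x y hx hy
    obtain ⟨ξ, h1, h2⟩ := hA D (hq hx) (hq hy)
    exact ⟨ξ, by funext k; simp only [X, h1, hq_xq], by funext k; simp only [Y, h2, hq_xq]⟩
  have hLD : ∀ {D : Type} [CommRing D] [Algebra ℂ D] (ξ : A →ₐ[ℂ] D), (fun k => ξ (LD w (X + Y) k)) =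
      LD w (fun k => ξ (X k)) + LD w (fun k => ξ (Y k)) := by
    intro D _ _ ξ
    funext k
    rw [LD_add, Pi.add_apply, map_add, LD_map, LD_map, Pi.add_apply]
  have hlam : ∀ {D : Type} [CommRing D] [Algebra ℂ D] (ξ : A →ₐ[ℂ] D), ξ (lam l (X + Y)) =
      lam l ((fun k => ξ (X k)) + (fun k => ξ (Y k))) := by
    intro D _ _ ξ
    rw [lam_map]
    congr 1
    funext k; simp
  rcases conj_lemma (aeval (LD w (X + Y)) : MP (r+1) →ₐ[ℂ] A) (by
      rw [injective_iff_map_eq_zero]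
      intro f hf
      apply phi_inj hne hsec
      intro x y hx hy
      obtain ⟨ξ, h1, h2⟩ := hhom ℂ x y hx hy
      have := congrArg ξ hf
      rw [comp_aeval_apply, hLD, h1, h2, map_zero, ae_ev] at this
      exact this) (lam l (X + Y)) hint with ⟨p, hp⟩ | ⟨g, hg0, hg⟩
  · exfalso
    refine no_section hI hnd L p ?_
    intro D _ _ x hx
    obtain ⟨ξ, h1, h2⟩ := hhom D x (cst D 0) hx (onC_cst h0)
    have := congrArg ξ hp
    have e0 : (cst D 0 : Fin (r+2) → D) = 0 := by funext k; simp [cst]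
    have e1 : LD w (0 : Fin (r+2) → D) = 0 := by funext k; simp [LD]
    rw [hlam, comp_aeval_apply, hLD, h1, h2, e0, e1, add_zero, add_zero] at this
    exact this
  · refine ⟨g, hg0, fun z hz => ?_⟩
    obtain ⟨ξ0, ξ1, h0, h1, hne⟩ := hg z hz
    have ez : ∀ ξ : A →ₐ[ℂ] ℂ, (∀ p, ξ (aeval (LD w (X + Y)) p) = eval z p) → LD w (fun k => ξ (X k)) + LD w (fun k => ξ (Y k)) = z := by
      intro ξ h
      rw [← hLD]
      funext k
      have := h (MvPolynomial.X k)
      rwa [aeval_X, eval_X] at this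
    refine ⟨_, _, _, _, hX.map ξ0, hY.map ξ0, hX.map ξ1, hY.map ξ1, ez _ h0, ez _ h1, ?_⟩
    rwa [← hlam, ← hlam]


instance ft_mv {ι B : Type} [Finite ι] [CommRing B] [Algebra ℂ B] [Algebra.FiniteType ℂ B] :
    Algebra.FiniteType ℂ (MvPolynomial ι B) :=
  Algebra.FiniteType.trans (S := B) inferInstance inferInstance

lemma spec_hom {B D : Type} [CommRing B] [Algebra ℂ B] [CommRing D] [Algebra ℂ D] (h : B →ₐ[ℂ] D) (s t : D) :
    ∃ H : MvPolynomial (Fin 2) B →ₐ[ℂ] D, (∀ b, H (C b) = h b) ∧ H (X 0) = s ∧ H (X 1) = t := by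
  let H0 : MvPolynomial (Fin 2) B →+* D := eval₂Hom (h : B →+* D) ![s, t]
  refine ⟨{ H0 with commutes' := fun c => ?_ }, fun b => ?_, ?_, ?_⟩
  · change H0 (algebraMap ℂ _ c) = _
    rw [IsScalarTower.algebraMap_apply ℂ B (MvPolynomial (Fin 2) B), MvPolynomial.algebraMap_eq]
    simp [H0]
  · change H0 _ = _; simp [H0]
  · change H0 _ = _; simp [H0]
  · change H0 _ = _; simp [H0]

def secE {n N : ℕ} (w : Fin N × Fin n → ℂ) (v : Fin N → ℂ) {B : Type} [CommRing B] [Algebra ℂ B] (x : Fin n → B) :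
    Fin N → MvPolynomial (Fin 2) B :=
  fun k => X 0 * C (LD w x k) + X 1 * C (algebraMap ℂ B (v k))

def secQ {n N : ℕ} (w : Fin N × Fin n → ℂ) (v : Fin N → ℂ) {B : Type} [CommRing B] [Algebra ℂ B] (x : Fin n → B) :
    MP N →ₐ[ℂ] MvPolynomial (Fin 2) B := aeval (secE w v x)

section
variable {n N : ℕ} {w : Fin N × Fin n → ℂ} {v : Fin N → ℂ} {B : Type} [CommRing B] [Algebra ℂ B]

lemma secQ_spec {D : Type} [CommRing D] [Algebra ℂ D] (H : MvPolynomial (Fin 2) B →ₐ[ℂ] D) (h : B →ₐ[ℂ] D)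
    (hh : ∀ b, H (C b) = h b) (x : Fin n → B) (f : MP N) :
    H (secQ w v x f) = aeval (H (X 0) • LD w (fun k => h (x k)) + H (X 1) • cst D v) f := by
  have : H.comp (secQ w v x) = aeval (H (X 0) • LD w (fun k => h (x k)) + H (X 1) • cst D v) := by
    apply MvPolynomial.algHom_ext
    intro k
    simp [secQ, secE, hh, LD_map, cst]
  exact DFunLike.congr_fun this f

lemma mem_secQ [IsDomain B] [Algebra.FiniteType ℂ B] (x : Fin n → B) (f : MP N) :
    f ∈ RingHom.ker (secQ w v x) ↔ ∀ (ξ : B →ₐ[ℂ] ℂ) (s t : ℂ), eval (s • LD w (fun k => ξ (x k)) + t • v) f = 0 := by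
  rw [RingHom.mem_ker]
  constructor
  · intro h ξ s t
    obtain ⟨H, h1, h2, h3⟩ := spec_hom ξ s t
    have := secQ_spec (w := w) (v := v) H ξ h1 x f
    rw [h, map_zero, h2, h3, ae_ev] at this
    exact this.symm
  · intro h
    apply eq_zero_of_pts
    intro H
    let ξ : B →ₐ[ℂ] ℂ := H.comp (Algebra.ofId B (MvPolynomial (Fin 2) B) |>.restrictScalars ℂ)
    have := secQ_spec (w := w) (v := v) H ξ (fun b => rfl) x f
    rw [this, ae_ev]
    exact h ξ _ _
end

def JChar {n N : ℕ} (I : Ideal (MP n)) (w : Fin N × Fin n → ℂ) (v : Fin N → ℂ) (J : Ideal (MP N)) : Prop :=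
  ∀ f, f ∈ J ↔ ∀ x y : Fin n → ℂ, OnC I x → OnC I y → LD w x + LD w y = v → ∀ s t : ℂ, eval (s • LD w x + t • v) f = 0

section
variable {n N : ℕ} {I : Ideal (MP n)} {w : Fin N × Fin n → ℂ} {v : Fin N → ℂ} {J : Ideal (MP N)} 

lemma sum_map {B D : Type} [CommRing B] [Algebra ℂ B] [CommRing D] [Algebra ℂ D] (q : B →ₐ[ℂ] D) {x y : Fin n → B}
    (h : LD w x + LD w y = cst B v) : LD w (fun k => q (x k)) + LD w (fun k => q (y k)) = cst D v := by
  funext k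
  have := congrArg q (congrFun h k)
  rw [Pi.add_apply, map_add, LD_map, LD_map] at this
  rw [Pi.add_apply, this]; simp [cst]

lemma J_le_Q (hJ : JChar I w v J) {B : Type} [CommRing B] [IsDomain B] [Algebra ℂ B] [Algebra.FiniteType ℂ B]
    {x y : Fin n → B} (hx : OnC I x) (hy : OnC I y) (h : LD w x + LD w y = cst B v) : J ≤ RingHom.ker (secQ w v x) := by
  intro f hf
  rw [mem_secQ]
  intro ξ s t
  refine (hJ f).mp hf _ _ (hx.map ξ) (hy.map ξ) ?_ s t
  have := sum_map ξ h
  rw [this]; funext k; simp [cst]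

lemma core_B0 [I.IsPrime] [J.IsPrime] (hJ : JChar I w v J) :
    ∃ (B : Type) (_ : CommRing B) (_ : IsDomain B) (_ : Algebra ℂ B) (_ : Algebra.FiniteType ℂ B) (x y : Fin n → B),
      OnC I x ∧ OnC I y ∧ LD w x + LD w y = cst B v ∧ (∀ U : Subalgebra ℂ B, (∀ k, x k ∈ U) → (∀ k, y k ∈ U) → U = ⊤) ∧
      RingHom.ker (secQ w v x) = J := by
  classical
  obtain ⟨A, _, _, _, _, i, j, huniv, -, hgen⟩ := prod_alg (MP n ⧸ I) (MP n ⧸ I)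
  have hN : IsNoetherianRing A := Algebra.FiniteType.isNoetherianRing ℂ A
  let x : Fin n → A := fun k => i (xq I k)
  let y : Fin n → A := fun k => j (xq I k)
  have hx : OnC I x := (onC_xq I).map i
  have hy : OnC I y := (onC_xq I).map j
  let 𝔞 : Ideal A := Ideal.span (Set.range fun k => (LD w x + LD w y - cst A v) k)
  have hfin : 𝔞.minimalPrimes.Finite := Ideal.finite_minimalPrimes_of_isNoetherianRing A 𝔞
  let Q : Ideal A → Ideal (MP N) := fun P => RingHom.ker (secQ w v (fun k => Ideal.Quotient.mkₐ ℂ P (x k)))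
  have hinf : hfin.toFinset.inf Q ≤ J := by
    intro f hf
    rw [hJ]
    intro x' y' hx' hy' hxy s t
    obtain ⟨h, h1, h2⟩ := huniv ℂ (hq hx') (hq hy')
    have hx1 : ∀ k, h (x k) = x' k := fun k => by rw [h1, hq_xq]
    have hy1 : ∀ k, h (y k) = y' k := fun k => by rw [h2, hq_xq]
    have hle : 𝔞 ≤ RingHom.ker h := by
      rw [Ideal.span_le]
      rintro _ ⟨k, rfl⟩
      rw [SetLike.mem_coe, RingHom.mem_ker]
      change h ((LD w x + LD w y - cst A v) k) = 0
      rw [Pi.sub_apply, Pi.add_apply, map_sub, map_add, LD_map, LD_map]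
      simp only [hx1, hy1, cst]
      have := congrFun hxy k
      simp only [Pi.add_apply] at this
      rw [this]; simp
    have : (RingHom.ker h).IsPrime := RingHom.ker_isPrime h
    obtain ⟨P, hP, hPle⟩ := Ideal.exists_minimalPrimes_le hle
    have hfP : f ∈ Q P := (Finset.inf_le (hfin.mem_toFinset.mpr hP) : hfin.toFinset.inf Q ≤ Q P) hf
    let h' : A ⧸ P →ₐ[ℂ] ℂ := Ideal.Quotient.liftₐ P h hPle
    obtain ⟨H, e1, e2, e3⟩ := spec_hom h' s t
    have := secQ_spec (w := w) (v := v) H h' e1 (fun k => Ideal.Quotient.mkₐ ℂ P (x k)) f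
    rw [RingHom.mem_ker.mp hfP, map_zero, e2, e3, ae_ev] at this
    have e4 : (fun k => h' (Ideal.Quotient.mkₐ ℂ P (x k))) = x' := by
      funext k; rw [← hx1]; rfl
    rw [e4] at this
    exact this.symm
  obtain ⟨P, hP, hPJ⟩ := (Ideal.IsPrime.inf_le' ‹J.IsPrime›).mp hinf
  rw [hfin.mem_toFinset] at hP
  have : P.IsPrime := hP.1.1
  have hsum : LD w (fun k => Ideal.Quotient.mkₐ ℂ P (x k)) + LD w (fun k => Ideal.Quotient.mkₐ ℂ P (y k)) = cst (A ⧸ P) v := by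
    funext k
    have h1 : (LD w x + LD w y - cst A v) k ∈ P := hP.1.2 (Ideal.subset_span ⟨k, rfl⟩)
    have h2 : Ideal.Quotient.mkₐ ℂ P ((LD w x + LD w y - cst A v) k) = 0 := Ideal.Quotient.eq_zero_iff_mem.mpr h1
    rw [Pi.sub_apply, Pi.add_apply, map_sub, map_add, LD_map, LD_map, sub_eq_zero] at h2
    rw [Pi.add_apply, h2]; rfl
  refine ⟨A ⧸ P, inferInstance, inferInstance, inferInstance, inferInstance, fun k => Ideal.Quotient.mkₐ ℂ P (x k),
    fun k => Ideal.Quotient.mkₐ ℂ P (y k), hx.map _, hy.map _, hsum, ?_, le_antisymm hPJ (J_le_Q hJ (hx.map _) (hy.map _) hsum)⟩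
  intro U h1 h2
  have := hgen (U.comap (Ideal.Quotient.mkₐ ℂ P)) (incl_xq i _ h1) (incl_xq j _ h2)
  rw [eq_top_iff]
  rintro b -
  obtain ⟨a, rfl⟩ := Ideal.Quotient.mkₐ_surjective ℂ P b
  have h3 : a ∈ U.comap (Ideal.Quotient.mkₐ ℂ P) := by rw [this]; trivial
  exact h3

lemma core_B1 [I.IsPrime] {x' y' : Fin n → ℂ} (hx' : OnC I x') (hy' : OnC I y') (hxy : LD w x' + LD w y' = v) :
    ∃ (B : Type) (_ : CommRing B) (_ : IsDomain B) (_ : Algebra ℂ B) (_ : Algebra.FiniteType ℂ B) (x y : Fin n → B)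
      (η : B →ₐ[ℂ] ℂ),
      OnC I x ∧ OnC I y ∧ LD w x + LD w y = cst B v ∧ (∀ U : Subalgebra ℂ B, (∀ k, x k ∈ U) → (∀ k, y k ∈ U) → U = ⊤) ∧
      (∀ k, η (x k) = x' k) ∧ (∀ k, η (y k) = y' k) ∧ td (MP n ⧸ I) + td (MP n ⧸ I) ≤ td B + N := by
  obtain ⟨A, _, _, _, _, i, j, huniv, htd, hgen⟩ := prod_alg (MP n ⧸ I) (MP n ⧸ I)
  obtain ⟨h, h1, h2⟩ := huniv ℂ (hq hx') (hq hy')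
  let x : Fin n → A := fun k => i (xq I k)
  let y : Fin n → A := fun k => j (xq I k)
  have hx1 : ∀ k, h (x k) = x' k := fun k => by rw [h1, hq_xq]
  have hy1 : ∀ k, h (y k) = y' k := fun k => by rw [h2, hq_xq]
  have hx : OnC I x := (onC_xq I).map i
  have hy : OnC I y := (onC_xq I).map j
  obtain ⟨B, _, _, _, _, q, η, hqs, hη, h0, ht⟩ := krull' h (fun k : Fin N => (LD w x + LD w y - cst A v) k) (by
    intro k
    rw [Pi.sub_apply, Pi.add_apply, map_sub, map_add, LD_map, LD_map]
    simp only [hx1, hy1, cst]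
    have := congrFun hxy k
    simp only [Pi.add_apply] at this
    rw [this]; simp)
  refine ⟨B, inferInstance, inferInstance, inferInstance, inferInstance, fun k => q (x k), fun k => q (y k), η,
    hx.map q, hy.map q, ?_, ?_, fun k => by rw [hη, hx1], fun k => by rw [hη, hy1], ?_⟩
  · funext k
    have h2 := h0 k
    rw [Pi.sub_apply, Pi.add_apply, map_sub, map_add, LD_map, LD_map, sub_eq_zero] at h2
    rw [Pi.add_apply, h2]; simp [cst]
  · intro U e1 e2
    have := hgen (U.comap q) (incl_xq i _ e1) (incl_xq j _ e2)
    rw [eq_top_iff]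
    rintro b -
    obtain ⟨a, rfl⟩ := hqs b
    have h3 : a ∈ U.comap q := by rw [this]; trivial
    exact h3
  · rw [Fintype.card_fin] at ht; omega
end


lemma line_alg {N d : ℕ} {G : MP N} (hG : G.IsHomogeneous d) {v : Fin N → ℂ} (hv : eval v G ≠ 0)
    {D : Type} [CommRing D] [Algebra ℂ D] (p : Fin N → ℂ) (t : D) (h : aeval (cst D p + t • cst D v) G = 0) :
    IsAlgebraic ℂ t := by
  obtain ⟨-, h2⟩ := line_lead (A := ℂ) hG p v
  refine ⟨aeval (fun j => Polynomial.C (p j) + Polynomial.C (algebraMap ℂ ℂ (v j)) * Polynomial.X) G, ?_, ?_⟩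
  rotate_left
  · have := comp_aeval_apply (Polynomial.aeval t : Polynomial ℂ →ₐ[ℂ] D) G
      (f := fun j => Polynomial.C (p j) + Polynomial.C (algebraMap ℂ ℂ (v j)) * Polynomial.X)
    rw [this, ← h]
    congr 2
    funext k
    simp only [map_add, map_mul, Polynomial.aeval_C, Polynomial.aeval_X, Pi.add_apply, Pi.smul_apply, smul_eq_mul, cst,
      Algebra.algebraMap_self, RingHom.id_apply]
    ring
  · intro h0
    rw [h0] at h2
    simp at h2
    exact hv h2.symm

section
variable {n N d : ℕ} {I : Ideal (MP n)} {w : Fin N × Fin n → ℂ} {v : Fin N → ℂ} {J : Ideal (MP N)} 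
  {o : Fin n → ℂ} {S : Fin n × Fin N → ℂ} {l : Fin n → ℂ} {F : MP n}

lemma type_const (L : LinData w o S l) (hF : F.IsHomogeneous d) (hFo : eval o F ≠ 0) (hS : SecF I F)
    {B : Type} [CommRing B] [IsDomain B] [Algebra ℂ B] [Algebra.FiniteType ℂ B] {x y : Fin n → B}
    (hx : OnC I x) (hy : OnC I y) (h : LD w x + LD w y = cst B v) (η : B →ₐ[ℂ] ℂ) :
    lam l (x + y) = algebraMap ℂ B (η (lam l (x + y))) := by
  obtain ⟨p, hp, h0⟩ := lam_integral L hF hFo (F_add hS hx hy)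
  apply alg_const_poly η (p.map (eval v : MP N →+* ℂ)) (hp.map _).ne_zero
  rw [Polynomial.aeval_def, Polynomial.eval₂_map]
  have : (algebraMap ℂ B).comp (eval v : MP N →+* ℂ) = (aeval (LD w (x + y)) : MP N →ₐ[ℂ] B).toRingHom := by
    ext f
    · simp
    · rw [LD_add, h]; simp [cst]
  rw [this]; exact h0

lemma td_Q1 (L : LinData w o S l) (hF : F.IsHomogeneous d) (hFo : eval o F ≠ 0) (hS : SecF I F) (hI : HomI I)
    {G : MP N} {e : ℕ} (hG : G.IsHomogeneous e) (hGI : G ∈ I.comap (Lst w)) (hGv : eval v G ≠ 0)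
    {B : Type} [CommRing B] [IsDomain B] [Algebra ℂ B] [Algebra.FiniteType ℂ B] {x y : Fin n → B}
    (hx : OnC I x) (hy : OnC I y) (h : LD w x + LD w y = cst B v) (η : B →ₐ[ℂ] ℂ)
    (hgen : ∀ U : Subalgebra ℂ B, (∀ k, x k ∈ U) → (∀ k, y k ∈ U) → U = ⊤) :
    td B + 2 ≤ td (MP N ⧸ RingHom.ker (secQ w v x)) := by
  have : (RingHom.ker (secQ w v x)).IsPrime := RingHom.ker_isPrime _
  let b : MP N ⧸ RingHom.ker (secQ w v x) →ₐ[ℂ] MvPolynomial (Fin 2) B := Ideal.Quotient.liftₐ _ (secQ w v x) (fun a ha => ha)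
  obtain ⟨ξ, x1, x2, x3⟩ := spec_hom η 1 0
  obtain ⟨D, _, _, _, _, q, η', hqs, hη', hqb, htd⟩ := fibre_lemma b ξ
  rw [td_mvPolynomial, Fintype.card_fin] at htd
  let c : B →ₐ[ℂ] MvPolynomial (Fin 2) B := (Algebra.ofId B (MvPolynomial (Fin 2) B)).restrictScalars ℂ
  let qc : B →ₐ[ℂ] D := q.comp c
  have hqc : ∀ a, q (C a) = qc a := fun a => rfl
  let X' : Fin n → D := fun k => qc (x k)
  let Y' : Fin n → D := fun k => qc (y k)
  have hX' : OnC I X' := hx.map qc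
  have hY' : OnC I Y' := hy.map qc
  have hXY : LD w X' + LD w Y' = cst D v := sum_map qc h
  let x0 : Fin n → ℂ := fun k => η (x k)
  let y0 : Fin n → ℂ := fun k => η (y k)
  have hx0 : OnC I x0 := hx.map η
  have hy0 : OnC I y0 := hy.map η
  have hxy0 : LD w x0 + LD w y0 = v := by
    have := sum_map η h
    rw [this]; funext k; simp [cst]
  let s := q (X 0)
  let t := q (X 1)
  have hη1 : η' s = 1 := by rw [hη', x2]
  have hη0 : η' t = 0 := by rw [hη', x3]
  have key : s • LD w X' + t • cst D v = cst D (LD w x0) := by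
    funext k
    have e1 := hqb (Ideal.Quotient.mk _ (X k))
    have e2 : b (Ideal.Quotient.mk _ (X k)) = secQ w v x (X k) := rfl
    have e3 := secQ_spec (w := w) (v := v) q qc hqc x (X k)
    have e4 := secQ_spec (w := w) (v := v) ξ η x1 x (X k)
    rw [e2, e3, e4, x2, x3] at e1
    simpa [cst] using e1
  have hs1 := onC_comap (w := w) (hX'.smul hI s) G hGI
  have hs2 := onC_comap (w := w) (hY'.smul hI s) G hGI
  have t0 : t = 0 := by
    have := line_alg hG hGv (D := D) (LD w x0) (-t) (by
      rw [← hs1, LD_smul]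
      congr 2
      rw [← key]; funext k; simp)
    have := alg_const η' this
    rw [map_neg, hη0] at this
    simpa using this
  rw [t0, zero_smul, add_zero] at key
  have s1 : s = 1 := by
    have := line_alg hG hGv (D := D) (- LD w x0) s (by
      rw [← hs2, LD_smul]
      congr 2
      rw [← hXY, smul_add, key]
      funext k; simp [cst])
    have := alg_const η' this
    rw [hη1] at this
    simpa using this
  rw [s1, one_smul, ← LD_cst] at key
  have kx : X' = cst D x0 := L_inj L hI hS hF hFo hX' (onC_cst hx0) key
  have ky : Y' = cst D y0 := by
    apply L_inj L hI hS hF hFo hY' (onC_cst hy0)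
    rw [key] at hXY
    rw [← hxy0] at hXY
    have h2 : cst D (LD w x0 + LD w y0) = LD w (cst D x0) + LD w (cst D y0) := by
      rw [LD_cst, LD_cst]; funext k; simp [cst]
    rw [h2] at hXY
    exact add_left_cancel hXY
  have hU : (⊥ : Subalgebra ℂ D).comap qc = ⊤ := by
    apply hgen
    · intro k; exact Algebra.mem_bot.mpr ⟨x0 k, (congrFun kx k).symm⟩
    · intro k; exact Algebra.mem_bot.mpr ⟨y0 k, (congrFun ky k).symm⟩
  have hT : ∀ a, q a ∈ (⊥ : Subalgebra ℂ D) := by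
    intro a
    induction a using MvPolynomial.induction_on with
    | C a =>
      have : a ∈ (⊥ : Subalgebra ℂ D).comap qc := by rw [hU]; trivial
      exact this
    | add a b ha hb => rw [map_add]; exact add_mem ha hb
    | mul_X a i ha =>
      rw [map_mul]
      refine mul_mem ha ?_
      fin_cases i
      · change s ∈ _; rw [s1]; exact one_mem _
      · change t ∈ _; rw [t0]; exact zero_mem _
  have hD : td D = 0 := by
    apply td_zero_of_const η'
    intro a
    obtain ⟨a, rfl⟩ := hqs a
    obtain ⟨z, hz⟩ := Algebra.mem_bot.mp (hT a)
    rw [← hz]; simp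
  omega
end


section
variable {n N d m : ℕ} {I : Ideal (MP n)} {w : Fin N × Fin n → ℂ} {v : Fin N → ℂ} {J : Ideal (MP N)} 
  {o : Fin n → ℂ} {S : Fin n × Fin N → ℂ} {l : Fin n → ℂ} {F : MP n}

lemma four_case (L : LinData w o S l) (hF : F.IsHomogeneous d) (hFo : eval o F ≠ 0) (hS : SecF I F) (hI : HomI I)
    (hT : ∀ v : Fin n → ℂ, v ≠ 0 → OnC I v → Module.finrank ℂ (TanI I v) = m + 1) 
    (hs : SurjAt I w v) (ht : TriAt I w v) (hz : ∀ x : Fin n → ℂ, OnC I x → LD w x ≠ v) (hN : 2 * N = 3 * m + 4)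
    {D : Type} [CommRing D] [IsDomain D] [Algebra ℂ D] [Algebra.FiniteType ℂ D] {X0 Y0 X1 Y1 : Fin n → D} {s t s' t' : D}
    (hs0 : s ≠ 0) (hs0' : s' ≠ 0) (hX0 : OnC I X0) (hY0 : OnC I Y0) (hX1 : OnC I X1) (hY1 : OnC I Y1)
    (h0 : LD w X0 + LD w Y0 = cst D v) (h1 : LD w X1 + LD w Y1 = cst D v)
    (heq : s • LD w X0 + t • cst D v = s' • LD w X1 + t' • cst D v)
    (hty : lam l (X0 + Y0) ≠ lam l (X1 + Y1)) : ∃ x, X0 = cst D x := by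
  have a0 : ∀ k, LD w X0 k + LD w Y0 k = cst D v k := fun k => congrFun h0 k
  have a1 : ∀ k, LD w X1 k + LD w Y1 k = cst D v k := fun k => congrFun h1 k
  have ae : ∀ k, s * LD w X0 k + t * cst D v k = s' * LD w X1 k + t' * cst D v k := fun k => congrFun heq k
  have cancel : ∀ {a : D} {x y : Fin n → D}, a ≠ 0 → a • x = a • y → x = y := by
    intro a x y ha h
    funext k
    exact mul_left_cancel₀ ha (congrFun h k)
  by_cases hc : t' - t = 0
  · have hc' : t' = t := sub_eq_zero.mp hc
    have e1 : s • X0 = s' • X1 := by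
      apply L_inj L hI hS hF hFo (hX0.smul hI s) (hX1.smul hI s')
      rw [LD_smul, LD_smul]
      funext k
      simp only [Pi.smul_apply, smul_eq_mul]
      have := ae k
      rw [hc'] at this
      exact add_right_cancel this
    by_cases hss : s' - s = 0
    · exfalso
      have hss' : s' = s := sub_eq_zero.mp hss
      rw [hss'] at e1
      have e2 : X0 = X1 := cancel hs0 e1
      have e3 : Y0 = Y1 := by
        apply L_inj L hI hS hF hFo hY0 hY1
        rw [← h0, e2] at h1
        exact (add_left_cancel h1).symm
      rw [e2, e3] at hty
      exact hty rfl
    · refine tri_const hT hI hs ht hz hN hss hs0' hX0 hY0 (hY1.smul hI s') h0 ?_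
      rw [LD_smul]
      funext k
      simp only [Pi.add_apply, Pi.smul_apply, smul_eq_mul]
      have := ae k
      rw [hc'] at this
      linear_combination s' * a0 k - s' * a1 k - this
  · set c := t' - t with hcd
    have hcn : -c ≠ 0 := neg_ne_zero.mpr hc
    by_cases hsc : s - c = 0
    · have hsc' : s = c := sub_eq_zero.mp hsc
      have e1 : s' • X1 = (-c) • Y0 := by
        apply L_inj L hI hS hF hFo (hX1.smul hI s') (hY0.smul hI _)
        rw [LD_smul, LD_smul]
        funext k
        simp only [Pi.smul_apply, smul_eq_mul]
        linear_combination - ae k + LD w X0 k * hsc' + c * a0 k + cst D v k * hcd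
      by_cases hsc2 : s' + c = 0
      · exfalso
        have e : -c = s' := by linear_combination -hsc2
        rw [e] at e1
        have e2 := cancel hs0' e1
        have e3 : X0 = Y1 := by
          apply L_inj L hI hS hF hFo hX0 hY1
          rw [← h0, e2, add_comm] at h1
          exact (add_right_cancel h1).symm
        rw [e2, e3] at hty
        exact hty (by rw [add_comm])
      · refine tri_const hT hI hs ht hz hN hs0' hsc2 hX0 hY0 (hY1.smul hI s') h0 ?_
        rw [LD_smul]
        funext k
        simp only [Pi.add_apply, Pi.smul_apply, smul_eq_mul]
        have e2 := congrArg (fun u => LD w u k) e1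
        simp only [LD_smul, Pi.smul_apply, smul_eq_mul] at e2
        linear_combination s' * a0 k - s' * a1 k + e2
    · refine tri_const hT hI hs ht hz hN hsc hcn hX0 hY0 (hX1.smul hI s') h0 ?_
      rw [LD_smul]
      funext k
      simp only [Pi.add_apply, Pi.smul_apply, smul_eq_mul]
      linear_combination ae k - c * a0 k - cst D v k * hcd

lemma core [I.IsPrime] [J.IsPrime] (L : LinData w o S l) (hF : F.IsHomogeneous d) (hFo : eval o F ≠ 0) (hS : SecF I F) (hI : HomI I)
    {G : MP N} {e : ℕ} (hG : G.IsHomogeneous e) (hGI : G ∈ I.comap (Lst w)) (hGv : eval v G ≠ 0)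
    (hT : ∀ v : Fin n → ℂ, v ≠ 0 → OnC I v → Module.finrank ℂ (TanI I v) = m + 1) 
    (hs : SurjAt I w v) (ht : TriAt I w v) (hN : 2 * N = 3 * m + 4) (hm : 0 < m) (htd : td (MP n ⧸ I) = m + 1)
    (hJ : JChar I w v J) {x0 y0 x1 y1 : Fin n → ℂ} (hx0 : OnC I x0) (hy0 : OnC I y0) (hx1 : OnC I x1) (hy1 : OnC I y1)
    (h0 : LD w x0 + LD w y0 = v) (h1 : LD w x1 + LD w y1 = v) (hne : lam l (x0 + y0) ≠ lam l (x1 + y1)) : False := by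
  have hz : ∀ x : Fin n → ℂ, OnC I x → LD w x ≠ v := by
    rintro x hx rfl
    have := onC_comap (w := w) hx G hGI
    rw [ae_ev] at this
    exact hGv this
  obtain ⟨B0, _, _, _, _, X0, Y0, hX0, hY0, hs0, hgen0, hk0⟩ := core_B0 hJ
  obtain ⟨η0, -⟩ := exists_pt (⊥ : Ideal B0) bot_ne_top
  have ty0 := type_const L hF hFo hS hX0 hY0 hs0 η0
  set τ0 := η0 (lam l (X0 + Y0)) with hτ0
  obtain ⟨x', y', hx', hy', h', hτ'⟩ : ∃ x' y' : Fin n → ℂ, OnC I x' ∧ OnC I y' ∧ LD w x' + LD w y' = v ∧ lam l (x' + y') ≠ τ0 := by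
    by_cases h : lam l (x0 + y0) = τ0
    · exact ⟨x1, y1, hx1, hy1, h1, fun h' => hne (h.trans h'.symm)⟩
    · exact ⟨x0, y0, hx0, hy0, h0, h⟩
  obtain ⟨B1, _, _, _, _, X1, Y1, η1, hX1, hY1, hs1, hgen1, hxe, hye, htd1⟩ := core_B1 hx' hy' h'
  have ty1 := type_const L hF hFo hS hX1 hY1 hs1 η1
  have hη1 : η1 (lam l (X1 + Y1)) = lam l (x' + y') := by
    rw [lam_map]
    congr 1
    funext k
    simp [hxe, hye]
  rw [hη1] at ty1
  have t0 := fib_td hT hs hz hX0 hY0 hs0 hgen0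
  have t1 := td_Q1 L hF hFo hS hI hG hGI hGv hX1 hY1 hs1 η1 hgen1
  let f0 : MP N ⧸ J →ₐ[ℂ] MvPolynomial (Fin 2) B0 := Ideal.Quotient.liftₐ J (secQ w v X0) (fun a ha => by
    rw [← hk0] at ha; exact ha)
  have f0e : ∀ f, f0 (Ideal.Quotient.mk J f) = secQ w v X0 f := fun f => rfl
  have hf0 : Function.Injective f0 := by
    rw [injective_iff_map_eq_zero]
    intro a ha
    obtain ⟨a, rfl⟩ := Ideal.Quotient.mk_surjective a
    rw [Ideal.Quotient.eq_zero_iff_mem, ← hk0]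
    exact ha
  have t2 := td_le_of_injective f0 hf0
  rw [td_mvPolynomial, Fintype.card_fin] at t2
  have hprime : (RingHom.ker (secQ w v X1)).IsPrime := RingHom.ker_isPrime _
  have hk1 : RingHom.ker (secQ w v X1) = J := by
    rcases (J_le_Q hJ hX1 hY1 hs1).eq_or_lt with h | h
    · exact h.symm
    · exfalso
      have := td_quot_lt h
      omega
  rw [hk1] at t1
  let f1 : MP N ⧸ J →ₐ[ℂ] MvPolynomial (Fin 2) B1 := Ideal.Quotient.liftₐ J (secQ w v X1) (fun a ha => by
    rw [← hk1] at ha; exact ha)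
  have hf1 : Function.Injective f1 := by
    rw [injective_iff_map_eq_zero]
    intro a ha
    obtain ⟨a, rfl⟩ := Ideal.Quotient.mk_surjective a
    rw [Ideal.Quotient.eq_zero_iff_mem, ← hk1]
    exact ha
  obtain ⟨D, _, _, _, _, g0, g1, hg, hg0, hg1⟩ := amalgam f0 f1 hf0 hf1
  let c0 : B0 →ₐ[ℂ] D := g0.comp ((Algebra.ofId B0 (MvPolynomial (Fin 2) B0)).restrictScalars ℂ)
  let c1 : B1 →ₐ[ℂ] D := g1.comp ((Algebra.ofId B1 (MvPolynomial (Fin 2) B1)).restrictScalars ℂ)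
  have sp0 := fun f => secQ_spec (w := w) (v := v) g0 c0 (fun b => rfl) X0 f
  have sp1 := fun f => secQ_spec (w := w) (v := v) g1 c1 (fun b => rfl) X1 f
  have heq : g0 (X 0) • LD w (fun k => c0 (X0 k)) + g0 (X 1) • cst D v =
      g1 (X 0) • LD w (fun k => c1 (X1 k)) + g1 (X 1) • cst D v := by
    funext k
    have e1 := hg (Ideal.Quotient.mk J (X k))
    have e2 : f1 (Ideal.Quotient.mk J (X k)) = secQ w v X1 (X k) := rfl
    rw [f0e, e2, sp0, sp1, aeval_X, aeval_X] at e1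
    exact e1
  have hn0 : g0 (X 0) ≠ 0 := by
    rw [← map_zero g0]; exact fun h => X_ne_zero _ (hg0 h)
  have hn1 : g1 (X 0) ≠ 0 := by
    rw [← map_zero g1]; exact fun h => X_ne_zero _ (hg1 h)
  obtain ⟨x, hx⟩ := four_case L hF hFo hS hI hT hs ht hz hN hn0 hn1 (hX0.map c0) (hY0.map c0) (hX1.map c1) (hY1.map c1)
    (sum_map c0 hs0) (sum_map c1 hs1) heq (by
      have e0 : lam l ((fun k => c0 (X0 k)) + fun k => c0 (Y0 k)) = algebraMap ℂ D τ0 := by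
        have := congrArg c0 ty0
        rw [lam_map, AlgHom.commutes] at this
        rw [← this]; congr 1; funext k; simp
      have e1 : lam l ((fun k => c1 (X1 k)) + fun k => c1 (Y1 k)) = algebraMap ℂ D (lam l (x' + y')) := by
        have := congrArg c1 ty1
        rw [lam_map, AlgHom.commutes] at this
        rw [← this]; congr 1; funext k; simp
      rw [e0, e1]
      intro h
      exact hτ' ((algebraMap ℂ D).injective h).symm)
  have hle : RingHom.ker (secQ w v x) ≤ J := by
    intro f hf
    rw [← hk0, RingHom.mem_ker]
    apply hg0
    rw [sp0, map_zero]
    obtain ⟨H, q1, q2, q3⟩ := spec_hom (Algebra.ofId ℂ D) (g0 (X 0)) (g0 (X 1))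
    have := secQ_spec (w := w) (v := v) H (Algebra.ofId ℂ D) q1 x f
    rw [RingHom.mem_ker.mp hf, map_zero, q2, q3] at this
    rw [this, hx]
    rfl
  have hp2 : (RingHom.ker (secQ w v x)).IsPrime := RingHom.ker_isPrime _
  have u1 : td (MP N ⧸ J) ≤ td (MP N ⧸ RingHom.ker (secQ w v x)) :=
    td_le_of_surjective (Ideal.Quotient.factorₐ ℂ hle) (Ideal.Quotient.factor_surjective hle)
  have u2 : td (MP N ⧸ RingHom.ker (secQ w v x)) ≤ td (MvPolynomial (Fin 2) ℂ) := by
    refine td_le_of_injective (Ideal.Quotient.liftₐ _ (secQ w v x) (fun a ha => ha)) ?_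
    rw [injective_iff_map_eq_zero]
    intro a ha
    obtain ⟨a, rfl⟩ := Ideal.Quotient.mk_surjective a
    rw [Ideal.Quotient.eq_zero_iff_mem]
    exact ha
  rw [td_mvPoly, Fintype.card_fin] at u2
  omega
end


section
variable {r m d : ℕ} {w : Fin (r+1) × Fin (r+2) → ℂ} {Z : Set (Pr (r+1))}

lemma LD_smul_add {n N : ℕ} (w : Fin N × Fin n → ℂ) (a b : ℂ) (x y : Fin n → ℂ) :
    LD w (a • x) + LD w (b • y) = a • LD w x + b • LD w y := by rw [LD_smul, LD_smul]

lemma cone_JChar (hcl : IsClosed Z) {v : Fin (r+1) → ℂ} (hv : v ≠ 0)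
    (hz : ∀ x : Fin (r+2) → ℂ, OnC (idealOf Z) x → LD w x ≠ v) :
    JChar (idealOf Z) w v (idealOf (secantCone (projImage w Z) (Projectivization.mk ℂ v hv))) := by
  have hI := homI_idealOf Z
  have hIJ := homI_idealOf (secantCone (projImage w Z) (Projectivization.mk ℂ v hv))
  intro f
  constructor
  · intro hf x y hx hy hxy s t
    have hx0 : LD w x ≠ 0 := fun h => hz y hy (by rw [← hxy, h, zero_add])
    have hy0 : LD w y ≠ 0 := fun h => hz x hx (by rw [← hxy, h, add_zero])
    obtain ⟨c1, hc1, e1⟩ := rep_mk hx0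
    obtain ⟨c2, hc2, e2⟩ := rep_mk hy0
    have hp : Projectivization.mk ℂ _ hx0 ∈ projImage w Z := mem_proj_of hcl hx hc1 e1
    have hq : Projectivization.mk ℂ _ hy0 ∈ projImage w Z := mem_proj_of hcl hy hc2 e2
    have hpq : Projectivization.mk ℂ _ hx0 ≠ Projectivization.mk ℂ _ hy0 := by
      intro h
      obtain ⟨c, hc⟩ := (Projectivization.mk_eq_mk_iff' ℂ _ _ hx0 hy0).mp h
      refine hz _ (hy.smul hI (c + 1)) ?_
      rw [LD_smul, ← hxy, ← hc, add_smul, one_smul]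
    set p := Projectivization.mk ℂ _ hx0 with hpd
    set q := Projectivization.mk ℂ _ hy0 with hqd
    have mx : LD w x ∈ Submodule.span ℂ ({p.rep, q.rep} : Set (Fin (r+1) → ℂ)) := by
      have : LD w x = c1⁻¹ • p.rep := by rw [e1, smul_smul, inv_mul_cancel₀ hc1, one_smul]
      rw [this]; exact Submodule.smul_mem _ _ (Submodule.subset_span (by simp))
    have my : LD w y ∈ Submodule.span ℂ ({p.rep, q.rep} : Set (Fin (r+1) → ℂ)) := by
      have : LD w y = c2⁻¹ • q.rep := by rw [e2, smul_smul, inv_mul_cancel₀ hc2, one_smul]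
      rw [this]; exact Submodule.smul_mem _ _ (Submodule.subset_span (by simp))
    have mv : v ∈ Submodule.span ℂ ({p.rep, q.rep} : Set (Fin (r+1) → ℂ)) := by
      rw [← hxy]; exact Submodule.add_mem _ mx my
    have key : ∀ u : Fin (r+1) → ℂ, ∀ hu : u ≠ 0, u ∈ Submodule.span ℂ ({p.rep, q.rep} : Set (Fin (r+1) → ℂ)) → 
        Projectivization.mk ℂ u hu ∈ secantCone (projImage w Z) (Projectivization.mk ℂ v hv) := by
      intro u hu hmem
      apply subset_closure
      simp only [Set.mem_iUnion]
      refine ⟨p, hp, q, hq, hpq, ?_, ?_⟩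
      · obtain ⟨c, hc, e⟩ := rep_mk hv
        change _ ∈ Submodule.span _ _
        rw [e]; exact Submodule.smul_mem _ _ mv
      · obtain ⟨c, hc, e⟩ := rep_mk hu
        change _ ∈ Submodule.span _ _
        rw [e]; exact Submodule.smul_mem _ _ hmem
    have key2 : ∀ u : Fin (r+1) → ℂ, u ≠ 0 → u ∈ Submodule.span ℂ ({p.rep, q.rep} : Set (Fin (r+1) → ℂ)) → 
        OnC (idealOf (secantCone (projImage w Z) (Projectivization.mk ℂ v hv))) u := by
      intro u hu hmem
      rw [onC_eval]
      intro g hg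
      exact hg (key u hu hmem) u hu rfl
    by_cases hu : s • LD w x + t • v = 0
    · rw [hu]
      exact onC_eval.mp (onC_zero hIJ (key2 _ hx0 mx)) f hf
    · exact onC_eval.mp (key2 _ hu (Submodule.add_mem _ (Submodule.smul_mem _ _ mx) (Submodule.smul_mem _ _ mv))) f hf
  · intro h
    rw [secantCone, idealOf_closure, mem_idealOf]
    intro p hp
    simp only [Set.mem_iUnion] at hp
    obtain ⟨x', ⟨x1, hx1, c1, hc1, e1⟩, y', ⟨y1, hy1, c2, hc2, e2⟩, hxy, hz0, hp⟩ := hp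
    rw [← LD_eq] at e1 e2
    obtain ⟨a, b, hab⟩ := Submodule.mem_span_pair.mp hz0
    obtain ⟨a', b', hab'⟩ := Submodule.mem_span_pair.mp hp
    obtain ⟨c, hc, ev⟩ := (mk_eq_iff hv _).mp rfl
    intro u hu hup
    obtain ⟨c', hc', eu⟩ := (mk_eq_iff hu _).mp hup
    rw [← hab, e1, e2] at ev
    rw [← hab', e1, e2] at eu
    have ox := onC_rep hx1
    have oy := onC_rep hy1
    generalize x1.rep = x at *
    generalize y1.rep = y at *
    have hα : c * a * c1 ≠ 0 := by
      intro h0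
      refine hz _ (oy.smul hI (c * b * c2)) ?_
      rw [ev, LD_smul]
      funext k
      simp only [Pi.add_apply, Pi.smul_apply, smul_eq_mul]
      linear_combination - LD w x k * h0
    have hβ : c * b * c2 ≠ 0 := by
      intro h0
      refine hz _ (ox.smul hI (c * a * c1)) ?_
      rw [ev, LD_smul]
      funext k
      simp only [Pi.add_apply, Pi.smul_apply, smul_eq_mul]
      linear_combination - LD w y k * h0
    have := h _ _ (ox.smul hI (c * a * c1)) (oy.smul hI (c * b * c2)) (by
      rw [LD_smul_add, ev]
      funext k
      simp only [Pi.add_apply, Pi.smul_apply, smul_eq_mul]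
      ring) ((c' * a' * c1) / (c * a * c1) - (c' * b' * c2) / (c * b * c2)) ((c' * b' * c2) / (c * b * c2))
    rw [← this]
    congr 2
    rw [eu, ev, LD_smul]
    funext k
    simp only [Pi.add_apply, Pi.smul_apply, smul_eq_mul]
    have f1 : (c' * a' * c1) / (c * a * c1) * (c * a * c1) = c' * a' * c1 := div_mul_cancel₀ _ hα
    have f2 : (c' * b' * c2) / (c * b * c2) * (c * b * c2) = c' * b' * c2 := div_mul_cancel₀ _ hβ
    linear_combination - LD w x k * f1 - LD w y k * f2

lemma m_pos {n : ℕ} {I : Ideal (MP n)} [I.IsPrime] (hI : HomI I) (hnd : NDI I) (hn : 2 ≤ n) {x : Fin n → ℂ} (hx0 : x ≠ 0) (hx : OnC I x)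
    (htd : td (MP n ⧸ I) = m + 1) : 0 < m := by
  by_contra hm
  have hm0 : m = 0 := by omega
  have ho : OnC I ((X 0 : MvPolynomial (Fin 1) ℂ) • cst (MvPolynomial (Fin 1) ℂ) x) := (onC_cst hx).smul hI _
  obtain ⟨i, hi⟩ := Function.ne_iff.mp hx0
  simp only [Pi.zero_apply] at hi
  have hsurj : Function.Surjective (hq ho) := by
    have : (hq ho).range = ⊤ := by
      rw [eq_top_iff, ← MvPolynomial.adjoin_range_X, Algebra.adjoin_le_iff]
      rintro _ ⟨j, rfl⟩
      have hj : j = 0 := Subsingleton.elim _ _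
      refine ⟨(x i)⁻¹ • xq I i, ?_⟩
      change hq ho _ = _
      rw [map_smul, hq_xq, hj]
      simp only [Pi.smul_apply, smul_eq_mul, cst, MvPolynomial.algebraMap_eq]
      rw [mul_comm, ← MvPolynomial.smul_eq_C_mul, smul_smul, inv_mul_cancel₀ hi, one_smul]
    exact AlgHom.range_eq_top _ |>.mp this
  have hinj : ∀ a, hq ho a = 0 → a = 0 := by
    intro a ha
    by_contra h
    have := td_lt_of_surjective (hq ho) hsurj h ha
    rw [td_mvPoly, Fintype.card_fin] at this
    omega
  obtain ⟨h, hh, hhx⟩ : ∃ h : Fin n → ℂ, h ≠ 0 ∧ lam h x = 0 := by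
    obtain ⟨j, hj⟩ : ∃ j : Fin n, j ≠ i := by
      have : Nontrivial (Fin n) := Fin.nontrivial_iff_two_le.mpr hn
      exact exists_ne i
    refine ⟨Pi.single j (x i) - Pi.single i (x j), ?_, ?_⟩
    · intro h0
      have := congrFun h0 j
      simp [hj] at this
      exact hi this
    · rw [lam_ℂ]
      simp [sub_mul, Finset.sum_sub_distrib, Pi.single_apply]; ring
  obtain ⟨y, hy, hyn⟩ := hnd h hh
  apply hyn
  have e : lam h (xq I) = 0 := by
    apply hinj
    rw [lam_map]
    simp only [hq_xq]
    change lam h ((X 0 : MvPolynomial (Fin 1) ℂ) • cst (MvPolynomial (Fin 1) ℂ) x) = 0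
    rw [lam_smul, lam_cst, hhx]; simp
  have := congrArg (hq hy) e
  rw [lam_map, map_zero] at this
  simpa using this
end


lemma exists_homG {N : ℕ} {I : Ideal (MP N)} (hI : HomI I) (h : I ≠ ⊥) : ∃ (G : MP N) (e : ℕ), G ∈ I ∧ G ≠ 0 ∧ G.IsHomogeneous e := by
  obtain ⟨f, hf, hf0⟩ := Submodule.exists_mem_ne_zero_of_ne_bot h
  by_contra! hc
  apply hf0
  rw [← sum_homogeneousComponent f]
  refine Finset.sum_eq_zero fun i _ => ?_
  by_contra h0
  exact hc _ i (hI f hf i) h0 (homogeneousComponent_isHomogeneous i f)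

lemma not_isc {r m d : ℕ} {w : Fin (r+1) × Fin (r+2) → ℂ} {Z : Set (Pr (r+1))} (hcl : IsClosed Z) (hirr : IsIrreducible Z)
    (hsm : IsSmoothSet Z) (hnd : NondegenerateSet Z) (hdim : pdim Z = ((m : ℕ∞) : WithBot ℕ∞)) (hN : 3 * m + 4 = 2 * (r + 1))
    {o : Fin (r+2) → ℂ} {S : Fin (r+2) × Fin (r+1) → ℂ} {l : Fin (r+2) → ℂ} (L : LinData w o S l)
    {F : MP (r+2)} (hF : F.IsHomogeneous d) (hFo : eval o F ≠ 0) (hS : SecF (idealOf Z) F)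
    (hne : ∀ x ∈ Z, matLin w x.rep ≠ 0)
    (hsec : secantVariety (projImage w Z) = univ) : ¬ ISC (projImage w Z) := by
  rintro ⟨U, hU, hUd, hUi⟩
  have hprime := idealOf_prime hirr
  have hI := homI_idealOf Z
  have hndI := nd_form hnd
  obtain ⟨z, hz⟩ := hirr.1
  have hT : ∀ v : Fin (r+2) → ℂ, v ≠ 0 → OnC (idealOf Z) v → Module.finrank ℂ (TanI (idealOf Z) v) = m + 1 :=
    fun v h0 h1 => (smooth_data hcl hsm hdim h0 h1).1
  have htd : td (MP (r+2) ⧸ idealOf Z) = m + 1 := (smooth_data hcl hsm hdim z.rep_nonzero (onC_rep hz)).2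
  have hm : 0 < m := m_pos hI hndI (by omega) z.rep_nonzero (onC_rep hz) htd
  have hn : Nonempty (Pr r) := ⟨Projectivization.mk ℂ _ (hne z hz)⟩
  obtain ⟨u, hu⟩ := hUd.nonempty
  obtain ⟨g0, d0, hg0, hgu, hg0U⟩ := open_sep hU u hu
  have hg00 : g0 ≠ 0 := by
    rintro rfl
    exact hgu fun v _ _ => by simp
  have hI' : HomI ((idealOf Z).comap (Lst w)) := by
    rw [← idealOf_proj hne]; exact homI_idealOf _
  have hI0 : (idealOf Z).comap (Lst w) ≠ ⊥ := by
    intro h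
    let φ : MP (r+1) →ₐ[ℂ] MP (r+2) ⧸ idealOf Z := (Ideal.Quotient.mkₐ ℂ _).comp (Lst w)
    have hφ : Function.Injective φ := by
      rw [injective_iff_map_eq_zero]
      intro a ha
      have : a ∈ (idealOf Z).comap (Lst w) := by
        rw [Ideal.mem_comap]; exact Ideal.Quotient.eq_zero_iff_mem.mp ha
      rw [h] at this
      exact this
    have := td_le_of_injective φ hφ
    rw [htd, td_mvPoly, Fintype.card_fin] at this
    omega
  obtain ⟨G, e, hGI, hG0, hG⟩ := exists_homG hI' hI0
  obtain ⟨Gs, hGs0, hGs⟩ := gen_surj (idealOf Z) w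
  obtain ⟨Gt, hGt0, hGt⟩ := gen_tri (idealOf Z) w
  obtain ⟨Gc, hGc0, hGc⟩ := gen_conj hirr.1 hsec hndI L hF hFo hS
  obtain ⟨v, hv⟩ := exists_eval_ne (mul_ne_zero (mul_ne_zero (mul_ne_zero (mul_ne_zero hg00 hG0) hGs0) hGt0) hGc0)
  simp only [map_mul, mul_ne_zero_iff] at hv
  obtain ⟨⟨⟨⟨v0, v1⟩, v2⟩, v3⟩, v4⟩ := hv
  have hz : ∀ x : Fin (r+2) → ℂ, OnC (idealOf Z) x → LD w x ≠ v := by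
    rintro x hx rfl
    have := onC_comap (w := w) hx G hGI
    rw [ae_ev] at this
    exact v1 this
  have hv0 : v ≠ 0 := by
    rintro rfl
    refine hz 0 (onC_zero hI (onC_rep ‹z ∈ Z›)) ?_
    rw [LD_eq, map_zero]
  have hmU : Projectivization.mk ℂ v hv0 ∈ U := by
    by_contra h
    exact v0 (hg0U _ h v hv0 rfl)
  have hJp := idealOf_prime (hUi _ hmU)
  obtain ⟨x0, y0, x1, y1, hx0, hy0, hx1, hy1, h0, h1, hl⟩ := hGc v v4
  exact core L hF hFo hS hI hG hGI v1 hT (hGs v v2) (hGt v v3) (by omega) hm htd (cone_JChar hcl hv0 hz)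
    hx0 hy0 hx1 hy1 h0 h1 hl

/-- **(Remark after Corollary 3: sharpness.)**  Let `Z ⊆ ℙ^{r+1}` be a smooth Severi
variety: smooth, irreducible, nondegenerate, projectable, with
`dim Z = (2/3)((r+1) - 2)` (i.e. `3 dim Z + 4 = 2(r+1)`).  Let `Y ⊆ ℙ^r` be its generic
projection (from a generic point not on `Z`, parametrized by a generic matrix).  Then `Y`
is smooth, non-projectable, `dim Y = (2/3)(r - 1)`, and `Y` does NOT have the irreducible
secant cone (ISC) property.  In particular the bound `dim Y > (2/3)(r-1)` of Corollary 3
is sharp. -/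
theorem generic_projection_of_severi_variety_not_isc
    (r m : ℕ) (Z : Set (Pr (r+1)))
    (hcl : IsClosed Z) (hirr : IsIrreducible Z) (hsm : IsSmoothSet Z)
    (hnd : NondegenerateSet Z)
    (hproj : secantVariety Z ≠ Set.univ)
    (hdim : pdim Z = ((m : ℕ∞) : WithBot ℕ∞))
    (hseveri : 3 * m + 4 = 2 * (r + 1)) :
    GenericAff fun w : Fin (r+1) × Fin (r+2) → ℂ =>
      (Function.Surjective (matLin w) ∧ ∀ x ∈ Z, matLin w x.rep ≠ 0) →
      IsSmoothSet (projImage w Z) ∧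
      secantVariety (projImage w Z) = Set.univ ∧
      pdim (projImage w Z) = ((m : ℕ∞) : WithBot ℕ∞) ∧
      3 * m = 2 * (r - 1) ∧
      ¬ ISC (projImage w Z) := by
  obtain ⟨F, d, hF, hF0, hFz, hS⟩ := secant_poly (by omega) hcl hnd hproj
  obtain ⟨hK, hKe⟩ := kap_poly_ne hF hF0
  refine genericAff_of_poly hK fun w hw => ?_
  rw [hKe] at hw
  rintro ⟨hs, hne⟩
  have hk : kap w ≠ 0 := by
    intro h
    rw [h] at hw
    exact hw hFz
  obtain ⟨S, l, L⟩ := lin_data hs hk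
  have hprime := idealOf_prime hirr
  have hSF : SecF (idealOf Z) F := hS
  have h1 := proj_smooth L hF hw hcl hirr hsm hdim hSF hne
  have h3 : pdim (projImage w Z) = ((m : ℕ∞) : WithBot ℕ∞) := by rw [proj_pdim L hF hw hcl hSF hne, hdim]
  have hYc := proj_closed L hF hw hcl (F_mem (le_refl Z) hF hSF) hne
  have hYn : (projImage w Z).Nonempty := by
    obtain ⟨z, hz⟩ := hirr.1
    obtain ⟨c, hc, e⟩ := rep_mk (hne z hz)
    exact ⟨_, z, hz, c, hc, e⟩
  have hYp : (idealOf (projImage w Z)).IsPrime := by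
    rw [idealOf_proj hne]; exact Ideal.comap_isPrime _ _
  have h2 := zak hYc hYn h1 (proj_nondeg hs hnd hne) h3 (by omega)
  exact ⟨h1, h2, h3, by omega, not_isc hcl hirr hsm hnd hdim hseveri L hF hw hSF hne h2⟩


end
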